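/- Let f satisfy (H) with τ₋ = τ₊ =: τ and 0 < τ ≤ 1.57863, and let Ω be an arbitrary bounded smooth domain in ℝⁿ with n ≤ 7. Then any sequence (u_m) of semistable solutions of (N_{λ_m}) satisfying the stability inequality obeys sup_m ‖u_m‖_{L^∞(Ω)} < a_f. -/

import Mathlib

open MeasureTheory Filter Topology Real Set

noncomputable section

/-- The Laplacian of a real-valued function on Euclidean space. -/
def lap {n : ℕ} (u : EuclideanSpace ℝ (Fin n) → ℝ) (x : EuclideanSpace ℝ (Fin n)) : ℝ :=
  ∑ i : Fin n, iteratedFDeriv ℝ 2 u x ![EuclideanSpace.single i (1:ℝ), EuclideanSpace.single i (1:ℝ)]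

/-- A bounded (smooth) domain. -/
def GoodDomain {n : ℕ} (Ω : Set (EuclideanSpace ℝ (Fin n))) : Prop :=
  IsOpen Ω ∧ Bornology.IsBounded Ω ∧ Ω.Nonempty

/-- The domain `[0, a_f)` of the nonlinearity. -/
def domf (a : EReal) : Set ℝ := {t : ℝ | 0 ≤ t ∧ (t : EReal) < a}

/-- The filter of `t → a_f⁻`. -/
def afFilter (a : EReal) : Filter ℝ :=
  if a = ⊤ then Filter.atTop else nhdsWithin a.toReal (Set.Iio a.toReal)

/-- Hypothesis (H) on the nonlinearity `f : [0, a_f) → ℝ₊`. -/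
structure HypH (a : EReal) (f : ℝ → ℝ) : Prop where
  a_pos : 0 < a
  smooth : ContDiffOn ℝ (⊤ : ℕ∞) f (domf a)
  mono : StrictMonoOn f (domf a)
  convex : ConvexOn ℝ (domf a) f
  f0_pos : 0 < f 0
  pos : ∀ t ∈ domf a, 0 < f t
  blowup : Filter.Tendsto f (afFilter a) Filter.atTop
  superlinear : a = ⊤ → Filter.Tendsto (fun t => f t / t) Filter.atTop Filter.atTop

/-- `τ₋ = liminf_{t → a_f} f f'' / (f')²`. -/
def tauMinus (a : EReal) (f : ℝ → ℝ) : ℝ :=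
  Filter.liminf (fun t => f t * deriv (deriv f) t / (deriv f t) ^ 2) (afFilter a)

/-- `τ₊ = limsup_{t → a_f} f f'' / (f')²`. -/
def tauPlus (a : EReal) (f : ℝ → ℝ) : ℝ :=
  Filter.limsup (fun t => f t * deriv (deriv f) t / (deriv f t) ^ 2) (afFilter a)

/-- `u` is a (smooth, `[0,a_f)`-valued) solution of `Δ²u = λ f(u)` in `Ω`,
`u = Δu = 0` on `∂Ω`. -/
def Solves {n : ℕ} (Ω : Set (EuclideanSpace ℝ (Fin n))) (a : EReal) (lam : ℝ)
    (f : ℝ → ℝ) (u : EuclideanSpace ℝ (Fin n) → ℝ) : Prop :=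
  ContDiff ℝ (⊤ : ℕ∞) u ∧ (∀ x ∈ Ω, 0 ≤ u x ∧ (u x : EReal) < a) ∧
  (∀ x ∈ Ω, lap (lap u) x = lam * f (u x)) ∧
  (∀ x ∈ frontier Ω, u x = 0) ∧ (∀ x ∈ frontier Ω, lap u x = 0)

/-- `u` is a semistable solution: the second variation is nonnegative over
test functions in `H² ∩ H¹₀` (modelled by smooth functions vanishing on `∂Ω`). -/
def Semistable {n : ℕ} (Ω : Set (EuclideanSpace ℝ (Fin n))) (lam : ℝ)
    (f : ℝ → ℝ) (u : EuclideanSpace ℝ (Fin n) → ℝ) : Prop :=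
  ∀ φ : EuclideanSpace ℝ (Fin n) → ℝ, ContDiff ℝ (⊤ : ℕ∞) φ → (∀ x ∈ frontier Ω, φ x = 0) →
    0 ≤ ∫ x in Ω, ((lap φ x) ^ 2 - lam * deriv f (u x) * (φ x) ^ 2)

/-- `u` satisfies the stability inequality
`√λ ∫ √(f'(u)) φ² ≤ ∫ |∇φ|²` for all `φ ∈ H¹₀(Ω)`
(modelled by smooth compactly supported test functions). -/
def StabIneq {n : ℕ} (Ω : Set (EuclideanSpace ℝ (Fin n))) (lam : ℝ)
    (f : ℝ → ℝ) (u : EuclideanSpace ℝ (Fin n) → ℝ) : Prop :=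
  ∀ φ : EuclideanSpace ℝ (Fin n) → ℝ, ContDiff ℝ (⊤ : ℕ∞) φ → HasCompactSupport φ →
    tsupport φ ⊆ Ω →
    Real.sqrt lam * ∫ x in Ω, Real.sqrt (deriv f (u x)) * (φ x) ^ 2 ≤
      ∫ x in Ω, ‖gradient φ x‖ ^ 2

/-- The quartic polynomial `P_f(α, τ₋, τ₊)`. -/
def Pf (τm τp α : ℝ) : ℝ :=
  (2 - τm) ^ 2 * α ^ 4 - 8 * (2 - τp) * α ^ 2 + 4 * (4 - 3 * τp) * α - 4 * (1 - τp)

/-- `F(t) = ∫₀ᵗ f(s) ds`. -/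
def Fint (f : ℝ → ℝ) (t : ℝ) : ℝ := ∫ s in (0:ℝ)..t, f s

/-- `f̃(t) = f(t) - f(0)`. -/
def ftil (f : ℝ → ℝ) (t : ℝ) : ℝ := f t - f 0

/-- `Θ(t) = ∫₀ᵗ θ'(s)² ds`. -/
def Theta (θ : ℝ → ℝ) (t : ℝ) : ℝ := ∫ s in (0:ℝ)..t, (deriv θ s) ^ 2


variable {n : ℕ}


abbrev ee (i : Fin n) : EuclideanSpace ℝ (Fin n) := EuclideanSpace.single i (1:ℝ)

lemma two_le_inf : (2 : WithTop ℕ∞) ≤ ((⊤ : ℕ∞) : WithTop ℕ∞) := by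
  have := WithTop.coe_le_coe.2 (le_top : (2 : ℕ∞) ≤ ⊤)
  exact this

lemma one_le_inf : (1 : WithTop ℕ∞) ≤ ((⊤ : ℕ∞) : WithTop ℕ∞) := by
  have := WithTop.coe_le_coe.2 (le_top : (1 : ℕ∞) ≤ ⊤)
  exact this

lemma inf_ne_zero' : ((⊤ : ℕ∞) : WithTop ℕ∞) ≠ 0 := by simp

lemma contDiffAt_deriv {ψ : ℝ → ℝ} {t : ℝ} {m k : WithTop ℕ∞} (h : ContDiffAt ℝ k ψ t)
    (hm : m + 1 ≤ k) : ContDiffAt ℝ m (deriv ψ) t := by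
  have : deriv ψ = fun t => fderiv ℝ ψ t 1 := by ext; simp
  rw [this]
  exact (h.fderiv_right hm).clm_apply contDiffAt_const

lemma lap_eq {u : EuclideanSpace ℝ (Fin n) → ℝ} {x} (hu : ContDiffAt ℝ 2 u x) :
    lap u x = ∑ i, fderiv ℝ (fun y => fderiv ℝ u y (ee i)) x (ee i) := by
  unfold lap
  refine Finset.sum_congr rfl fun i _ => ?_
  rw [iteratedFDeriv_two_apply]
  have h1 : DifferentiableAt ℝ (fderiv ℝ u) x :=
    (hu.fderiv_right (m := 1) (by norm_num)).differentiableAt (by norm_num)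
  rw [fderiv_clm_apply h1 (by fun_prop)]
  simp

lemma lap_congr {u v : EuclideanSpace ℝ (Fin n) → ℝ} {x} (h : u =ᶠ[𝓝 x] v) :
    lap u x = lap v x := by
  unfold lap
  rw [(h.iteratedFDeriv ℝ 2).eq_of_nhds]

lemma contDiff_lap {u : EuclideanSpace ℝ (Fin n) → ℝ} (hu : ContDiff ℝ (⊤ : ℕ∞) u) :
    ContDiff ℝ (⊤ : ℕ∞) (lap u) := by
  have : lap u = fun x => ∑ i, fderiv ℝ (fun y => fderiv ℝ u y (ee i)) x (ee i) := by
    ext x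
    exact lap_eq (hu.contDiffAt.of_le two_le_inf)
  rw [this]
  refine ContDiff.sum fun i _ => ?_
  have h1 : ContDiff ℝ (⊤ : ℕ∞) (fun y => fderiv ℝ u y (ee i)) :=
    (hu.fderiv_right (m := (⊤ : ℕ∞)) (by simp)).clm_apply contDiff_const
  exact (h1.fderiv_right (m := (⊤ : ℕ∞)) (by simp)).clm_apply contDiff_const

lemma lap_comp {Z : EuclideanSpace ℝ (Fin n) → ℝ} {ψ : ℝ → ℝ} {x}
    (hZ : ContDiffAt ℝ 2 Z x) (hψ : ContDiffAt ℝ 2 ψ (Z x)) :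
    lap (fun y => ψ (Z y)) x = deriv ψ (Z x) * lap Z x
      + deriv (deriv ψ) (Z x) * ∑ i, (fderiv ℝ Z x (ee i)) ^ 2 := by
  have hc : ContDiffAt ℝ 2 (fun y => ψ (Z y)) x := hψ.comp x hZ
  rw [lap_eq hc, lap_eq hZ, Finset.mul_sum, Finset.mul_sum, ← Finset.sum_add_distrib]
  refine Finset.sum_congr rfl fun i _ => ?_
  have e1 : ∀ᶠ y in 𝓝 x, ContDiffAt ℝ 2 Z y := hZ.eventually (by simp)
  have e2 : ∀ᶠ y in 𝓝 x, ContDiffAt ℝ 2 ψ (Z y) :=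
    hZ.continuousAt.eventually (hψ.eventually (by simp))
  have e3 : (fun y => fderiv ℝ (fun z => ψ (Z z)) y (ee i)) =ᶠ[𝓝 x]
      fun y => deriv ψ (Z y) * fderiv ℝ Z y (ee i) := by
    filter_upwards [e1, e2] with y h1 h2
    have := (h2.differentiableAt (by norm_num)).hasDerivAt.comp_hasFDerivAt y
      (h1.differentiableAt (by norm_num)).hasFDerivAt
    have h3 := this.fderiv
    simp only [Function.comp_def] at h3
    rw [h3]; simp
  rw [e3.fderiv_eq]
  have d1 : HasDerivAt (deriv ψ) (deriv (deriv ψ) (Z x)) (Z x) := by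
    have h0 : ContDiffAt ℝ 1 (deriv ψ) (Z x) := contDiffAt_deriv hψ (by norm_num)
    exact (h0.differentiableAt (by norm_num)).hasDerivAt
  have d2 := d1.comp_hasFDerivAt x (hZ.differentiableAt (by norm_num)).hasFDerivAt
  have d3 : DifferentiableAt ℝ (fun y => fderiv ℝ Z y (ee i)) x :=
    ((hZ.fderiv_right (m := 1) (by norm_num)).clm_apply contDiffAt_const).differentiableAt
      (by norm_num)
  have := (d2.mul d3.hasFDerivAt).fderiv
  simp only [Function.comp_def] at this
  erw [this]
  simp; ring

lemma norm_gradient_sq {φ : EuclideanSpace ℝ (Fin n) → ℝ} {x} :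
    ‖gradient φ x‖ ^ 2 = ∑ i, (fderiv ℝ φ x (ee i)) ^ 2 := by
  rw [EuclideanSpace.norm_sq_eq]
  refine Finset.sum_congr rfl fun i _ => ?_
  have : (gradient φ x) i = fderiv ℝ φ x (ee i) := by
    have h1 : inner ℝ (gradient φ x) (ee i) = fderiv ℝ φ x (ee i) := by
      unfold gradient
      rw [InnerProductSpace.toDual_symm_apply]
    rw [← h1, EuclideanSpace.inner_single_right]
    simp
  rw [this]; simp


lemma contDiff_one_fderiv_cont {φ : EuclideanSpace ℝ (Fin n) → ℝ} (hφ : ContDiff ℝ 1 φ)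
    (v : EuclideanSpace ℝ (Fin n)) : Continuous (fun x => fderiv ℝ φ x v) :=
  (hφ.continuous_fderiv (by norm_num)).clm_apply continuous_const

lemma hcs_fderiv {φ : EuclideanSpace ℝ (Fin n) → ℝ} (hc : HasCompactSupport φ)
    (v : EuclideanSpace ℝ (Fin n)) : HasCompactSupport (fun x => fderiv ℝ φ x v) :=
  (hc.fderiv (𝕜 := ℝ)).comp_left (g := fun L : EuclideanSpace ℝ (Fin n) →L[ℝ] ℝ => L v) (by simp)

/-- Green's identity. -/
lemma green {φ u : EuclideanSpace ℝ (Fin n) → ℝ} (hφ : ContDiff ℝ 1 φ)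
    (hc : HasCompactSupport φ) (hu : ContDiff ℝ 2 u) :
    ∫ x, φ x * lap u x = - ∫ x, ∑ i, fderiv ℝ φ x (ee i) * fderiv ℝ u x (ee i) := by
  have hp : ∀ i : Fin n, ContDiff ℝ 1 (fun y => fderiv ℝ u y (ee i)) := fun i =>
    (hu.fderiv_right (m := 1) (by norm_num)).clm_apply contDiff_const
  have h1 : ∀ x, φ x * lap u x =
      ∑ i, φ x * fderiv ℝ (fun y => fderiv ℝ u y (ee i)) x (ee i) := fun x => by
    rw [lap_eq hu.contDiffAt, Finset.mul_sum]
  have i1 : ∀ i : Fin n, Integrable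
      (fun x => φ x * fderiv ℝ (fun y => fderiv ℝ u y (ee i)) x (ee i)) := fun i =>
    (hφ.continuous.mul (contDiff_one_fderiv_cont (hp i) _)).integrable_of_hasCompactSupport
      hc.mul_right
  have i2 : ∀ i : Fin n, Integrable
      (fun x => fderiv ℝ φ x (ee i) * fderiv ℝ u x (ee i)) := fun i =>
    ((contDiff_one_fderiv_cont hφ _).mul (hp i).continuous).integrable_of_hasCompactSupport
      (hcs_fderiv hc _).mul_right
  have i3 : ∀ i : Fin n, Integrable (fun x => φ x * fderiv ℝ u x (ee i)) := fun i =>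
    (hφ.continuous.mul (hp i).continuous).integrable_of_hasCompactSupport hc.mul_right
  simp_rw [h1]
  rw [integral_finsetSum _ (fun i _ => i1 i), integral_finsetSum _ (fun i _ => i2 i),
    ← Finset.sum_neg_distrib]
  refine Finset.sum_congr rfl fun i _ => ?_
  exact integral_mul_fderiv_eq_neg_fderiv_mul_of_integrable (i2 i) (i1 i) (i3 i)
    (fun x _ => (hφ.differentiable (by norm_num)) x)
    (fun x _ => ((hp i).differentiable (by norm_num)) x)

/-- Green's identity, second version. -/
lemma green' {φ u : EuclideanSpace ℝ (Fin n) → ℝ} (hφ : ContDiff ℝ 1 φ)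
    (hc : HasCompactSupport u) (hu : ContDiff ℝ 2 u) :
    ∫ x, φ x * lap u x = - ∫ x, ∑ i, fderiv ℝ φ x (ee i) * fderiv ℝ u x (ee i) := by
  have hp : ∀ i : Fin n, ContDiff ℝ 1 (fun y => fderiv ℝ u y (ee i)) := fun i =>
    (hu.fderiv_right (m := 1) (by norm_num)).clm_apply contDiff_const
  have h1 : ∀ x, φ x * lap u x =
      ∑ i, φ x * fderiv ℝ (fun y => fderiv ℝ u y (ee i)) x (ee i) := fun x => by
    rw [lap_eq hu.contDiffAt, Finset.mul_sum]
  have i1 : ∀ i : Fin n, Integrable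
      (fun x => φ x * fderiv ℝ (fun y => fderiv ℝ u y (ee i)) x (ee i)) := fun i =>
    (hφ.continuous.mul (contDiff_one_fderiv_cont (hp i) _)).integrable_of_hasCompactSupport
      (hcs_fderiv (hcs_fderiv hc _) _).mul_left
  have i2 : ∀ i : Fin n, Integrable
      (fun x => fderiv ℝ φ x (ee i) * fderiv ℝ u x (ee i)) := fun i =>
    ((contDiff_one_fderiv_cont hφ _).mul (hp i).continuous).integrable_of_hasCompactSupport
      (hcs_fderiv hc _).mul_left
  have i3 : ∀ i : Fin n, Integrable (fun x => φ x * fderiv ℝ u x (ee i)) := fun i =>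
    (hφ.continuous.mul (hp i).continuous).integrable_of_hasCompactSupport (hcs_fderiv hc _).mul_left
  simp_rw [h1]
  rw [integral_finsetSum _ (fun i _ => i1 i), integral_finsetSum _ (fun i _ => i2 i),
    ← Finset.sum_neg_distrib]
  refine Finset.sum_congr rfl fun i _ => ?_
  exact integral_mul_fderiv_eq_neg_fderiv_mul_of_integrable (i2 i) (i1 i) (i3 i)
    (fun x _ => (hφ.differentiable (by norm_num)) x)
    (fun x _ => ((hp i).differentiable (by norm_num)) x)

lemma loc_eventually {Ω : Set (EuclideanSpace ℝ (Fin n))} (hΩ : IsOpen Ω)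
    (q : EuclideanSpace ℝ (Fin n) → ℝ) {x} (hx : x ∈ Ω) : Ω.indicator q =ᶠ[𝓝 x] q := by
  filter_upwards [hΩ.mem_nhds hx] with y hy
  simp [hy]

lemma loc_supp {Ω K : Set (EuclideanSpace ℝ (Fin n))} (hK : IsCompact K)
    {q : EuclideanSpace ℝ (Fin n) → ℝ} (h0 : ∀ x ∈ Ω, x ∉ K → q x = 0) :
    tsupport (Ω.indicator q) ⊆ K := by
  refine closure_minimal ?_ hK.isClosed
  intro x hx
  by_contra hxK
  apply hx
  by_cases hxΩ : x ∈ Ω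
  · simp [hxΩ, h0 x hxΩ hxK]
  · simp [hxΩ]

lemma loc_hcs {Ω K : Set (EuclideanSpace ℝ (Fin n))} (hK : IsCompact K)
    {q : EuclideanSpace ℝ (Fin n) → ℝ} (h0 : ∀ x ∈ Ω, x ∉ K → q x = 0) :
    HasCompactSupport (Ω.indicator q) :=
  hK.of_isClosed_subset (isClosed_tsupport _) (loc_supp hK h0)

lemma loc_contDiff {Ω K : Set (EuclideanSpace ℝ (Fin n))} (hΩ : IsOpen Ω) (hK : IsCompact K)
    (hKΩ : K ⊆ Ω) {k : WithTop ℕ∞} {q : EuclideanSpace ℝ (Fin n) → ℝ}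
    (hq : ∀ x ∈ Ω, ContDiffAt ℝ k q x)
    (h0 : ∀ x ∈ Ω, x ∉ K → q x = 0) : ContDiff ℝ k (Ω.indicator q) := by
  rw [contDiff_iff_contDiffAt]
  intro x
  by_cases hx : x ∈ Ω
  · exact (hq x hx).congr_of_eventuallyEq (loc_eventually hΩ q hx)
  · have hxK : x ∉ K := fun h => hx (hKΩ h)
    have : Ω.indicator q =ᶠ[𝓝 x] fun _ => 0 := by
      filter_upwards [hK.isClosed.isOpen_compl.mem_nhds hxK] with y hy
      by_cases hyΩ : y ∈ Ω
      · simp [hyΩ, h0 y hyΩ hy]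
      · simp [hyΩ]
    exact contDiffAt_const.congr_of_eventuallyEq this

lemma superlevel_compact {Ω : Set (EuclideanSpace ℝ (Fin n))}
    (hb : Bornology.IsBounded Ω) {u : EuclideanSpace ℝ (Fin n) → ℝ} (hu : Continuous u) (c : ℝ) :
    IsCompact (closure Ω ∩ {x | c ≤ u x}) :=
  hb.isCompact_closure.inter_right (isClosed_le continuous_const hu)

lemma superlevel_sub {Ω : Set (EuclideanSpace ℝ (Fin n))} (hΩ : IsOpen Ω)
    {u : EuclideanSpace ℝ (Fin n) → ℝ} {c : ℝ} (hc : 0 < c)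
    (h0 : ∀ x ∈ frontier Ω, u x = 0) : closure Ω ∩ {x | c ≤ u x} ⊆ Ω := by
  rintro x ⟨hx, hcx⟩
  by_contra hxΩ
  have : x ∈ frontier Ω := by
    rw [frontier, hΩ.interior_eq]; exact ⟨hx, hxΩ⟩
  have := h0 x this
  simp at hcx
  linarith

/-- The energy identity. -/
lemma energy {Ω K : Set (EuclideanSpace ℝ (Fin n))} (hΩ : IsOpen Ω) (hK : IsCompact K)
    (hKΩ : K ⊆ Ω) {u : EuclideanSpace ℝ (Fin n) → ℝ} (hu : ContDiff ℝ (⊤ : ℕ∞) u)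
    {η F : ℝ → ℝ} (hη : ∀ x ∈ Ω, ContDiffAt ℝ (⊤ : ℕ∞) η (u x))
    (hF : ∀ x ∈ Ω, ContDiffAt ℝ 1 F (u x)) (hd : ∀ x ∈ Ω, deriv F (u x) = deriv η (u x) ^ 2)
    (h2 : ∀ x ∈ Ω, x ∉ K → F (u x) = 0) :
    ∫ x in Ω, ‖gradient (Ω.indicator (fun x => η (u x))) x‖ ^ 2
      = ∫ x in Ω, F (u x) * (- lap u x) := by
  have hu2 : ContDiff ℝ 2 u := hu.of_le two_le_inf
  have hu1 : ContDiff ℝ 1 u := hu.of_le one_le_inf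
  have hC : ContDiff ℝ 1 (Ω.indicator (fun x => F (u x))) :=
    loc_contDiff hΩ hK hKΩ (fun x hx => (hF x hx).comp x hu1.contDiffAt) h2
  have G := green hC (loc_hcs hK h2) hu2
  have l1 : ∫ x in Ω, F (u x) * (- lap u x) = - ∫ x, Ω.indicator (fun x => F (u x)) x * lap u x := by
    rw [← integral_indicator hΩ.measurableSet, ← integral_neg]
    congr 1; ext x
    by_cases hx : x ∈ Ω <;> simp [hx]
  rw [l1, G, neg_neg, ← integral_indicator hΩ.measurableSet]
  congr 1; ext x
  by_cases hx : x ∈ Ω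
  · have f1 : ∀ i, fderiv ℝ (Ω.indicator (fun x => F (u x))) x (ee i)
        = deriv F (u x) * fderiv ℝ u x (ee i) := fun i => by
      rw [(loc_eventually hΩ _ hx).fderiv_eq]
      have := ((hF x hx).differentiableAt (by norm_num)).hasDerivAt.comp_hasFDerivAt x
        ((hu1.differentiable (by norm_num)) x).hasFDerivAt
      have h3 := this.fderiv
      simp only [Function.comp_def] at h3
      rw [h3]; simp
    have f2 : ∀ i, fderiv ℝ (Ω.indicator (fun x => η (u x))) x (ee i)
        = deriv η (u x) * fderiv ℝ u x (ee i) := fun i => by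
      rw [(loc_eventually hΩ _ hx).fderiv_eq]
      have := ((hη x hx).differentiableAt inf_ne_zero').hasDerivAt.comp_hasFDerivAt x
        ((hu1.differentiable (by norm_num)) x).hasFDerivAt
      have h3 := this.fderiv
      simp only [Function.comp_def] at h3
      rw [h3]; simp
    simp only [hx, indicator_of_mem, norm_gradient_sq, f1, f2, hd x hx]
    refine Finset.sum_congr rfl fun i _ => ?_
    ring
  · have hxK : x ∉ K := fun h => hx (hKΩ h)
    have f1 : ∀ i, fderiv ℝ (Ω.indicator (fun x => F (u x))) x (ee i) = 0 := fun i => by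
      rw [fderiv_of_notMem_tsupport (𝕜 := ℝ) (fun h => hxK (loc_supp hK h2 h))]; simp
    simp [hx, f1]

/-- Poincaré's inequality. -/
lemma poincare {R : ℝ} (hn : 0 < n) {φ : EuclideanSpace ℝ (Fin n) → ℝ} (hφ : ContDiff ℝ 1 φ)
    (hc : HasCompactSupport φ) (hR : 0 < R) (hs : ∀ x, φ x ≠ 0 → ‖x‖ ≤ R) :
    ∫ x, φ x ^ 2 ≤ 4 * R ^ 2 * ∫ x, ‖gradient φ x‖ ^ 2 := by
  let i : Fin n := ⟨0, hn⟩
  have hx : ContDiff ℝ 1 (fun x : EuclideanSpace ℝ (Fin n) => x i) := by fun_prop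
  have hφ2 : ContDiff ℝ 1 (fun x => φ x ^ 2) := hφ.pow 2
  have hc2 : HasCompactSupport (fun x => φ x ^ 2) := hc.comp_left (g := fun t => t ^ 2) (by simp)
  have dx : ∀ x, fderiv ℝ (fun x : EuclideanSpace ℝ (Fin n) => x i) x (ee i) = 1 := fun x => by
    have : HasFDerivAt (fun x : EuclideanSpace ℝ (Fin n) => x i)
      (EuclideanSpace.proj i : EuclideanSpace ℝ (Fin n) →L[ℝ] ℝ) x :=
      (EuclideanSpace.proj i : EuclideanSpace ℝ (Fin n) →L[ℝ] ℝ).hasFDerivAt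
    rw [this.fderiv]; simp
  have dφ : ∀ x, fderiv ℝ (fun x => φ x ^ 2) x (ee i) = 2 * φ x * fderiv ℝ φ x (ee i) := fun x => by
    have := ((hφ.differentiable (by norm_num)) x).hasFDerivAt.pow 2
    rw [this.fderiv]; simp
  have key := integral_mul_fderiv_eq_neg_fderiv_mul_of_integrable (μ := volume)
    (f := fun x => φ x ^ 2) (g := fun x : EuclideanSpace ℝ (Fin n) => x i) (v := ee i)
    (((contDiff_one_fderiv_cont hφ2 _).mul hx.continuous).integrable_of_hasCompactSupport
      (hcs_fderiv hc2 _).mul_right)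
    ((hφ2.continuous.mul (contDiff_one_fderiv_cont hx _)).integrable_of_hasCompactSupport
      hc2.mul_right)
    ((hφ2.continuous.mul hx.continuous).integrable_of_hasCompactSupport
      hc2.mul_right)
    (fun x _ => (hφ2.differentiable (by norm_num)) x)
    (fun x _ => (hx.differentiable (by norm_num)) x)
  simp only [dx, mul_one, dφ] at key
  rw [← integral_neg] at key
  have I1 : Integrable (fun x => φ x ^ 2) :=
    hφ2.continuous.integrable_of_hasCompactSupport hc2
  have I2 : Integrable (fun x => ‖gradient φ x‖ ^ 2) := by
    simp_rw [norm_gradient_sq]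
    refine integrable_finsetSum _ fun j _ => ?_
    have hh : HasCompactSupport (fun x => fderiv ℝ φ x (ee j) * fderiv ℝ φ x (ee j)) :=
      (hcs_fderiv hc _).mul_right
    have := ((contDiff_one_fderiv_cont hφ (ee j)).mul
      (contDiff_one_fderiv_cont hφ (ee j))).integrable_of_hasCompactSupport (μ := volume) hh
    refine this.congr (Eventually.of_forall fun x => ?_)
    simp only [Pi.mul_apply]; ring
  have I3 : Integrable (fun x => -(2 * φ x * fderiv ℝ φ x (ee i) * x i)) := by
    have hh : HasCompactSupport (fun x => φ x * (fderiv ℝ φ x (ee i) * x i)) := hc.mul_right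
    have := ((hφ.continuous.mul ((contDiff_one_fderiv_cont hφ (ee i)).mul
      hx.continuous))).integrable_of_hasCompactSupport (μ := volume) hh
    refine (this.const_mul (-2)).congr (Eventually.of_forall fun x => ?_)
    simp only [Pi.mul_apply]; ring
  have le : ∫ x, -(2 * φ x * fderiv ℝ φ x (ee i) * x i)
      ≤ ∫ x, (1 / 2 * φ x ^ 2 + 2 * R ^ 2 * ‖gradient φ x‖ ^ 2) := by
    refine integral_mono I3 ((I1.const_mul _).add (I2.const_mul _)) fun x => ?_
    by_cases h0 : φ x = 0
    · simp only [h0]; simp; positivity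
    · have hxR : (x i) ^ 2 ≤ R ^ 2 := by
        have h1 : ‖x i‖ ≤ ‖x‖ := PiLp.norm_apply_le x i
        have h2 := hs x h0
        rw [Real.norm_eq_abs] at h1
        exact sq_le_sq' (by linarith [neg_abs_le (x i)]) (by linarith [le_abs_self (x i)])
      have hg : (fderiv ℝ φ x (ee i)) ^ 2 ≤ ‖gradient φ x‖ ^ 2 := by
        rw [norm_gradient_sq]
        exact Finset.single_le_sum (f := fun j => (fderiv ℝ φ x (ee j)) ^ 2)
          (fun j _ => sq_nonneg _) (Finset.mem_univ i)
      have h3 : (x i) ^ 2 * (fderiv ℝ φ x (ee i)) ^ 2 ≤ R ^ 2 * ‖gradient φ x‖ ^ 2 := by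
        gcongr
      simp only
      nlinarith [sq_nonneg (φ x + 2 * (x i * fderiv ℝ φ x (ee i)))]
  rw [← key, integral_add (I1.const_mul _) (I2.const_mul _), integral_const_mul,
    integral_const_mul] at le
  linarith

/-- At a local minimum the Laplacian is nonnegative. -/
lemma lap_nonneg_of_isLocalMin {u : EuclideanSpace ℝ (Fin n) → ℝ} {x}
    (hu : ContDiffAt ℝ 2 u x) (hm : IsLocalMin u x) : 0 ≤ lap u x := by
  rw [lap_eq hu]
  refine Finset.sum_nonneg fun i _ => ?_
  by_contra hneg
  push Not at hneg
  set g : ℝ → ℝ := fun t => u (x + t • ee i) with hg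
  have hl : ∀ t : ℝ, HasDerivAt (fun t : ℝ => x + t • ee i) (ee i) t := fun t => by
    simpa using ((hasDerivAt_id t).smul_const (ee i)).const_add x
  have c0 : Tendsto (fun t : ℝ => x + t • ee i) (𝓝 0) (𝓝 x) := by
    have := (hl 0).continuousAt.tendsto
    simpa using this
  have e1 : ∀ᶠ y in 𝓝 x, ContDiffAt ℝ 2 u y := hu.eventually (by simp)
  have d1 : deriv g =ᶠ[𝓝 0] fun t => fderiv ℝ u (x + t • ee i) (ee i) := by
    filter_upwards [c0.eventually e1] with t ht
    exact ((ht.differentiableAt (by norm_num)).hasFDerivAt.comp_hasDerivAt t (hl t)).deriv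
  have d3 : DifferentiableAt ℝ (fun y => fderiv ℝ u y (ee i)) x :=
    ((hu.fderiv_right (m := 1) (by norm_num)).clm_apply contDiffAt_const).differentiableAt
      (by norm_num)
  have d2 : deriv (deriv g) 0 = fderiv ℝ (fun y => fderiv ℝ u y (ee i)) x (ee i) := by
    rw [d1.deriv_eq]
    have hx0 : x + (0:ℝ) • ee i = x := by simp
    have h' : HasFDerivAt (fun y => fderiv ℝ u y (ee i))
        (fderiv ℝ (fun y => fderiv ℝ u y (ee i)) x) (x + (0:ℝ) • ee i) := by
      rw [hx0]; exact d3.hasFDerivAt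
    exact (h'.comp_hasDerivAt 0 (hl 0)).deriv
  have hgmin : IsLocalMin g 0 := by
    have := c0.eventually hm
    filter_upwards [this] with t ht
    simpa [hg] using ht
  have hg0 : deriv g 0 = 0 := hgmin.deriv_eq_zero
  have hgc : ContinuousAt g 0 := by
    have h' : ContinuousAt u (x + (0:ℝ) • ee i) := by simpa using hu.continuousAt
    exact ContinuousAt.comp (f := fun t : ℝ => x + t • ee i) h' (hl 0).continuousAt
  rw [← d2] at hneg
  have hgmax := isLocalMax_of_deriv_deriv_neg hneg hg0 hgc
  have hconst : g =ᶠ[𝓝 0] fun _ => g 0 := by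
    filter_upwards [hgmin, hgmax] with t h1 h2
    exact le_antisymm h2 h1
  have : deriv g =ᶠ[𝓝 0] fun _ => 0 := by
    have := hconst.deriv
    simpa using this
  have h0 : deriv (deriv g) 0 = 0 := by rw [this.deriv_eq]; simp
  linarith

/-- Minimum principle for strict supersolutions. -/
lemma min_principle {U : Set (EuclideanSpace ℝ (Fin n))} (hU : IsOpen U)
    (hb : Bornology.IsBounded U) {v : EuclideanSpace ℝ (Fin n) → ℝ} (hv : ContDiff ℝ 2 v)
    (hl : ∀ x ∈ U, lap v x < 0) (h0 : ∀ x ∈ frontier U, 0 ≤ v x) :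
    ∀ x ∈ U, 0 ≤ v x := by
  intro x hx
  obtain ⟨y, hy, hmin⟩ := hb.isCompact_closure.exists_isMinOn ⟨x, subset_closure hx⟩
    hv.continuous.continuousOn
  have hyx : v y ≤ v x := hmin (subset_closure hx)
  by_cases hyU : y ∈ U
  · exfalso
    have : IsLocalMin v y := by
      filter_upwards [hU.mem_nhds hyU] with z hz
      exact hmin (subset_closure hz)
    have := lap_nonneg_of_isLocalMin hv.contDiffAt this
    linarith [hl y hyU]
  · have : y ∈ frontier U := by
      rw [frontier, hU.interior_eq]; exact ⟨hy, hyU⟩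
    linarith [h0 y this]

lemma lap_normsq (hn : 0 < n) (x₀ x : EuclideanSpace ℝ (Fin n)) (φ : ℝ → ℝ) (c : ℝ)
    (hφ : ContDiffAt ℝ 2 φ (‖x - x₀‖ ^ 2 + c)) :
    lap (fun y => φ (‖y - x₀‖ ^ 2 + c)) x = 2 * n * deriv φ (‖x - x₀‖ ^ 2 + c)
      + 4 * ‖x - x₀‖ ^ 2 * deriv (deriv φ) (‖x - x₀‖ ^ 2 + c) := by
  have hs : ContDiff ℝ 2 (fun y : EuclideanSpace ℝ (Fin n) => ‖y - x₀‖ ^ 2 + c) := by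
    exact ((contDiff_id.sub contDiff_const).norm_sq ℝ).add contDiff_const
  have hfd : ∀ (y : EuclideanSpace ℝ (Fin n)) (i : Fin n),
      fderiv ℝ (fun y => ‖y - x₀‖ ^ 2 + c) y (ee i) = 2 * (y i - x₀ i) := by
    intro y i
    have h1 : HasFDerivAt (fun y : EuclideanSpace ℝ (Fin n) => y - x₀)
      (ContinuousLinearMap.id ℝ _) y := (hasFDerivAt_id y).sub_const x₀
    have := (h1.norm_sq.add_const c).fderiv
    rw [this]
    simp [EuclideanSpace.inner_single_right]
  have hl : lap (fun y => ‖y - x₀‖ ^ 2 + c) x = 2 * n := by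
    rw [lap_eq hs.contDiffAt]
    have : ∀ i : Fin n, fderiv ℝ (fun y => fderiv ℝ (fun y => ‖y - x₀‖ ^ 2 + c) y (ee i)) x (ee i)
        = 2 := by
      intro i
      simp_rw [hfd]
      have h2 : HasFDerivAt (fun x : EuclideanSpace ℝ (Fin n) => x i)
        (EuclideanSpace.proj i : EuclideanSpace ℝ (Fin n) →L[ℝ] ℝ) x :=
        (EuclideanSpace.proj i : EuclideanSpace ℝ (Fin n) →L[ℝ] ℝ).hasFDerivAt
      have h3 := ((h2.sub_const (x₀ i)).const_mul 2).fderiv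
      rw [h3]; simp
    rw [Finset.sum_congr rfl (fun i _ => this i)]
    simp; ring
  rw [lap_comp hs.contDiffAt hφ, hl]
  simp_rw [hfd]
  have : ∑ i, (2 * (x i - x₀ i)) ^ 2 = 4 * ‖x - x₀‖ ^ 2 := by
    rw [EuclideanSpace.norm_sq_eq, Finset.mul_sum]
    refine Finset.sum_congr rfl fun i _ => ?_
    simp; ring
  rw [this]; ring


lemma contDiffAt_of_deriv {k k' : ℝ → ℝ} {s : ℝ} {m : ℕ}
    (h : ∀ᶠ t in 𝓝 s, HasDerivAt k (k' t) t) (hk : ContDiffAt ℝ m k' s) :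
    ContDiffAt ℝ (m + 1) k s := by
  rw [contDiffAt_succ_iff_hasFDerivAt]
  refine ⟨fun t => ContinuousLinearMap.toSpanSingleton ℝ (k' t), ⟨_, h, fun t ht => ?_⟩, ?_⟩
  · have : HasDerivAt k (k' t) t := ht
    exact this.hasFDerivAt
  · have := (ContinuousLinearMap.toSpanSingletonCLE (𝕜 := ℝ) (E := ℝ)).contDiff.contDiffAt.comp s hk
    exact this

lemma contDiffAt_of_deriv_top {k k' : ℝ → ℝ} {s : ℝ}
    (h : ∀ᶠ t in 𝓝 s, HasDerivAt k (k' t) t) (hk : ContDiffAt ℝ (⊤ : ℕ∞) k' s) :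
    ContDiffAt ℝ (⊤ : ℕ∞) k s := by
  rw [contDiffAt_infty]
  intro m
  have h1 : ContDiffAt ℝ m k' s := hk.of_le (by exact_mod_cast le_top)
  exact (contDiffAt_of_deriv h h1).of_le (by exact_mod_cast Nat.le_succ m)

def kk (n : ℕ) (R s : ℝ) : ℝ := ∫ σ in s..R, σ ^ (-(n / 2 : ℝ))

lemma kk_deriv {R s : ℝ} (hs : 0 < s) (hR : 0 < R) :
    HasDerivAt (kk n R) (-(s ^ (-(n / 2 : ℝ)))) s := by
  have hcont : ContinuousOn (fun σ : ℝ => σ ^ (-(n / 2 : ℝ))) (Ioi 0) := fun t ht =>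
    (Real.continuousAt_rpow_const _ _ (Or.inl (ne_of_gt ht))).continuousWithinAt
  refine intervalIntegral.integral_hasDerivAt_left ?_ ?_ ?_
  · refine (hcont.mono ?_).intervalIntegrable
    intro t ht
    exact lt_of_lt_of_le (lt_min hs hR) ht.1
  · exact hcont.stronglyMeasurableAtFilter isOpen_Ioi s hs
  · exact Real.continuousAt_rpow_const _ _ (Or.inl hs.ne')

lemma kk_bound (hn : 0 < n) (hn7 : n ≤ 7) {R s : ℝ} (hs : 0 < s) (hsR : s ≤ R) :
    0 ≤ kk n R s ∧ kk n R s ≤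
      R ^ (1 - n / 7 : ℝ) / (5 * n / 14) * s ^ (-(5 * n / 14 : ℝ)) := by
  have hR : 0 < R := hs.trans_le hsR
  have hn0 : (0:ℝ) < n := by exact_mod_cast hn
  have hn7' : (n:ℝ) ≤ 7 := by exact_mod_cast hn7
  have hcont : ∀ r : ℝ, ContinuousOn (fun σ : ℝ => σ ^ r) (uIcc s R) := fun r t ht =>
    (Real.continuousAt_rpow_const _ _ (Or.inl (ne_of_gt
      (lt_of_lt_of_le (lt_min hs hR) ht.1)))).continuousWithinAt
  constructor
  · refine intervalIntegral.integral_nonneg hsR fun t ht => ?_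
    exact Real.rpow_nonneg (hs.le.trans ht.1) _
  · have h1 : kk n R s ≤ ∫ σ in s..R, R ^ (1 - n / 7 : ℝ) * σ ^ (-(5 * n / 14 : ℝ) - 1) := by
      refine intervalIntegral.integral_mono_on hsR (hcont _).intervalIntegrable
        ((hcont _).const_smul (R ^ (1 - n / 7 : ℝ))).intervalIntegrable fun t ht => ?_
      have ht0 : 0 < t := hs.trans_le ht.1
      have : t ^ (-(n / 2 : ℝ)) = t ^ (1 - n / 7 : ℝ) * t ^ (-(5 * n / 14 : ℝ) - 1) := by
        rw [← Real.rpow_add ht0]; congr 1; ring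
      rw [this]
      gcongr
      · linarith
      · exact ht.2
    refine h1.trans ?_
    rw [intervalIntegral.integral_const_mul, integral_rpow (Or.inr ⟨by
      have : 0 < (5 * n / 14 : ℝ) := by positivity
      linarith, fun h => absurd h.1 (not_le.2 (lt_min hs hR))⟩)]
    have e : (-(5 * n / 14 : ℝ) - 1 + 1) = -(5 * n / 14 : ℝ) := by ring
    rw [e]
    set b : ℝ := 5 * n / 14 with hb
    have hb0 : 0 < b := by positivity
    have e2 : (R ^ (-b) - s ^ (-b)) / (-b) ≤ s ^ (-b) / b := by
      rw [div_neg, ← neg_div, div_le_div_iff_of_pos_right hb0]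
      have := Real.rpow_nonneg hR.le (-b)
      linarith
    calc R ^ (1 - n / 7 : ℝ) * ((R ^ (-b) - s ^ (-b)) / (-b))
        ≤ R ^ (1 - n / 7 : ℝ) * (s ^ (-b) / b) :=
          mul_le_mul_of_nonneg_left e2 (Real.rpow_nonneg hR.le _)
      _ = _ := by ring

lemma kk_contDiffAt {R s : ℝ} (hs : 0 < s) (hR : 0 < R) : ContDiffAt ℝ 2 (kk n R) s := by
  have := contDiffAt_of_deriv (m := 1) (k := kk n R) (k' := fun s => -(s ^ (-(n / 2 : ℝ)))) (s := s)
    (by filter_upwards [lt_mem_nhds hs] with t ht using kk_deriv ht hR)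
    (by exact (Real.contDiffAt_rpow_const_of_ne hs.ne').neg)
  exact this.of_le (by norm_num)

lemma kk_deriv2 {R s : ℝ} (hs : 0 < s) (hR : 0 < R) :
    deriv (deriv (kk n R)) s = (n / 2 : ℝ) * s ^ (-(n / 2 : ℝ) - 1) := by
  have : deriv (kk n R) =ᶠ[𝓝 s] fun s => -(s ^ (-(n / 2 : ℝ))) := by
    filter_upwards [lt_mem_nhds hs] with t ht using (kk_deriv ht hR).deriv
  rw [this.deriv_eq]
  have := (Real.hasDerivAt_rpow_const (x := s) (p := -(n / 2 : ℝ)) (Or.inl hs.ne')).neg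
  have := this.deriv
  simp only [Pi.neg_def] at this
  rw [this]; ring

lemma lap_kernel (hn : 0 < n) {R δ : ℝ} (hR : 0 < R) (hδ : 0 < δ)
    (x y : EuclideanSpace ℝ (Fin n)) :
    lap (fun y => kk n R (‖y - x‖ ^ 2 + δ ^ 2)) y =
      -(2 * n * δ ^ 2 * (‖y - x‖ ^ 2 + δ ^ 2) ^ (-(n / 2 : ℝ) - 1)) := by
  have hs : 0 < ‖y - x‖ ^ 2 + δ ^ 2 := by positivity
  rw [lap_normsq hn x y (kk n R) _ (kk_contDiffAt hs hR), kk_deriv2 hs hR, (kk_deriv hs hR).deriv]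
  set s := ‖y - x‖ ^ 2 + δ ^ 2
  have e1 : s ^ (-(n / 2 : ℝ)) = s * s ^ (-(n / 2 : ℝ) - 1) := by
    rw [Real.rpow_sub_one hs.ne']; field_simp
  have e2 : ‖y - x‖ ^ 2 = s - δ ^ 2 := by simp [s]
  rw [e1, e2]; ring

lemma kernel_bound (hn : 0 < n) (hn7 : n ≤ 7) {D : ℝ} (hD : 0 < D) :
    ∃ C > 0, ∀ (Ω : Set (EuclideanSpace ℝ (Fin n))) (x : EuclideanSpace ℝ (Fin n)),
      IsOpen Ω → (∀ y ∈ Ω, ‖y - x‖ ≤ D) → ∀ H ρ : EuclideanSpace ℝ (Fin n) → ℝ,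
      ContDiff ℝ 2 H → HasCompactSupport H → tsupport H ⊆ Ω → (∀ y, 0 ≤ H y) →
      (∀ y ∈ Ω, 0 ≤ ρ y) → (∀ y ∈ Ω, -lap H y ≤ ρ y) →
      IntegrableOn (fun y => ‖y - x‖ ^ (-(5 * n / 7 : ℝ)) * ρ y) Ω →
      H x ≤ C * ∫ y in Ω, ‖y - x‖ ^ (-(5 * n / 7 : ℝ)) * ρ y := by
  have hn0 : (0:ℝ) < n := by exact_mod_cast hn
  set R := D ^ 2 + 1 with hRdef
  have hR : 0 < R := by positivity
  set C1 := R ^ (1 - n / 7 : ℝ) / (5 * n / 14) with hC1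
  have hC1p : 0 < C1 := by positivity
  set ω := (volume (Metric.ball (0 : EuclideanSpace ℝ (Fin n)) 1)).toReal with hω
  have hωp : 0 < ω := ENNReal.toReal_pos (Metric.measure_ball_pos _ _ one_pos).ne'
    measure_ball_lt_top.ne
  set c0 := n * (2:ℝ) ^ (-(n / 2 : ℝ) - 1) * ω with hc0
  have hc0p : 0 < c0 := by positivity
  refine ⟨C1 / c0, by positivity, ?_⟩
  intro Ω x hΩ hΩD H ρ hH hcH hsH hH0 hρ hHρ hI
  have hint0 : 0 ≤ ∫ y in Ω, ‖y - x‖ ^ (-(5 * n / 7 : ℝ)) * ρ y :=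
    setIntegral_nonneg hΩ.measurableSet fun y hy => mul_nonneg (by positivity) (hρ y hy)
  rcases (hH0 x).eq_or_lt with h0 | hpos
  · rw [← h0]; positivity
  -- choose δ
  have hev : ∀ᶠ y in 𝓝 x, H x / 2 < H y :=
    hH.continuous.continuousAt.eventually (lt_mem_nhds (by linarith))
  obtain ⟨δ', hδ', hball⟩ := Metric.eventually_nhds_iff_ball.1 hev
  set δ := min δ' 1 with hδ
  have hδp : 0 < δ := lt_min hδ' one_pos
  have hδ1 : δ ≤ 1 := min_le_right _ _
  set K : EuclideanSpace ℝ (Fin n) → ℝ := fun y => kk n R (‖y - x‖ ^ 2 + δ ^ 2) with hK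
  have hspos : ∀ y : EuclideanSpace ℝ (Fin n), 0 < ‖y - x‖ ^ 2 + δ ^ 2 := fun y => by positivity
  have hKs : ContDiff ℝ 2 K := by
    rw [contDiff_iff_contDiffAt]
    intro y
    have hs : ContDiffAt ℝ 2 (fun y : EuclideanSpace ℝ (Fin n) => ‖y - x‖ ^ 2 + δ ^ 2) y :=
      (((contDiff_id.sub contDiff_const).norm_sq ℝ).add contDiff_const).contDiffAt
    exact (kk_contDiffAt (hspos y) hR).comp y hs
  have g1 := green (hH.of_le (by norm_num)) hcH hKs
  have g2 := green' (hKs.of_le (by norm_num)) hcH hH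
  have g3 : ∫ y, H y * lap K y = ∫ y, K y * lap H y := by
    rw [g1, g2]; congr 2; ext y
    refine Finset.sum_congr rfl fun i _ => mul_comm _ _
  -- lower bound
  have hlapK : ∀ y, lap K y = -(2 * n * δ ^ 2 * (‖y - x‖ ^ 2 + δ ^ 2) ^ (-(n / 2 : ℝ) - 1)) :=
    fun y => lap_kernel hn hR hδp x y
  have hclap : Continuous (lap K) := by
    have : lap K = fun y => -(2 * n * δ ^ 2 * (‖y - x‖ ^ 2 + δ ^ 2) ^ (-(n / 2 : ℝ) - 1)) := by
      ext y; exact hlapK y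
    rw [this]
    refine (continuous_const.mul (Continuous.rpow_const (by fun_prop) fun y => ?_)).neg
    exact Or.inl (hspos y).ne'
  have low : c0 * H x ≤ ∫ y, H y * (-lap K y) := by
    have hnn : ∀ y, 0 ≤ H y * (-lap K y) := fun y => by
      rw [hlapK, neg_neg]
      exact mul_nonneg (hH0 y) (mul_nonneg (by positivity) (Real.rpow_nonneg (hspos y).le _))
    have hintg : Integrable (fun y => H y * (-lap K y)) :=
      (hH.continuous.mul hclap.neg).integrable_of_hasCompactSupport hcH.mul_right
    have b1 : ∫ y in Metric.ball x δ, H y * (-lap K y) ≤ ∫ y, H y * (-lap K y) :=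
      setIntegral_le_integral hintg (Eventually.of_forall hnn)
    refine le_trans ?_ b1
    have b2 : ∫ y in Metric.ball x δ, (H x / 2 * (2 * n * δ ^ 2 * (2 * δ ^ 2) ^ (-(n / 2 : ℝ) - 1)))
        ≤ ∫ y in Metric.ball x δ, H y * (-lap K y) := by
      refine setIntegral_mono_on (integrableOn_const measure_ball_lt_top.ne) hintg.integrableOn
        measurableSet_ball fun y hy => ?_
      rw [hlapK, neg_neg]
      have hyd : ‖y - x‖ < δ := by simpa [dist_eq_norm] using hy
      have hHy : H x / 2 ≤ H y := (hball y (Metric.ball_subset_ball (min_le_left _ _) hy)).le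
      have hle : ‖y - x‖ ^ 2 + δ ^ 2 ≤ 2 * δ ^ 2 := by nlinarith [norm_nonneg (y - x)]
      have : (2 * δ ^ 2) ^ (-(n / 2 : ℝ) - 1) ≤ (‖y - x‖ ^ 2 + δ ^ 2) ^ (-(n / 2 : ℝ) - 1) := by
        apply Real.rpow_le_rpow_of_nonpos (hspos y) hle
        have : (0:ℝ) ≤ n / 2 := by positivity
        linarith
      gcongr
      exact hH0 y
    haveI : Nonempty (Fin n) := ⟨⟨0, hn⟩⟩
    refine le_trans (le_of_eq ?_) b2
    rw [setIntegral_const, Measure.real, Measure.addHaar_ball _ _ hδp.le, ENNReal.toReal_mul,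
      ENNReal.toReal_ofReal (by positivity), ← hω]
    have e3 : (2 * δ ^ 2) ^ (-(n / 2 : ℝ) - 1) = 2 ^ (-(n / 2 : ℝ) - 1) * (δ ^ n * δ ^ 2)⁻¹ := by
      rw [Real.mul_rpow (by norm_num) (by positivity)]
      congr 1
      rw [← pow_add, ← Real.rpow_natCast, ← Real.rpow_natCast, ← Real.rpow_mul hδp.le,
        ← Real.rpow_neg hδp.le]
      congr 1; push_cast; ring
    rw [e3, hc0]
    simp only [finrank_euclideanSpace, Fintype.card_fin, smul_eq_mul]
    field_simp
  -- upper bound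
  have up : ∫ y, K y * (-lap H y) ≤ C1 * ∫ y in Ω, ‖y - x‖ ^ (-(5 * n / 7 : ℝ)) * ρ y := by
    have hlapH : ∀ y, y ∉ Ω → lap H y = 0 := fun y hy => by
      have h1 : H =ᶠ[𝓝 y] fun _ => 0 := notMem_tsupport_iff_eventuallyEq.1 fun h => hy (hsH h)
      rw [lap_congr h1]
      rw [lap_eq contDiffAt_const]; simp
    have hcl : Continuous (lap H) := by
      have : lap H = fun x => ∑ i, fderiv ℝ (fun y => fderiv ℝ H y (ee i)) x (ee i) := by
        ext x; exact lap_eq hH.contDiffAt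
      rw [this]
      refine continuous_finsetSum _ fun i _ => contDiff_one_fderiv_cont ?_ _
      exact (hH.fderiv_right (m := 1) (by norm_num)).clm_apply contDiff_const
    have hcs : HasCompactSupport (fun y => K y * (-lap H y)) := by
      refine hcH.mono' ?_
      intro y hy
      by_contra hyn
      apply hy
      have h1 : H =ᶠ[𝓝 y] fun _ => 0 := notMem_tsupport_iff_eventuallyEq.1 hyn
      have : lap H y = 0 := by rw [lap_congr h1, lap_eq contDiffAt_const]; simp
      simp [this]
    have hintg : Integrable (fun y => K y * (-lap H y)) :=
      (hKs.continuous.mul hcl.neg).integrable_of_hasCompactSupport hcs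
    rw [← setIntegral_eq_integral_of_forall_compl_eq_zero (s := Ω)
      (fun y hy => by simp [hlapH y hy]), ← integral_const_mul]
    refine setIntegral_mono_on_ae hintg.integrableOn (hI.const_mul C1) hΩ.measurableSet ?_
    have hne : ∀ᵐ y : EuclideanSpace ℝ (Fin n), y ≠ x := by
      haveI : Nonempty (Fin n) := ⟨⟨0, hn⟩⟩
      exact (measure_eq_zero_iff_ae_notMem.1 (measure_singleton x)).mono fun y hy => by simpa using hy
    filter_upwards [hne] with y hyx hy
    have hr : 0 < ‖y - x‖ := norm_pos_iff.2 (sub_ne_zero.2 hyx)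
    have hsR : ‖y - x‖ ^ 2 + δ ^ 2 ≤ R := by
      have := hΩD y hy
      have h1 : ‖y - x‖ ^ 2 ≤ D ^ 2 := by gcongr
      have h2 : δ ^ 2 ≤ 1 := by nlinarith
      linarith
    have kb := kk_bound hn hn7 (hspos y) hsR
    have h1 : (‖y - x‖ ^ 2 + δ ^ 2) ^ (-(5 * n / 14 : ℝ)) ≤ ‖y - x‖ ^ (-(5 * n / 7 : ℝ)) := by
      have : ‖y - x‖ ^ (-(5 * n / 7 : ℝ)) = (‖y - x‖ ^ 2) ^ (-(5 * n / 14 : ℝ)) := by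
        rw [← Real.rpow_natCast, ← Real.rpow_mul hr.le]; congr 1; push_cast; ring
      rw [this]
      apply Real.rpow_le_rpow_of_nonpos (by positivity) (by nlinarith)
      have : (0:ℝ) ≤ 5 * n / 14 := by positivity
      linarith
    calc K y * (-lap H y) ≤ K y * ρ y := mul_le_mul_of_nonneg_left (hHρ y hy) kb.1
      _ ≤ (C1 * ‖y - x‖ ^ (-(5 * n / 7 : ℝ))) * ρ y := by
          refine mul_le_mul_of_nonneg_right (kb.2.trans ?_) (hρ y hy)
          exact mul_le_mul_of_nonneg_left h1 hC1p.le
      _ = _ := by ring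
  have g4 : ∫ y, H y * (-lap K y) = ∫ y, K y * (-lap H y) := by
    simp_rw [mul_neg, integral_neg, g3]
  rw [div_mul_eq_mul_div, le_div_iff₀ hc0p]
  linarith

/-- uniform integrability of the kernel powers -/
lemma kernel_int (hn : 0 < n) {r D : ℝ} (hr0 : 0 ≤ r) (hr : r < n) :
    ∃ C, ∀ (Ω : Set (EuclideanSpace ℝ (Fin n))) (x : EuclideanSpace ℝ (Fin n)),
      MeasurableSet Ω → (∀ y ∈ Ω, ‖y - x‖ < D) →
      IntegrableOn (fun y => ‖y - x‖ ^ (-r)) Ω ∧ ∫ y in Ω, ‖y - x‖ ^ (-r) ≤ C := by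
  haveI : Nonempty (Fin n) := ⟨⟨0, hn⟩⟩
  have hn1 : (1:ℝ) ≤ n := by exact_mod_cast hn
  have h1 : IntegrableOn (fun x : EuclideanSpace ℝ (Fin n) => ‖x‖ ^ (-r)) (Metric.ball 0 D) := by
    rw [integrableOn_fun_norm_addHaar volume (f := fun t => t ^ (-r))]
    have : IntegrableOn (fun y : ℝ => y ^ ((n:ℝ) - 1 - r)) (Ioo 0 D) :=
      ((intervalIntegral.intervalIntegrable_rpow' (a := 0) (b := D) (by linarith)).1).mono_set
        Ioo_subset_Ioc_self
    refine this.congr_fun (fun y hy => ?_) measurableSet_Ioo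
    simp only [finrank_euclideanSpace, Fintype.card_fin, smul_eq_mul]
    rw [← Real.rpow_natCast, ← Real.rpow_add hy.1]
    congr 1
    rw [Nat.cast_sub hn]; push_cast; ring
  refine ⟨∫ y in Metric.ball (0 : EuclideanSpace ℝ (Fin n)) D, ‖y‖ ^ (-r), ?_⟩
  intro Ω x hΩ hD
  have hsub : Ω ⊆ Metric.ball x D := fun y hy => by simpa [dist_eq_norm] using hD y hy
  have mp : MeasurePreserving (fun y : EuclideanSpace ℝ (Fin n) => y - x) volume volume :=
    measurePreserving_sub_right volume x
  have me : MeasurableEmbedding (fun y : EuclideanSpace ℝ (Fin n) => y - x) :=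
    (Homeomorph.subRight x).measurableEmbedding
  have hpre : (fun y : EuclideanSpace ℝ (Fin n) => y - x) ⁻¹' Metric.ball 0 D = Metric.ball x D := by
    ext y; simp [dist_eq_norm]
  have h2 : IntegrableOn (fun y => ‖y - x‖ ^ (-r)) (Metric.ball x D) := by
    have := (mp.integrableOn_comp_preimage me (f := fun y => ‖y‖ ^ (-r))
      (s := Metric.ball 0 D)).2 h1
    rw [hpre] at this
    exact this
  refine ⟨h2.mono_set hsub, ?_⟩
  have h3 := mp.setIntegral_preimage_emb me (fun y => ‖y‖ ^ (-r)) (Metric.ball 0 D)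
  rw [hpre] at h3
  rw [← h3]
  exact setIntegral_mono_set h2 (Eventually.of_forall fun y => by positivity)
    (HasSubset.Subset.eventuallyLE hsub)


lemma lap_add {u v : EuclideanSpace ℝ (Fin n) → ℝ} {x} (hu : ContDiffAt ℝ 2 u x)
    (hv : ContDiffAt ℝ 2 v x) : lap (fun y => u y + v y) x = lap u x + lap v x := by
  unfold lap
  rw [← Finset.sum_add_distrib]
  refine Finset.sum_congr rfl fun i _ => ?_
  have := fun_iteratedFDeriv_add_apply (𝕜 := ℝ) (i := 2) hu hv
  rw [this]; rfl

lemma lap_const_mul {u : EuclideanSpace ℝ (Fin n) → ℝ} {x} (hu : ContDiffAt ℝ 2 u x) (c : ℝ) :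
    lap (fun y => c * u y) x = c * lap u x := by
  rw [lap_comp (ψ := fun t => c * t) hu (contDiff_const.mul contDiff_id).contDiffAt]
  have h1 : deriv (fun t : ℝ => c * t) = fun _ => c := by
    ext t; simpa using ((hasDerivAt_id t).const_mul c).deriv
  rw [h1]; simp

lemma ball_barrier (hn : 0 < n) {v : EuclideanSpace ℝ (Fin n) → ℝ} (hv : ContDiff ℝ 2 v)
    {x₀ : EuclideanSpace ℝ (Fin n)} {r c : ℝ}
    (h0 : ∀ y ∈ Metric.closedBall x₀ r, 0 ≤ v y) (hl : ∀ y ∈ Metric.ball x₀ r, lap v y < -c) :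
    ∀ y ∈ Metric.ball x₀ r, c * (r ^ 2 - ‖y - x₀‖ ^ 2) / (2 * n) ≤ v y := by
  have hn0 : (0:ℝ) < n := by exact_mod_cast hn
  set φ : ℝ → ℝ := fun t => c / (2 * n) * t with hφ
  have hφs : ContDiff ℝ 2 φ := contDiff_const.mul contDiff_id
  have hφ1 : deriv φ = fun _ => c / (2 * n) := by
    ext t; simpa [hφ] using ((hasDerivAt_id t).const_mul (c / (2 * n))).deriv
  set b : EuclideanSpace ℝ (Fin n) → ℝ := fun y => φ (‖y - x₀‖ ^ 2 + -r ^ 2) with hb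
  have hbs : ContDiff ℝ 2 b :=
    hφs.comp (((contDiff_id.sub contDiff_const).norm_sq ℝ).add contDiff_const)
  have hlb : ∀ y, lap b y = c := by
    intro y
    rw [hb, lap_normsq hn x₀ y φ _ hφs.contDiffAt, hφ1]
    simp; field_simp
  have hmin := min_principle (U := Metric.ball x₀ r) Metric.isOpen_ball Metric.isBounded_ball
    (v := fun y => v y + b y) (hv.add hbs)
    (fun y hy => by
      rw [lap_add hv.contDiffAt hbs.contDiffAt, hlb]
      linarith [hl y hy])
    (fun y hy => by
      have hs : y ∈ Metric.sphere x₀ r := Metric.frontier_ball_subset_sphere hy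
      have hs' : ‖y - x₀‖ = r := by simpa [dist_eq_norm] using hs
      have : b y = 0 := by simp [hb, hφ, hs']
      rw [this, add_zero]
      exact h0 y (Metric.sphere_subset_closedBall hs))
  intro y hy
  have := hmin y hy
  have e : b y = -(c * (r ^ 2 - ‖y - x₀‖ ^ 2) / (2 * n)) := by
    simp only [hb, hφ]; field_simp; ring
  linarith

/-- open interval -/
def II (a : EReal) : Set ℝ := {t : ℝ | 0 < t ∧ (t : EReal) < a}

lemma II_open (a : EReal) : IsOpen (II a) := by
  refine (isOpen_lt continuous_const continuous_id).inter ?_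
  exact isOpen_lt continuous_coe_real_ereal continuous_const

lemma II_sub {a : EReal} : II a ⊆ domf a := fun _ ht => ⟨ht.1.le, ht.2⟩

lemma II_nhds {a : EReal} {t : ℝ} (ht : t ∈ II a) : II a ∈ 𝓝 t := (II_open a).mem_nhds ht

lemma II_down {a : EReal} {s t : ℝ} (ht : t ∈ II a) (hs : 0 < s) (hst : s ≤ t) : s ∈ II a :=
  ⟨hs, lt_of_le_of_lt (EReal.coe_le_coe_iff.2 hst) ht.2⟩

lemma II_convex (a : EReal) : Convex ℝ (II a) := by
  rw [convex_iff_ordConnected]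
  constructor
  intro x hx y hy z hz
  exact II_down hy (hx.1.trans_le hz.1) hz.2

lemma f_smooth {a : EReal} {f : ℝ → ℝ} (hf : HypH a f) {t : ℝ} (ht : t ∈ II a) :
    ContDiffAt ℝ (⊤ : ℕ∞) f t :=
  hf.smooth.contDiffAt (mem_of_superset (II_nhds ht) II_sub)

lemma f_diff {a : EReal} {f : ℝ → ℝ} (hf : HypH a f) {t : ℝ} (ht : t ∈ II a) :
    DifferentiableAt ℝ f t := (f_smooth hf ht).differentiableAt (by simp)

lemma zero_mem_domf {a : EReal} {f : ℝ → ℝ} (hf : HypH a f) : (0:ℝ) ∈ domf a :=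
  ⟨le_rfl, by exact_mod_cast hf.a_pos⟩

lemma f_ge {a : EReal} {f : ℝ → ℝ} (hf : HypH a f) {t : ℝ} (ht : t ∈ domf a) : f 0 ≤ f t :=
  hf.mono.monotoneOn (zero_mem_domf hf) ht ht.1

lemma fp_pos {a : EReal} {f : ℝ → ℝ} (hf : HypH a f) {t : ℝ} (ht : t ∈ II a) :
    0 < deriv f t := by
  have h := hf.convex.slope_le_deriv (zero_mem_domf hf) (II_sub ht) ht.1 (f_diff hf ht)
  have h2 := hf.mono (zero_mem_domf hf) (II_sub ht) ht.1
  refine lt_of_lt_of_le ?_ h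
  rw [slope_def_field]
  have := ht.1
  exact div_pos (by linarith) (by linarith)

lemma fp_mono {a : EReal} {f : ℝ → ℝ} (hf : HypH a f) : MonotoneOn (deriv f) (II a) :=
  (hf.convex.subset II_sub (II_convex a)).monotoneOn_deriv fun _ hx => f_diff hf hx

lemma fp_smooth {a : EReal} {f : ℝ → ℝ} (hf : HypH a f) {t : ℝ} (ht : t ∈ II a) :
    ContDiffAt ℝ (⊤ : ℕ∞) (deriv f) t := contDiffAt_deriv (f_smooth hf ht) (by simp)

lemma fpp_nonneg {a : EReal} {f : ℝ → ℝ} (hf : HypH a f) {t : ℝ} (ht : t ∈ II a) :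
    0 ≤ deriv (deriv f) t := by
  have h := (fp_mono hf).derivWithin_nonneg (x := t)
  rwa [derivWithin_of_mem_nhds (II_nhds ht)] at h

/-- the second order system -/
structure Sys (Ω : Set (EuclideanSpace ℝ (Fin n))) (a : EReal) (f : ℝ → ℝ) (L : ℝ)
    (u w : EuclideanSpace ℝ (Fin n) → ℝ) : Prop where
  Lpos : 0 < L
  hu : ContDiff ℝ (⊤ : ℕ∞) u
  hw : ContDiff ℝ (⊤ : ℕ∞) w
  lu : ∀ x, lap u x = -(L * w x)
  lw : ∀ x ∈ Ω, lap w x = -(L * f (u x))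
  u0 : ∀ x ∈ frontier Ω, u x = 0
  w0 : ∀ x ∈ frontier Ω, w x = 0
  uI : ∀ x ∈ Ω, u x ∈ II a
  wpos : ∀ x ∈ Ω, 0 < w x
  stab : ∀ φ : EuclideanSpace ℝ (Fin n) → ℝ, ContDiff ℝ (⊤ : ℕ∞) φ → HasCompactSupport φ →
    tsupport φ ⊆ Ω → L * ∫ x in Ω, √(deriv f (u x)) * (φ x) ^ 2 ≤ ∫ x in Ω, ‖gradient φ x‖ ^ 2

lemma sys_of_solves (hn : 0 < n) {Ω : Set (EuclideanSpace ℝ (Fin n))} (hΩ : GoodDomain Ω)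
    {a : EReal} {f : ℝ → ℝ} (hf : HypH a f) {lam : ℝ} (hlam : 0 < lam)
    {u : EuclideanSpace ℝ (Fin n) → ℝ} (hs : Solves Ω a lam f u) (hst : StabIneq Ω lam f u) :
    Sys Ω a f (√lam) u (fun x => (-(1 / √lam)) * lap u x) := by
  obtain ⟨hu, hua, heq, hu0, hlu0⟩ := hs
  have hL : 0 < √lam := Real.sqrt_pos.2 hlam
  have hn0 : (0:ℝ) < n := by exact_mod_cast hn
  have hlap : ContDiff ℝ (⊤ : ℕ∞) (lap u) := contDiff_lap hu
  have hw : ContDiff ℝ (⊤ : ℕ∞) (fun x => (-(1 / √lam)) * lap u x) := contDiff_const.mul hlap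
  have lu : ∀ x, lap u x = -(√lam * ((-(1 / √lam)) * lap u x)) := fun x => by field_simp
  have lw : ∀ x ∈ Ω, lap (fun x => (-(1 / √lam)) * lap u x) x = -(√lam * f (u x)) := by
    intro x hx
    rw [lap_const_mul (hlap.contDiffAt.of_le two_le_inf), heq x hx]
    have : lam = √lam * √lam := (Real.mul_self_sqrt hlam.le).symm
    nth_rewrite 2 [this]
    field_simp
  have w0 : ∀ x ∈ frontier Ω, (-(1 / √lam)) * lap u x = 0 := fun x hx => by simp [hlu0 x hx]
  have lwle : ∀ x ∈ Ω, lap (fun x => (-(1 / √lam)) * lap u x) x < -(√lam * f 0 / 2) := by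
    intro x hx
    rw [lw x hx]
    have := f_ge hf (hua x hx)
    have h2 := mul_le_mul_of_nonneg_left this hL.le
    have h3 := mul_pos hL hf.f0_pos
    linarith
  have wnn : ∀ x ∈ Ω, 0 ≤ (-(1 / √lam)) * lap u x := by
    refine min_principle hΩ.1 hΩ.2.1 (hw.of_le two_le_inf) (fun x hx => ?_)
      (fun x hx => (w0 x hx).ge)
    have h3 := mul_pos hL hf.f0_pos
    linarith [lwle x hx]
  have wpos : ∀ x ∈ Ω, 0 < (-(1 / √lam)) * lap u x := by
    intro x hx
    obtain ⟨r, hr, hrs⟩ := Metric.nhds_basis_closedBall.mem_iff.1 (hΩ.1.mem_nhds hx)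
    have := ball_barrier hn (hw.of_le two_le_inf) (x₀ := x) (r := r) (c := √lam * f 0 / 2)
      (fun y hy => wnn y (hrs hy)) (fun y hy => lwle y (hrs (Metric.ball_subset_closedBall hy)))
      x (Metric.mem_ball_self hr)
    refine lt_of_lt_of_le ?_ this
    have h3 := mul_pos hL hf.f0_pos
    have h4 : 0 < √lam * f 0 / 2 * r ^ 2 / (2 * n) := by positivity
    simpa using h4
  refine ⟨hL, hu, hw, lu, lw, hu0, w0, ?_, wpos, hst⟩
  intro x hx
  refine ⟨?_, (hua x hx).2⟩
  obtain ⟨r, hr, hrs⟩ := Metric.nhds_basis_closedBall.mem_iff.1 (hΩ.1.mem_nhds hx)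
  obtain ⟨z, hz, hmin⟩ := (isCompact_closedBall x r).exists_isMinOn
    ⟨x, Metric.mem_closedBall_self hr.le⟩ hw.continuous.continuousOn
  have hm := wpos z (hrs hz)
  set μ := (-(1 / √lam)) * lap u z with hμ
  have := ball_barrier hn (hu.of_le two_le_inf) (x₀ := x) (r := r) (c := √lam * μ / 2)
      (fun y hy => (hua y (hrs hy)).1) (fun y hy => by
        rw [lu y]
        have h1 : μ ≤ (-(1 / √lam)) * lap u y := hmin (Metric.ball_subset_closedBall hy)
        have h2 := mul_le_mul_of_nonneg_left h1 hL.le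
        have h3 := mul_pos hL hm
        linarith)
      x (Metric.mem_ball_self hr)
  refine lt_of_lt_of_le ?_ this
  have h3 := mul_pos hL hm
  have h4 : 0 < √lam * μ / 2 * r ^ 2 / (2 * n) := by positivity
  simpa using h4

lemma int_of_bdd {Ω : Set (EuclideanSpace ℝ (Fin n))} (hΩ : GoodDomain Ω)
    {g : EuclideanSpace ℝ (Fin n) → ℝ} (hg : ContinuousOn g Ω) {C : ℝ}
    (hC : ∀ x ∈ Ω, |g x| ≤ C) : IntegrableOn g Ω :=
  IntegrableOn.of_bound (C := C) hΩ.2.1.measure_lt_top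
    (hg.aestronglyMeasurable hΩ.1.measurableSet)
    ((ae_restrict_iff' hΩ.1.measurableSet).2 (Eventually.of_forall fun x hx => hC x hx))

lemma Sys.max {Ω : Set (EuclideanSpace ℝ (Fin n))} (hΩ : GoodDomain Ω)
    {a : EReal} {f : ℝ → ℝ} {L : ℝ}
    {u w : EuclideanSpace ℝ (Fin n) → ℝ} (S : Sys Ω a f L u w) :
    ∃ t ∈ II a, ∀ x ∈ Ω, u x ≤ t := by
  obtain ⟨x₀, hx₀⟩ := hΩ.2.2
  obtain ⟨z, hz, hmax⟩ := hΩ.2.1.isCompact_closure.exists_isMaxOn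
    ⟨x₀, subset_closure hx₀⟩ S.hu.continuous.continuousOn
  have h1 : u x₀ ≤ u z := hmax (subset_closure hx₀)
  have hzΩ : z ∈ Ω := by
    by_contra hzn
    have : z ∈ frontier Ω := by rw [frontier, hΩ.1.interior_eq]; exact ⟨hz, hzn⟩
    have h2 := S.u0 z this
    have := (S.uI x₀ hx₀).1
    linarith
  exact ⟨u z, S.uI z hzΩ, fun x hx => hmax (subset_closure hx)⟩

lemma Sys.wmax {Ω : Set (EuclideanSpace ℝ (Fin n))} (hΩ : GoodDomain Ω)
    {a : EReal} {f : ℝ → ℝ} {L : ℝ}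
    {u w : EuclideanSpace ℝ (Fin n) → ℝ} (S : Sys Ω a f L u w) :
    ∃ t, 0 < t ∧ ∀ x ∈ Ω, w x ≤ t := by
  obtain ⟨x₀, hx₀⟩ := hΩ.2.2
  obtain ⟨z, hz, hmax⟩ := hΩ.2.1.isCompact_closure.exists_isMaxOn
    ⟨x₀, subset_closure hx₀⟩ S.hw.continuous.continuousOn
  have h1 : w x₀ ≤ w z := hmax (subset_closure hx₀)
  exact ⟨w z, (S.wpos x₀ hx₀).trans_le h1, fun x hx => hmax (subset_closure hx)⟩

/-- continuous functions of `(u,w)` are integrable -/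
lemma Sys.int {Ω : Set (EuclideanSpace ℝ (Fin n))} (hΩ : GoodDomain Ω)
    {a : EReal} {f : ℝ → ℝ} {L : ℝ}
    {u w : EuclideanSpace ℝ (Fin n) → ℝ} (S : Sys Ω a f L u w) {g p : ℝ → ℝ}
    (hg : ContinuousOn g (II a)) (hgb : ∀ t ∈ II a, ∃ C, ∀ s, 0 < s → s ≤ t → |g s| ≤ C)
    (hp : Continuous p) : IntegrableOn (fun x => g (u x) * p (w x)) Ω := by
  obtain ⟨t, ht, hut⟩ := S.max hΩ
  obtain ⟨C, hC⟩ := hgb t ht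
  obtain ⟨D, hD⟩ := (hΩ.2.1.isCompact_closure.image_of_continuousOn
    (hp.comp S.hw.continuous).continuousOn).isBounded.exists_norm_le
  refine int_of_bdd (C := C * D) hΩ ?_ ?_
  · exact (hg.comp S.hu.continuous.continuousOn fun x hx => S.uI x hx).mul
      (hp.comp S.hw.continuous).continuousOn
  · intro x hx
    rw [abs_mul]
    have h1 := hC (u x) (S.uI x hx).1 (hut x hx)
    have h2 := hD (p (w x)) ⟨x, subset_closure hx, rfl⟩
    exact mul_le_mul h1 h2 (abs_nonneg _) ((abs_nonneg _).trans h1)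

lemma V_cont {a : EReal} {f : ℝ → ℝ} (hf : HypH a f) :
    ContinuousOn (fun t => √(deriv f t)) (II a) := fun t ht =>
  (Real.continuous_sqrt.continuousAt.comp (fp_smooth hf ht).continuousAt).continuousWithinAt

lemma V_mono {a : EReal} {f : ℝ → ℝ} (hf : HypH a f) :
    MonotoneOn (fun t => √(deriv f t)) (II a) := fun s hs t ht hst =>
  Real.sqrt_le_sqrt (fp_mono hf hs ht hst)

lemma V_bdd {a : EReal} {f : ℝ → ℝ} (hf : HypH a f) :
    ∀ t ∈ II a, ∃ C, ∀ s, 0 < s → s ≤ t → |√(deriv f s)| ≤ C := fun t ht =>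
  ⟨√(deriv f t), fun s hs hst => by
    rw [abs_of_nonneg (Real.sqrt_nonneg _)]
    exact V_mono hf (II_down ht hs hst) ht hst⟩

lemma bump_exists (x : EuclideanSpace ℝ (Fin n)) {r : ℝ} (hr : 0 < r) :
    ∃ φ : EuclideanSpace ℝ (Fin n) → ℝ, ContDiff ℝ (⊤ : ℕ∞) φ ∧ HasCompactSupport φ ∧
      tsupport φ ⊆ Metric.ball x r ∧ (∀ y, 0 ≤ φ y ∧ φ y ≤ 1) ∧ φ x = 1 := by
  let φ : ContDiffBump x := ⟨r / 4, r / 2, by linarith, by linarith⟩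
  refine ⟨φ, φ.contDiff, φ.hasCompactSupport, ?_, fun y => ⟨φ.nonneg, φ.le_one⟩, ?_⟩
  · rw [φ.tsupport_eq]
    exact Metric.closedBall_subset_ball (by change r / 2 < r; linarith)
  · exact φ.one_of_mem_closedBall (Metric.mem_closedBall_self (by change 0 ≤ r / 4; linarith))

set_option maxHeartbeats 400000 in
/-- `L` is uniformly bounded -/
lemma L_bound (hn : 0 < n) {Ω : Set (EuclideanSpace ℝ (Fin n))} (hΩ : GoodDomain Ω)
    {a : EReal} {f : ℝ → ℝ} (hf : HypH a f) :
    ∃ L0 : ℝ, 0 < L0 ∧ ∀ L u w, Sys Ω a f L u w → L ≤ L0 := by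
  have hn0 : (0:ℝ) < n := by exact_mod_cast hn
  have hf0 := hf.f0_pos
  obtain ⟨x, hx⟩ := hΩ.2.2
  obtain ⟨r, hr, hrs⟩ := Metric.nhds_basis_closedBall.mem_iff.1 (hΩ.1.mem_nhds hx)
  set c1 := f 0 / 2 * (3 * r ^ 2 / 4) / (2 * n) with hc1
  have hc1p : 0 < c1 := by positivity
  set c2 := c1 / 2 * (3 * r ^ 2 / 16) / (2 * n) with hc2
  have hc2p : 0 < c2 := by positivity
  have low : ∀ L u w, Sys Ω a f L u w → ∀ y ∈ Metric.ball x (r / 4), L ^ 2 * c2 ≤ u y := by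
    intro L u w S y hy
    have hL := S.Lpos
    have b1 := ball_barrier hn (S.hw.of_le two_le_inf) (x₀ := x) (r := r) (c := L * f 0 / 2)
      (fun y hy => (S.wpos y (hrs hy)).le) (fun y hy => by
        have hyΩ := hrs (Metric.ball_subset_closedBall hy)
        rw [S.lw y hyΩ]
        have h2 := mul_le_mul_of_nonneg_left (f_ge hf (II_sub (S.uI y hyΩ))) hL.le
        have h3 := mul_pos hL hf.f0_pos
        linarith)
    have b2 : ∀ y ∈ Metric.ball x (r / 2), L * c1 ≤ w y := by
      intro y hy
      have hd : ‖y - x‖ < r / 2 := by simpa [dist_eq_norm] using hy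
      refine le_trans ?_ (b1 y (Metric.ball_subset_ball (by linarith) hy))
      have : ‖y - x‖ ^ 2 ≤ (r / 2) ^ 2 := by gcongr
      have e : L * c1 = L * f 0 / 2 * (3 * r ^ 2 / 4) / (2 * n) := by rw [hc1]; ring
      rw [e]
      gcongr
      linarith
    have b3 := ball_barrier hn (S.hu.of_le two_le_inf) (x₀ := x) (r := r / 2)
      (c := L ^ 2 * c1 / 2)
      (fun y hy => (S.uI y (hrs (Metric.closedBall_subset_closedBall (by linarith) hy))).1.le)
      (fun y hy => by
        rw [S.lu]
        have h2 := mul_le_mul_of_nonneg_left (b2 y hy) hL.le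
        have h3 : 0 < L ^ 2 * c1 := by positivity
        nlinarith) y (Metric.ball_subset_ball (by linarith) hy)
    refine le_trans ?_ b3
    have hd : ‖y - x‖ < r / 4 := by simpa [dist_eq_norm] using hy
    have : ‖y - x‖ ^ 2 ≤ (r / 4) ^ 2 := by gcongr
    have e : L ^ 2 * c2 = L ^ 2 * c1 / 2 * (3 * r ^ 2 / 16) / (2 * n) := by rw [hc2]; ring
    rw [e]
    gcongr
    linarith
  have hxb : x ∈ Metric.ball x (r / 4) := Metric.mem_ball_self (by linarith)
  by_cases ha : a = ⊤
  · -- use a bump function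
    have hballΩ : Metric.ball x (r / 4) ⊆ Ω := fun y hy => hrs
      (Metric.ball_subset_closedBall (Metric.ball_subset_ball (by linarith) hy))
    obtain ⟨φ, hφs, hφc, hsup, h01, hfx⟩ := bump_exists x (show 0 < r / 4 by linarith)
    have h1I : (1:ℝ) ∈ II a := ⟨one_pos, by rw [ha]; exact EReal.coe_lt_top 1⟩
    have hV1 : 0 < √(deriv f 1) := Real.sqrt_pos.2 (fp_pos hf h1I)
    have hφc2 : HasCompactSupport (fun y => φ y ^ 2) := by
      refine hφc.mono fun y hy => ?_
      simp only [Function.mem_support] at hy ⊢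
      intro h; simp [h] at hy
    have hφi' : Integrable (fun y => φ y ^ 2) :=
      (hφs.continuous.pow 2).integrable_of_hasCompactSupport
        hφc2
    have hφi : IntegrableOn (fun y => φ y ^ 2) Ω := hφi'.integrableOn
    have hJ : 0 < ∫ y in Ω, φ y ^ 2 := by
      rw [setIntegral_eq_integral_of_forall_compl_eq_zero fun y hy => by
        rw [image_eq_zero_of_notMem_tsupport fun h => hy (hballΩ (hsup h))]; simp]
      refine (hφs.continuous.pow 2).integral_pos_of_hasCompactSupport_nonneg_nonzero
        hφc2 (fun y => by positivity) (x := x) ?_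
      simp [hfx]
    set J := ∫ y in Ω, φ y ^ 2
    set G := ∫ y in Ω, ‖gradient φ y‖ ^ 2
    refine ⟨max 1 (max (1 / c2) (G / (√(deriv f 1) * J))), by positivity, ?_⟩
    intro L u w S
    have hL := S.Lpos
    rcases le_total (L ^ 2 * c2) 1 with h1 | h1
    · rcases le_total L 1 with h2 | h2
      · exact h2.trans (le_max_left _ _)
      · refine le_trans ?_ ((le_max_left _ _).trans (le_max_right _ _))
        rw [le_div_iff₀ hc2p]
        nlinarith
    · refine le_trans ?_ ((le_max_right _ _).trans (le_max_right _ _))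
      rw [le_div_iff₀ (by positivity)]
      have st := S.stab φ hφs hφc (hsup.trans hballΩ)
      refine le_trans ?_ st
      refine mul_le_mul_of_nonneg_left ?_ hL.le
      rw [← integral_const_mul]
      refine setIntegral_mono_on (hφi.const_mul _) ?_ hΩ.1.measurableSet ?_
      · have i1 := S.int hΩ (V_cont hf) (V_bdd hf) (p := fun _ => 1) continuous_const
        refine Integrable.mono' i1 ?_ ?_
        · exact (((V_cont hf).comp S.hu.continuous.continuousOn fun x hx => S.uI x hx).mul
            (hφs.continuous.pow 2).continuousOn).aestronglyMeasurable hΩ.1.measurableSet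
        · refine Eventually.of_forall fun y => ?_
          rw [Real.norm_of_nonneg (by positivity)]
          have h0 := (h01 y).1
          have h1 := (h01 y).2
          refine mul_le_mul_of_nonneg_left ?_ (Real.sqrt_nonneg _)
          nlinarith
      · intro y hy
        by_cases hyb : y ∈ Metric.ball x (r / 4)
        · refine mul_le_mul_of_nonneg_right ?_ (by positivity)
          exact V_mono hf h1I (S.uI y hy) (h1.trans (low L u w S y hyb))
        · have : φ y = 0 := image_eq_zero_of_notMem_tsupport fun h => hyb (hsup h)
          simp [this]
  · refine ⟨max 1 (a.toReal / c2), by positivity, ?_⟩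
    intro L u w S
    have hL := S.Lpos
    rcases le_total L 1 with h2 | h2
    · exact h2.trans (le_max_left _ _)
    · refine le_trans ?_ (le_max_right _ _)
      rw [le_div_iff₀ hc2p]
      have h1 := low L u w S x hxb
      have h3 := (S.uI x hx).2
      have h4 : (a.toReal : EReal) = a := EReal.coe_toReal ha (ne_bot_of_gt hf.a_pos)
      rw [← h4] at h3
      have h5 : u x < a.toReal := by exact_mod_cast h3
      have h6 : L * c2 ≤ L ^ 2 * c2 := mul_le_mul_of_nonneg_right (by nlinarith) hc2p.le
      linarith

lemma quartic_neg {τ : ℝ} (h0 : 8 / 9 ≤ τ) (h1 : τ ≤ 1.57863) :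
    625 * τ ^ 4 < 64 * (2 - τ) * (14 * τ - 8) * (9 * τ - 4) := by
  set b : ℝ := 1.57863 with hb
  have e : 625 * τ ^ 4 - 64 * (2 - τ) * (14 * τ - 8) * (9 * τ - 4) =
      (625 * b ^ 4 - 64 * (2 - b) * (14 * b - 8) * (9 * b - 4)) - (b - τ) *
      (625 * τ ^ 3 + (625 * b + 8064) * τ ^ 2 + (625 * b ^ 2 + 8064 * b - 24320) * τ
        + (625 * b ^ 3 + 8064 * b ^ 2 - 24320 * b + 18432)) := by ring
  have hPb : 625 * b ^ 4 - 64 * (2 - b) * (14 * b - 8) * (9 * b - 4) < 0 := by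
    rw [hb]; norm_num
  have hq : 0 ≤ 625 * τ ^ 3 + (625 * b + 8064) * τ ^ 2 + (625 * b ^ 2 + 8064 * b - 24320) * τ
        + (625 * b ^ 3 + 8064 * b ^ 2 - 24320 * b + 18432) := by
    obtain ⟨t, rfl⟩ : ∃ t, τ = 8 / 9 + t := ⟨τ - 8 / 9, by ring⟩
    have ht : 0 ≤ t := by linarith
    have h3 : 0 ≤ t ^ 3 := by positivity
    have h2 : 0 ≤ t ^ 2 := by positivity
    rw [hb]
    nlinarith
  have := mul_nonneg (sub_nonneg.2 h1) hq
  linarith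

lemma alpha_exists {τ : ℝ} (h0 : 0 < τ) (h1 : τ ≤ 1.57863) :
    ∃ α : ℝ, 1 ≤ α ∧ 5 * τ < 4 * α * (2 - τ) ∧
      α ^ 4 * (1 - τ / 2) ^ 2 < (2 * α - 1) * (τ / 2 + (2 * α - 1) * (1 - τ / 2)) := by
  have hd : 0 < 2 - τ := by norm_num at h1; linarith
  rcases lt_or_ge τ (8 / 9) with h | h
  · exact ⟨1, le_rfl, by linarith, by nlinarith⟩
  · set α₀ := 5 * τ / (4 * (2 - τ)) with hα
    have ha : 1 ≤ α₀ := by rw [hα, le_div_iff₀ (by positivity)]; linarith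
    have hk : α₀ * (1 - τ / 2) = 5 * τ / 8 := by rw [hα]; field_simp; ring
    have hs : α₀ ^ 4 * (1 - τ / 2) ^ 2 <
        (2 * α₀ - 1) * (τ / 2 + (2 * α₀ - 1) * (1 - τ / 2)) := by
      have e1 : α₀ ^ 4 * (1 - τ / 2) ^ 2 = α₀ ^ 2 * (5 * τ / 8) ^ 2 := by rw [← hk]; ring
      have e2 : (2 * α₀ - 1) * (τ / 2 + (2 * α₀ - 1) * (1 - τ / 2)) =
          (2 * α₀ - 1) * (9 * τ / 4 - 1) := by
        have : (2 * α₀ - 1) * (1 - τ / 2) = 5 * τ / 4 - (1 - τ / 2) := by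
          linear_combination 2 * hk
        rw [this]; ring
      rw [e1, e2, hα]
      have q := quartic_neg h h1
      have e3 : (5 * τ / (4 * (2 - τ))) ^ 2 * (5 * τ / 8) ^ 2 =
        (625 * τ ^ 4) / (1024 * (2 - τ) ^ 2) := by field_simp; ring
      have e4 : (2 * (5 * τ / (4 * (2 - τ))) - 1) * (9 * τ / 4 - 1) =
        (64 * (2 - τ) * (14 * τ - 8) * (9 * τ - 4)) / (1024 * (2 - τ) ^ 2) := by
        field_simp; ring
      rw [e3, e4]
      exact div_lt_div_of_pos_right q (by positivity)
    have hc : ∀ᶠ α in 𝓝 α₀, α ^ 4 * (1 - τ / 2) ^ 2 <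
        (2 * α - 1) * (τ / 2 + (2 * α - 1) * (1 - τ / 2)) :=
      Tendsto.eventually_lt (Continuous.tendsto (by fun_prop) _)
        (Continuous.tendsto (by fun_prop) _) hs
    obtain ⟨α, h2, h3⟩ := ((hc.filter_mono nhdsWithin_le_nhds).and
      (self_mem_nhdsWithin : Ioi α₀ ∈ 𝓝[>] α₀)).exists
    refine ⟨α, ha.trans (le_of_lt h3), ?_, h2⟩
    have h3' : α₀ < α := h3
    rw [hα, div_lt_iff₀ (by positivity)] at h3'
    linarith

/-- The one dimensional parameters. -/
structure Par (τ α c1 ε σ : ℝ) : Prop where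
  hα : 1 ≤ α
  hc1 : 0 < c1
  hc12 : c1 * (α ^ 2 / (2 * α - 1)) < 1
  hε : 0 < ε
  hε2 : τ + ε < 2
  hσ : 0 < σ
  hσα : 5 * σ < 4 * α
  hT1 : ∀ T, τ - ε < T → T < τ + ε →
    α ^ 2 * (1 - T / 2) ^ 2 ≤ c1 * (T / 2 + (2 * α - 1) * (1 - T / 2))
  hT2 : ∀ T, τ - ε < T → T < τ + ε → T / 2 ≤ σ * (1 - T / 2)

lemma par_exists {τ : ℝ} (h0 : 0 < τ) (h1 : τ ≤ 1.57863) :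
    ∃ α c1 ε σ : ℝ, Par τ α c1 ε σ := by
  obtain ⟨α, ha, hb, hc⟩ := alpha_exists h0 h1
  have hd : 0 < 2 - τ := by norm_num at h1; linarith
  have ha2 : 0 < 2 * α - 1 := by linarith
  set D := τ / 2 + (2 * α - 1) * (1 - τ / 2) with hD
  have hDp : 0 < D := by
    have : 0 < (2 * α - 1) * (1 - τ / 2) := mul_pos ha2 (by linarith)
    linarith
  obtain ⟨c1, h2, h3⟩ : ∃ c1, α ^ 2 * (1 - τ / 2) ^ 2 / D < c1 ∧ c1 < (2 * α - 1) / α ^ 2 := by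
    apply exists_between
    rw [div_lt_div_iff₀ hDp (by positivity)]
    calc α ^ 2 * (1 - τ / 2) ^ 2 * α ^ 2 = α ^ 4 * (1 - τ / 2) ^ 2 := by ring
      _ < _ := hc
  obtain ⟨σ, h4, h5⟩ : ∃ σ, τ / (2 - τ) < σ ∧ σ < 4 * α / 5 := by
    apply exists_between
    rw [div_lt_div_iff₀ hd (by norm_num)]; linarith
  have hσ : 0 < σ := lt_trans (by positivity) h4
  have hc1 : 0 < c1 := lt_of_le_of_lt (by positivity) h2
  have n1 : ∀ᶠ T in 𝓝 τ, α ^ 2 * (1 - T / 2) ^ 2 < c1 * (T / 2 + (2 * α - 1) * (1 - T / 2)) :=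
    Tendsto.eventually_lt (Continuous.tendsto (by fun_prop) _)
        (Continuous.tendsto (by fun_prop) _) (by
          rw [div_lt_iff₀ hDp] at h2; exact h2)
  have n2 : ∀ᶠ T in 𝓝 τ, T / 2 < σ * (1 - T / 2) :=
    Tendsto.eventually_lt (Continuous.tendsto (by fun_prop) _)
        (Continuous.tendsto (by fun_prop) _) (by
          rw [div_lt_iff₀ hd] at h4; linarith)
  obtain ⟨ε, he, h6⟩ := Metric.eventually_nhds_iff.1 (n1.and n2)
  refine ⟨α, c1, min ε ((2 - τ) / 2), σ, ha, hc1, ?_, by positivity, ?_, hσ, by linarith, ?_, ?_⟩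
  · rw [lt_div_iff₀ (by positivity)] at h3
    rw [← mul_div_assoc, div_lt_one ha2]; exact h3
  · have := min_le_right ε ((2 - τ) / 2); linarith
  · intro T h7 h8
    have := min_le_left ε ((2 - τ) / 2)
    exact (h6 (y := T) (by rw [Real.dist_eq, abs_lt]; constructor <;> linarith)).1.le
  · intro T h7 h8
    have := min_le_left ε ((2 - τ) / 2)
    exact (h6 (y := T) (by rw [Real.dist_eq, abs_lt]; constructor <;> linarith)).2.le

lemma II_nonempty {a : EReal} (ha : 0 < a) : ∃ t, t ∈ II a := by
  obtain ⟨t, h1, h2⟩ := EReal.lt_iff_exists_real_btwn.1 ha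
  exact ⟨t, by exact_mod_cast h1, h2⟩

lemma af_eventually {a : EReal} (ha : 0 < a) {P : ℝ → Prop} :
    (∀ᶠ t in afFilter a, P t) ↔ ∃ t0 ∈ II a, ∀ t ∈ II a, t0 ≤ t → P t := by
  unfold afFilter
  split_ifs with h
  · constructor
    · intro hP
      obtain ⟨N, hN⟩ := eventually_atTop.1 hP
      refine ⟨max N 1, ⟨by positivity, by rw [h]; exact EReal.coe_lt_top _⟩, fun t _ ht => ?_⟩
      exact hN t ((le_max_left _ _).trans ht)
    · rintro ⟨t0, ht0, hP⟩
      filter_upwards [eventually_ge_atTop t0] with t ht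
      exact hP t ⟨ht0.1.trans_le ht, by rw [h]; exact EReal.coe_lt_top _⟩ ht
  · have h4 : (a.toReal : EReal) = a := EReal.coe_toReal h (ne_bot_of_gt ha)
    have ha' : 0 < a.toReal := by rw [← h4] at ha; exact_mod_cast ha
    have hlt : ∀ t : ℝ, (t : EReal) < a ↔ t < a.toReal := fun t => by
      rw [← h4]; simp
    constructor
    · intro hP
      obtain ⟨l, hl, hP⟩ := (mem_nhdsLT_iff_exists_Ioo_subset' ha').1 hP
      have hl' : l < a.toReal := hl
      have hm : max l 0 < a.toReal := max_lt hl' ha'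
      obtain ⟨t0, h5, h6⟩ := exists_between hm
      refine ⟨t0, ⟨(le_max_right _ _).trans_lt h5, (hlt _).2 h6⟩, fun t ht h7 => ?_⟩
      exact hP ⟨((le_max_left _ _).trans_lt h5).trans_le h7, (hlt _).1 ht.2⟩
    · rintro ⟨t0, ht0, hP⟩
      filter_upwards [Ioo_mem_nhdsLT ((hlt _).1 ht0.2)] with t ht
      exact hP t ⟨ht0.1.trans ht.1, (hlt _).2 ht.2⟩ ht.1.le

lemma af_neBot {a : EReal} : (afFilter a).NeBot := by
  unfold afFilter
  split_ifs <;> infer_instance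

lemma T_nonneg {a : EReal} {f : ℝ → ℝ} (hf : HypH a f) {t : ℝ} (ht : t ∈ II a) :
    0 ≤ f t * deriv (deriv f) t / (deriv f t) ^ 2 :=
  div_nonneg (mul_nonneg (hf.pos t (II_sub ht)).le (fpp_nonneg hf ht)) (by positivity)

lemma T_tendsto {a : EReal} {f : ℝ → ℝ} (hf : HypH a f)
    (heq : tauMinus a f = tauPlus a f) (hτ0 : 0 < tauPlus a f) :
    Tendsto (fun t => f t * deriv (deriv f) t / (deriv f t) ^ 2) (afFilter a)
      (𝓝 (tauPlus a f)) := by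
  have := af_neBot (a := a)
  refine tendsto_of_liminf_eq_limsup heq rfl ?_ ?_
  · by_contra hb
    have : tauPlus a f = 0 := by
      unfold tauPlus
      rw [limsup_eq]
      have : {b : ℝ | ∀ᶠ t in afFilter a, f t * deriv (deriv f) t / (deriv f t) ^ 2 ≤ b} = ∅ := by
        ext b
        simp only [mem_setOf_eq, mem_empty_iff_false, iff_false]
        intro h
        exact hb ⟨b, by simpa using h⟩
      rw [this, Real.sInf_empty]
    linarith
  · refine ⟨0, ?_⟩
    rw [eventually_map, af_eventually hf.a_pos]
    obtain ⟨t, ht⟩ := II_nonempty hf.a_pos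
    exact ⟨t, ht, fun s hs _ => T_nonneg hf hs⟩

lemma mono_tool {a : EReal} {g g' : ℝ → ℝ} {t0 : ℝ} (ht0 : t0 ∈ II a)
    (h : ∀ t ∈ II a, t0 ≤ t → HasDerivAt g (g' t) t ∧ 0 ≤ g' t) {s t : ℝ} (ht : t ∈ II a)
    (hs : t0 ≤ s) (hst : s ≤ t) : g s ≤ g t := by
  have hm : ∀ x ∈ Icc t0 t, x ∈ II a := fun x hx => II_down ht (ht0.1.trans_le hx.1) hx.2
  have : MonotoneOn g (Icc t0 t) := by
    refine monotoneOn_of_deriv_nonneg (convex_Icc _ _) ?_ ?_ ?_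
    · intro x hx
      exact (h x (hm x hx) hx.1).1.continuousAt.continuousWithinAt
    · intro x hx
      have hx := interior_subset hx
      exact (h x (hm x hx) hx.1).1.differentiableAt.differentiableWithinAt
    · intro x hx
      have hx := interior_subset hx
      rw [(h x (hm x hx) hx.1).1.deriv]
      exact (h x (hm x hx) hx.1).2
  exact this ⟨hs, hst⟩ ⟨hs.trans hst, le_rfl⟩ hst

def VV (f : ℝ → ℝ) (t : ℝ) : ℝ := √(deriv f t)
def hh (f : ℝ → ℝ) (t : ℝ) : ℝ := f t / VV f t
def TT (f : ℝ → ℝ) (t : ℝ) : ℝ := f t * deriv (deriv f) t / (deriv f t) ^ 2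

lemma VV_pos {a : EReal} {f : ℝ → ℝ} (hf : HypH a f) {t : ℝ} (ht : t ∈ II a) : 0 < VV f t :=
  Real.sqrt_pos.2 (fp_pos hf ht)

lemma VV_sq {a : EReal} {f : ℝ → ℝ} (hf : HypH a f) {t : ℝ} (ht : t ∈ II a) :
    VV f t ^ 2 = deriv f t := Real.sq_sqrt (fp_pos hf ht).le

lemma hh_pos {a : EReal} {f : ℝ → ℝ} (hf : HypH a f) {t : ℝ} (ht : t ∈ II a) : 0 < hh f t :=
  div_pos (hf.pos t (II_sub ht)) (VV_pos hf ht)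

lemma f_eq {a : EReal} {f : ℝ → ℝ} (hf : HypH a f) {t : ℝ} (ht : t ∈ II a) :
    f t = VV f t * hh f t := by
  have := VV_pos hf ht
  unfold hh; field_simp

lemma VV_smooth {a : EReal} {f : ℝ → ℝ} (hf : HypH a f) {t : ℝ} (ht : t ∈ II a) :
    ContDiffAt ℝ (⊤ : ℕ∞) (VV f) t :=
  (fp_smooth hf ht).sqrt (fp_pos hf ht).ne'

lemma hh_smooth {a : EReal} {f : ℝ → ℝ} (hf : HypH a f) {t : ℝ} (ht : t ∈ II a) :
    ContDiffAt ℝ (⊤ : ℕ∞) (hh f) t :=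
  (f_smooth hf ht).div (VV_smooth hf ht) (VV_pos hf ht).ne'

lemma VV_deriv {a : EReal} {f : ℝ → ℝ} (hf : HypH a f) {t : ℝ} (ht : t ∈ II a) :
    HasDerivAt (VV f) (TT f t / 2 * VV f t ^ 2 / hh f t) t := by
  have h1 : HasDerivAt (deriv f) (deriv (deriv f) t) t :=
    ((fp_smooth hf ht).differentiableAt (by simp)).hasDerivAt
  have h2 := h1.sqrt (fp_pos hf ht).ne'
  refine HasDerivAt.congr_deriv (show HasDerivAt (VV f) _ t from h2) ?_
  have hV := VV_pos hf ht
  have hfp := hf.pos t (II_sub ht)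
  unfold TT hh
  rw [← VV_sq hf ht]
  rw [Real.sqrt_sq hV.le]
  field_simp

lemma hh_deriv {a : EReal} {f : ℝ → ℝ} (hf : HypH a f) {t : ℝ} (ht : t ∈ II a) :
    HasDerivAt (hh f) (VV f t * (1 - TT f t / 2)) t := by
  have h1 := (f_diff hf ht).hasDerivAt.div (VV_deriv hf ht) (VV_pos hf ht).ne'
  refine h1.congr_deriv ?_
  have hV := VV_pos hf ht
  have hH := hh_pos hf ht
  rw [← VV_sq hf ht, f_eq hf ht]
  field_simp

/-- Everything about `f` near `a`, for `t ≥ t0`. -/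
structure Near (a : EReal) (f : ℝ → ℝ) (τ ε t0 : ℝ) : Prop where
  mem : t0 ∈ II a
  hT : ∀ t ∈ II a, t0 ≤ t → τ - ε < TT f t ∧ TT f t < τ + ε

lemma near_exists {a : EReal} {f : ℝ → ℝ} (hf : HypH a f)
    (heq : tauMinus a f = tauPlus a f) (hτ0 : 0 < tauPlus a f) {ε : ℝ} (hε : 0 < ε) :
    ∃ t0, Near a f (tauPlus a f) ε t0 := by
  have h := T_tendsto hf heq hτ0
  have h2 := h.eventually (Ioo_mem_nhds (by linarith : tauPlus a f - ε < tauPlus a f)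
    (by linarith : tauPlus a f < tauPlus a f + ε))
  obtain ⟨t0, ht0, h3⟩ := (af_eventually hf.a_pos).1 h2
  exact ⟨t0, ht0, fun t ht h4 => h3 t ht h4⟩

lemma TT_nonneg {a : EReal} {f : ℝ → ℝ} (hf : HypH a f) {t : ℝ} (ht : t ∈ II a) :
    0 ≤ TT f t := T_nonneg hf ht

lemma hh_large {a : EReal} {f : ℝ → ℝ} (hf : HypH a f) {τ ε t0 : ℝ} (hε2 : τ + ε < 2)
    (N : Near a f τ ε t0) (M : ℝ) :
    ∃ t1 ∈ II a, t0 ≤ t1 ∧ ∀ t ∈ II a, t1 ≤ t → M ≤ hh f t := by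
  set k0 := 1 - (τ + ε) / 2 with hk0
  have hk : 0 < k0 := by rw [hk0]; linarith
  set g : ℝ → ℝ := fun t => Real.log (hh f t) - k0 * Real.log (f t) with hg
  have hmono : ∀ t ∈ II a, t0 ≤ t → g t0 ≤ g t := fun t ht h0 => by
    refine mono_tool (g := g) (g' := fun t => VV f t * (1 - TT f t / 2) / hh f t
      - k0 * (deriv f t / f t)) N.mem (fun s hs h1 => ⟨?_, ?_⟩) ht le_rfl h0
    · exact ((hh_deriv hf hs).log (hh_pos hf hs).ne').sub
        (((f_diff hf hs).hasDerivAt.log (hf.pos s (II_sub hs)).ne').const_mul k0)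
    · have hV := VV_pos hf hs
      have hH := hh_pos hf hs
      rw [← VV_sq hf hs, f_eq hf hs]
      have e : VV f s * (1 - TT f s / 2) / hh f s - k0 * (VV f s ^ 2 / (VV f s * hh f s)) =
        VV f s / hh f s * (1 - TT f s / 2 - k0) := by field_simp
      rw [e]
      have := (N.hT s hs h1).2
      exact mul_nonneg (by positivity) (by rw [hk0]; linarith)
  set Q := Real.exp ((Real.log (max M 1) - g t0) / k0) with hQ
  obtain ⟨t1, ht1, h1⟩ := (af_eventually hf.a_pos).1 (hf.blowup.eventually_ge_atTop Q)
  refine ⟨max t0 t1, ?_, le_max_left _ _, fun t ht h2 => ?_⟩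
  · rcases max_choice t0 t1 with h | h <;> rw [h]
    exacts [N.mem, ht1]
  · have h3 := h1 t ht ((le_max_right _ _).trans h2)
    have h4 := hmono t ht ((le_max_left _ _).trans h2)
    have h5 : (Real.log (max M 1) - g t0) / k0 ≤ Real.log (f t) :=
      (Real.le_log_iff_exp_le (hf.pos t (II_sub ht))).2 h3
    rw [div_le_iff₀ hk] at h5
    have h6 : Real.log (max M 1) ≤ Real.log (hh f t) := by
      simp only [hg] at h4 h5; linarith
    exact (le_max_left _ _).trans ((Real.log_le_log_iff (by positivity) (hh_pos hf ht)).1 h6)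

lemma VV_le {a : EReal} {f : ℝ → ℝ} (hf : HypH a f) {τ α c1 ε σ t0 : ℝ} (P : Par τ α c1 ε σ)
    (N : Near a f τ ε t0) :
    ∃ C > 0, ∀ t ∈ II a, t0 ≤ t → VV f t ≤ C * hh f t ^ σ := by
  set g : ℝ → ℝ := fun t => σ * Real.log (hh f t) - Real.log (VV f t) with hg
  have hmono : ∀ t ∈ II a, t0 ≤ t → g t0 ≤ g t := fun t ht h0 => by
    refine mono_tool (g := g) (g' := fun t => σ * (VV f t * (1 - TT f t / 2) / hh f t)
      - TT f t / 2 * VV f t ^ 2 / hh f t / VV f t) N.mem (fun s hs h1 => ⟨?_, ?_⟩) ht le_rfl h0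
    · exact (((hh_deriv hf hs).log (hh_pos hf hs).ne').const_mul σ).sub
        ((VV_deriv hf hs).log (VV_pos hf hs).ne')
    · have hV := VV_pos hf hs
      have hH := hh_pos hf hs
      have e : σ * (VV f s * (1 - TT f s / 2) / hh f s)
        - TT f s / 2 * VV f s ^ 2 / hh f s / VV f s =
        VV f s / hh f s * (σ * (1 - TT f s / 2) - TT f s / 2) := by field_simp
      rw [e]
      have h2 := P.hT2 _ (N.hT s hs h1).1 (N.hT s hs h1).2
      exact mul_nonneg (by positivity) (by linarith)
  refine ⟨Real.exp (-g t0), Real.exp_pos _, fun t ht h1 => ?_⟩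
  have h2 := hmono t ht h1
  have hH := hh_pos hf ht
  have hV := VV_pos hf ht
  rw [← Real.log_le_log_iff hV (by positivity), Real.log_mul (by positivity) (by positivity),
    Real.log_exp, Real.log_rpow hH]
  simp only [hg] at h2 ⊢
  linarith

/-- primitives on `II` -/
lemma prim_II {a : EReal} {g : ℝ → ℝ} (hg : ContinuousOn g (II a)) {t0 t : ℝ} (ht0 : t0 ∈ II a)
    (ht : t ∈ II a) : HasDerivAt (fun t => ∫ s in t0..t, g s) (g t) t := by
  refine intervalIntegral.integral_hasDerivAt_right ?_ ?_ ?_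
  · refine (hg.mono ?_).intervalIntegrable
    intro s hs
    rcases le_total t0 t with h | h
    · rw [uIcc_of_le h] at hs; exact II_down ht (ht0.1.trans_le hs.1) hs.2
    · rw [uIcc_of_ge h] at hs; exact II_down ht0 (ht.1.trans_le hs.1) hs.2
  · exact hg.stronglyMeasurableAtFilter (II_open a) t ht
  · exact hg.continuousAt (II_nhds ht)

def step (s : ℝ) : ℝ := Real.smoothTransition (s - 1)

lemma step_smooth : ContDiff ℝ (⊤ : ℕ∞) step :=
  Real.smoothTransition.contDiff.comp (contDiff_id.sub contDiff_const)

lemma step_zero {s : ℝ} (h : s ≤ 1) : step s = 0 :=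
  Real.smoothTransition.zero_of_nonpos (by linarith)

lemma step_one {s : ℝ} (h : 2 ≤ s) : step s = 1 :=
  Real.smoothTransition.one_of_one_le (by linarith)

lemma step_nonneg (s : ℝ) : 0 ≤ step s := Real.smoothTransition.nonneg _
lemma step_le_one (s : ℝ) : step s ≤ 1 := Real.smoothTransition.le_one _
lemma step_mono : Monotone step := fun _ _ h => Real.smoothTransition.monotone (by linarith)

lemma prim_R {g : ℝ → ℝ} (hg : Continuous g) (t : ℝ) :
    HasDerivAt (fun t => ∫ s in (0:ℝ)..t, g s) (g t) t :=
  intervalIntegral.integral_hasDerivAt_right (hg.intervalIntegrable _ _)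
    (hg.stronglyMeasurableAtFilter _ _) hg.continuousAt

lemma prim_zero {g : ℝ → ℝ} (hg : ∀ s ≤ 1, g s = 0) {t : ℝ} (ht : t ≤ 1) :
    ∫ s in (0:ℝ)..t, g s = 0 := by
  apply intervalIntegral.integral_zero_ae
  refine Eventually.of_forall fun s hs => hg s ?_
  rcases le_total 0 t with h | h
  · rw [uIoc_of_le h] at hs; exact hs.2.trans ht
  · rw [uIoc_of_ge h] at hs; exact hs.2.trans zero_le_one

/-- the convex cut-off -/
lemma psi_exists : ∃ ψ : ℝ → ℝ, ContDiff ℝ (⊤ : ℕ∞) ψ ∧ (∀ s ≤ 1, ψ s = 0) ∧ (∀ s, 0 ≤ ψ s) ∧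
    (∀ s, 0 ≤ deriv ψ s ∧ deriv ψ s ≤ 1) ∧ (∀ s ≤ 1, deriv ψ s = 0) ∧
    (∀ s, 0 ≤ deriv (deriv ψ) s) ∧
    (∀ s, s - 2 ≤ ψ s) := by
  set ψ : ℝ → ℝ := fun t => ∫ s in (0:ℝ)..t, step s with hψ
  have hd : ∀ t, HasDerivAt ψ (step t) t := prim_R step_smooth.continuous
  have hd' : deriv ψ = step := funext fun t => (hd t).deriv
  have h0 : ∀ s ≤ 1, ψ s = 0 := fun s hs => prim_zero (fun _ h => step_zero h) hs
  have hm : Monotone ψ := monotone_of_deriv_nonneg (fun t => (hd t).differentiableAt)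
    (fun t => by rw [hd']; exact step_nonneg t)
  have hnn : ∀ s, 0 ≤ ψ s := fun s => by
    rcases le_total s 1 with h | h
    · exact (h0 s h).ge
    · rw [← h0 1 le_rfl]; exact hm h
  refine ⟨ψ, ?_, h0, hnn, fun s => ?_, fun s hs => ?_, fun s => ?_, fun s => ?_⟩
  · rw [contDiff_iff_contDiffAt]
    exact fun t => contDiffAt_of_deriv_top (Eventually.of_forall hd) step_smooth.contDiffAt
  · rw [hd']; exact ⟨step_nonneg s, step_le_one s⟩
  · rw [hd']; exact step_zero hs
  · rw [hd']
    exact step_mono.deriv_nonneg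
  · rcases le_total s 2 with h | h
    · linarith [hnn s]
    · have : MonotoneOn (fun s => ψ s - s) (Ici 2) := by
        refine monotoneOn_of_deriv_nonneg (convex_Ici 2) ?_ ?_ ?_
        · exact fun t _ => ((hd t).sub (hasDerivAt_id t)).continuousAt.continuousWithinAt
        · exact fun t _ => ((hd t).sub (hasDerivAt_id t)).differentiableAt.differentiableWithinAt
        · intro t ht
          have ht : (2:ℝ) ≤ t := interior_subset ht
          have h1 : deriv (fun s => ψ s - s) t = step t - 1 := ((hd t).sub (hasDerivAt_id t)).deriv
          rw [h1, step_one ht]; simp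
      have h2 := this (mem_Ici.2 le_rfl) h h
      simp only at h2
      linarith [hnn 2]

/-- the power cut-off -/
lemma zeta_exists {α : ℝ} (hα : 1 ≤ α) : ∃ ζ E2 : ℝ → ℝ, ContDiff ℝ (⊤ : ℕ∞) ζ ∧
    (∀ s, HasDerivAt E2 (deriv ζ s ^ 2) s) ∧ (∀ s ≤ 1, ζ s = 0) ∧ (∀ s ≤ 1, E2 s = 0) ∧
    (∀ s, 0 ≤ ζ s) ∧ (∀ s, 0 ≤ s → s ^ α - 2 ^ α ≤ ζ s) ∧ 
    (∀ s, 0 ≤ s → deriv ζ s ^ 2 ≤ α ^ 2 * s ^ (2 * α - 2)) ∧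
    (∀ s, 0 ≤ s → E2 s ≤ α ^ 2 / (2 * α - 1) * s ^ (2 * α - 1)) := by
  set g : ℝ → ℝ := fun s => α * s ^ (α - 1) * step s with hg
  have hgs : ContDiff ℝ (⊤ : ℕ∞) g := by
    rw [contDiff_iff_contDiffAt]
    intro s
    rcases lt_or_ge s 1 with h | h
    · have : g =ᶠ[𝓝 s] fun _ => 0 := by
        filter_upwards [gt_mem_nhds h] with t ht
        simp [hg, step_zero (le_of_lt ht)]
      exact contDiffAt_const.congr_of_eventuallyEq this
    · exact (contDiffAt_const.mul (Real.contDiffAt_rpow_const_of_ne (by linarith))).mul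
        step_smooth.contDiffAt
  have hg0 : ∀ s ≤ 1, g s = 0 := fun s hs => by simp [hg, step_zero hs]
  have hgnn : ∀ s, 0 ≤ g s := fun s => by
    rcases le_total s 1 with h | h
    · exact (hg0 s h).ge
    · have := step_nonneg s
      simp only [hg]; positivity
  set ζ : ℝ → ℝ := fun t => ∫ s in (0:ℝ)..t, g s with hζ
  have hd : ∀ t, HasDerivAt ζ (g t) t := prim_R hgs.continuous
  have hd' : deriv ζ = g := funext fun t => (hd t).deriv
  have h0 : ∀ s ≤ 1, ζ s = 0 := fun s hs => prim_zero hg0 hs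
  have hm : Monotone ζ := monotone_of_deriv_nonneg (fun t => (hd t).differentiableAt)
    (fun t => by rw [hd']; exact hgnn t)
  have hnn : ∀ s, 0 ≤ ζ s := fun s => by
    rcases le_total s 1 with h | h
    · exact (h0 s h).ge
    · rw [← h0 1 le_rfl]; exact hm h
  have hg2 : ∀ s, 0 ≤ s → g s ^ 2 ≤ α ^ 2 * s ^ (2 * α - 2) := by
    intro s hs
    have e : s ^ (2 * α - 2) = (s ^ (α - 1)) ^ 2 := by
      rw [← Real.rpow_natCast, ← Real.rpow_mul hs]; congr 1; push_cast; ring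
    rw [e]
    have h1 := step_nonneg s
    have h2 := step_le_one s
    have h3 : step s ^ 2 ≤ 1 := by nlinarith
    have e2 : g s ^ 2 = α ^ 2 * (s ^ (α - 1)) ^ 2 * step s ^ 2 := by simp only [hg]; ring
    rw [e2]
    exact mul_le_of_le_one_right (by positivity) h3
  set E2 : ℝ → ℝ := fun t => ∫ s in (0:ℝ)..t, g s ^ 2 with hE2
  have hE : ∀ t, HasDerivAt E2 (g t ^ 2) t := prim_R (hgs.continuous.pow 2)
  have hE0 : ∀ s ≤ 1, E2 s = 0 := fun s hs => prim_zero (fun t ht => by simp [hg0 t ht]) hs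
  refine ⟨ζ, E2, ?_, fun s => ?_, h0, hE0, hnn, fun s hs => ?_, fun s hs => ?_, fun s hs => ?_⟩
  · rw [contDiff_iff_contDiffAt]
    exact fun t => contDiffAt_of_deriv_top (Eventually.of_forall hd) hgs.contDiffAt
  · rw [hd']; exact hE s
  · rcases le_total s 2 with h | h
    · have : s ^ α ≤ 2 ^ α := by gcongr
      linarith [hnn s]
    · have hdd : ∀ t, HasDerivAt (fun s => ζ s - s ^ α) (g t - α * t ^ (α - 1)) t := fun t =>
        (hd t).sub (Real.hasDerivAt_rpow_const (Or.inr hα))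
      have : MonotoneOn (fun s => ζ s - s ^ α) (Ici 2) := by
        refine monotoneOn_of_deriv_nonneg (convex_Ici 2) ?_ ?_ ?_
        · exact fun t _ => (hdd t).continuousAt.continuousWithinAt
        · exact fun t _ => (hdd t).differentiableAt.differentiableWithinAt
        · intro t ht
          have ht : (2:ℝ) ≤ t := interior_subset ht
          rw [(hdd t).deriv]
          simp [hg, step_one ht]
      have h2 := this (mem_Ici.2 le_rfl) h h
      simp only at h2
      linarith [hnn 2]
  · rw [hd']; exact hg2 s hs
  · have ha2 : 0 < 2 * α - 1 := by linarith
    have hdd : ∀ t, HasDerivAt (fun s => α ^ 2 / (2 * α - 1) * s ^ (2 * α - 1) - E2 s)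
        (α ^ 2 / (2 * α - 1) * ((2 * α - 1) * t ^ (2 * α - 1 - 1)) - g t ^ 2) t := fun t =>
        ((Real.hasDerivAt_rpow_const (Or.inr (by linarith))).const_mul _).sub (hE t)
    have : MonotoneOn (fun s => α ^ 2 / (2 * α - 1) * s ^ (2 * α - 1) - E2 s) (Ici 0) := by
      refine monotoneOn_of_deriv_nonneg (convex_Ici 0) ?_ ?_ ?_
      · exact fun t _ => (hdd t).continuousAt.continuousWithinAt
      · exact fun t _ => (hdd t).differentiableAt.differentiableWithinAt
      · intro t ht
        have ht : (0:ℝ) ≤ t := interior_subset ht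
        rw [(hdd t).deriv]
        have e : α ^ 2 / (2 * α - 1) * ((2 * α - 1) * t ^ (2 * α - 1 - 1)) =
          α ^ 2 * t ^ (2 * α - 2) := by
          rw [show 2 * α - 1 - 1 = 2 * α - 2 by ring, ← mul_assoc, div_mul_cancel₀ _ ha2.ne']
        rw [e]; linarith [hg2 t ht]
    have h2 := this (mem_Ici.2 le_rfl) hs hs
    simp only [hE0 0 zero_le_one, Real.zero_rpow ha2.ne'] at h2
    linarith

lemma hh_mono {a : EReal} {f : ℝ → ℝ} (hf : HypH a f) {τ ε t0 : ℝ} (hε2 : τ + ε < 2)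
    (N : Near a f τ ε t0) {s t : ℝ} (ht : t ∈ II a) (hs : t0 ≤ s) (hst : s ≤ t) :
    hh f s ≤ hh f t := by
  refine mono_tool (g := hh f) N.mem (fun s hs h1 => ⟨hh_deriv hf hs, ?_⟩) ht hs hst
  have h2 := (N.hT s hs h1).2
  exact mul_nonneg (VV_pos hf hs).le (by linarith)

/-- the test function `η` and its energy `E` -/
structure EtaE (a : EReal) (f : ℝ → ℝ) (α c1 t0 : ℝ) (η E : ℝ → ℝ) : Prop where
  smooth : ∀ t ∈ II a, ContDiffAt ℝ (⊤ : ℕ∞) η t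
  dE : ∀ t ∈ II a, HasDerivAt E (deriv η t ^ 2) t
  eta0 : ∀ t, t ≤ t0 → η t = 0
  E0 : ∀ t ∈ II a, t ≤ t0 → E t = 0
  Emono : ∀ s t, s ∈ II a → t ∈ II a → s ≤ t → E s ≤ E t
  Ele : ∀ t ∈ II a, t0 ≤ t → E t ≤ c1 * (VV f t * hh f t ^ (2 * α - 1))
  etage : ∀ t ∈ II a, t0 ≤ t → (hh f t - hh f t0) ^ α - 2 ^ α ≤ η t

lemma eta_exists {a : EReal} {f : ℝ → ℝ} (hf : HypH a f) {τ α c1 ε σ t0 : ℝ}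
    (P : Par τ α c1 ε σ) (N : Near a f τ ε t0) : ∃ η E, EtaE a f α c1 t0 η E := by
  obtain ⟨ζ, -, hζ, -, hζ0, -, hζnn, hζge, hζd, -⟩ := zeta_exists P.hα
  have hα := P.hα
  set q : ℝ → ℝ := fun t => ζ (hh f t - hh f t0) with hq
  set η : ℝ → ℝ := fun t => if t0 ≤ t then q t else 0 with hη
  have hqs : ∀ t ∈ II a, ContDiffAt ℝ (⊤ : ℕ∞) q t := fun t ht =>
    hζ.contDiffAt.comp t ((hh_smooth hf ht).sub contDiffAt_const)
  have hz : ∀ t ≤ t0, η =ᶠ[𝓝 t] fun _ => 0 := by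
    intro t ht
    rcases ht.lt_or_eq with h | h
    · filter_upwards [gt_mem_nhds h] with s hs
      simp [hη, not_le.2 hs]
    · rw [h]
      have hc : ContinuousAt (hh f) t0 := (hh_smooth hf N.mem).continuousAt
      have : ∀ᶠ s in 𝓝 t0, hh f s < hh f t0 + 1 :=
        hc.eventually (gt_mem_nhds (by linarith))
      filter_upwards [this] with s hs
      by_cases h1 : t0 ≤ s
      · simp only [hη, if_pos h1, hq]
        exact hζ0 _ (by linarith)
      · simp [hη, h1]
  have hp : ∀ t, t0 < t → η =ᶠ[𝓝 t] q := by
    intro t ht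
    filter_upwards [lt_mem_nhds ht] with s hs
    simp [hη, (le_of_lt hs : t0 ≤ s)]
  have hs : ∀ t ∈ II a, ContDiffAt ℝ (⊤ : ℕ∞) η t := by
    intro t ht
    rcases le_or_gt t t0 with h | h
    · exact contDiffAt_const.congr_of_eventuallyEq (hz t h)
    · exact (hqs t ht).congr_of_eventuallyEq (hp t h)
  have hdc : ContinuousOn (fun t => deriv η t ^ 2) (II a) := fun t ht =>
    ((contDiffAt_deriv (m := (⊤ : ℕ∞)) (hs t ht) (by simp)).continuousAt.pow 2).continuousWithinAt
  have hd0 : ∀ t ≤ t0, deriv η t = 0 := fun t ht => by rw [(hz t ht).deriv_eq]; simp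
  set E : ℝ → ℝ := fun t => ∫ s in t0..t, deriv η s ^ 2 with hE
  have dE : ∀ t ∈ II a, HasDerivAt E (deriv η t ^ 2) t := fun t ht => prim_II hdc N.mem ht
  have hdq : ∀ t ∈ II a, t0 ≤ t → deriv η t ^ 2 ≤
      α ^ 2 * hh f t ^ (2 * α - 2) * (VV f t * (1 - TT f t / 2)) ^ 2 := by
    intro t ht h
    rcases h.eq_or_lt with h1 | h1
    · rw [hd0 t h1.ge]
      have := (hh_pos hf ht).le
      simp only [ne_eq, OfNat.ofNat_ne_zero, not_false_eq_true, zero_pow]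
      positivity
    · rw [(hp t h1).deriv_eq]
      have e : HasDerivAt q (deriv ζ (hh f t - hh f t0) * (VV f t * (1 - TT f t / 2))) t :=
        ((hζ.differentiable (by simp)).differentiableAt.hasDerivAt (x := hh f t - hh f t0)).comp t
          ((hh_deriv hf ht).sub_const (hh f t0))
      rw [e.deriv, mul_pow]
      refine mul_le_mul_of_nonneg_right ?_ (sq_nonneg _)
      have hm := hh_mono hf P.hε2 N ht le_rfl h
      refine (hζd _ (by linarith)).trans ?_
      have h0 := hh_pos hf N.mem
      refine mul_le_mul_of_nonneg_left ?_ (by positivity)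
      exact Real.rpow_le_rpow (by linarith) (by linarith) (by linarith)
  refine ⟨η, E, hs, dE, fun t ht => (hz t ht).eq_of_nhds, ?_, ?_, ?_, ?_⟩
  · intro t _ h
    apply intervalIntegral.integral_zero_ae
    refine Eventually.of_forall fun s hs => ?_
    rw [uIoc_of_ge h] at hs
    rw [hd0 s hs.2]; simp
  · intro s t hs' ht hst
    exact mono_tool hs' (fun r hr _ => ⟨dE r hr, sq_nonneg _⟩) ht le_rfl hst
  · intro t ht h
    set D : ℝ → ℝ := fun t => c1 * (VV f t * hh f t ^ (2 * α - 1)) - E t with hD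
    have h1 : D t0 ≤ D t := by
      refine mono_tool (g := D) N.mem (fun s hs' h1 => ⟨(((VV_deriv hf hs').mul
        ((hh_deriv hf hs').rpow_const (p := 2 * α - 1) (Or.inl (hh_pos hf hs').ne'))).const_mul c1).sub
        (dE s hs'), ?_⟩) ht le_rfl h
      have hH := hh_pos hf hs'
      have hV := VV_pos hf hs'
      have e1 : hh f s ^ (2 * α - 1) = hh f s * hh f s ^ (2 * α - 2) := by
        rw [← Real.rpow_one_add' hH.le (by linarith)]; congr 1; ring
      have e2 : (2 * α - 1 - 1) = 2 * α - 2 := by ring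
      rw [e1, e2, sub_nonneg]
      refine (hdq s hs' h1).trans ?_
      have hk := P.hT1 _ (N.hT s hs' h1).1 (N.hT s hs' h1).2
      have h3 := mul_le_mul_of_nonneg_left hk
        (show 0 ≤ hh f s ^ (2 * α - 2) * VV f s ^ 2 by positivity)
      calc _ = hh f s ^ (2 * α - 2) * VV f s ^ 2 * (α ^ 2 * (1 - TT f s / 2) ^ 2) := by ring
        _ ≤ _ := h3
        _ = _ := by field_simp
    have h2 : 0 ≤ D t0 := by
      simp only [hD, hE, intervalIntegral.integral_same, sub_zero]
      have hH := hh_pos hf N.mem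
      have hV := VV_pos hf N.mem
      have := P.hc1
      positivity
    simp only [hD] at h1 h2
    linarith
  · intro t ht h
    have hm := hh_mono hf P.hε2 N ht le_rfl h
    have := hζge (hh f t - hh f t0) (by linarith)
    simpa [hη, h, hq] using this

lemma rearr {x y p : ℝ} (hx : 0 ≤ x) (hy : 0 ≤ y) (hp : 2 ≤ p) :
    x * y ^ (p - 1) + y * x ^ (p - 1) ≤ x ^ p + y ^ p := by
  have e : ∀ z : ℝ, 0 ≤ z → z ^ p = z * z ^ (p - 1) := fun z hz => by
    rw [← Real.rpow_one_add' hz (by linarith)]; congr 1; ring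
  rw [e x hx, e y hy]
  rcases le_total x y with h | h
  · have := Real.rpow_le_rpow hx h (by linarith : 0 ≤ p - 1)
    nlinarith
  · have := Real.rpow_le_rpow hy h (by linarith : 0 ≤ p - 1)
    nlinarith

lemma pow_large {α : ℝ} (hα : 1 ≤ α) (h0 : ℝ) {δ : ℝ} (hδ : 0 < δ) :
    ∃ M ≥ (1:ℝ), ∀ h ≥ M, h0 ≤ h ∧ 2 ^ α ≤ (h - h0) ^ α ∧
      (1 - δ) * h ^ (2 * α) ≤ ((h - h0) ^ α - 2 ^ α) ^ 2 := by
  have hα0 : 0 < α := by linarith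
  have t1 : Tendsto (fun h : ℝ => ((1 - h0 / h) ^ α - (2 / h) ^ α) ^ 2) atTop (𝓝 1) := by
    have a1 : Tendsto (fun h : ℝ => (1 - h0 / h) ^ α) atTop (𝓝 ((1 - 0) ^ α)) :=
      (tendsto_const_nhds.sub (tendsto_const_nhds.div_atTop tendsto_id)).rpow_const
        (Or.inr hα0.le)
    have a2 : Tendsto (fun h : ℝ => (2 / h) ^ α) atTop (𝓝 (0 ^ α)) :=
      (tendsto_const_nhds.div_atTop tendsto_id).rpow_const (Or.inr hα0.le)
    have := (a1.sub a2).pow 2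
    simpa [Real.zero_rpow hα0.ne'] using this
  have e1 := t1.eventually (lt_mem_nhds (by linarith : 1 - δ < 1))
  obtain ⟨M, hM⟩ := eventually_atTop.1 (e1.and (eventually_ge_atTop (max (|h0| + 2) 1)))
  refine ⟨max M 1, le_max_right _ _, fun h hh => ?_⟩
  obtain ⟨h1, h2⟩ := hM h ((le_max_left _ _).trans hh)
  have h3 : |h0| + 2 ≤ h := (le_max_left _ _).trans h2
  have h4 := le_abs_self h0
  have hp : 0 < h := by have := abs_nonneg h0; linarith
  refine ⟨by linarith, Real.rpow_le_rpow (by norm_num) (by linarith) hα0.le, ?_⟩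
  have e2 : (h - h0) ^ α = h ^ α * (1 - h0 / h) ^ α := by
    rw [← Real.mul_rpow hp.le]
    · congr 1; field_simp
    · rw [sub_nonneg, div_le_one hp]; linarith
  have e3 : (2:ℝ) ^ α = h ^ α * (2 / h) ^ α := by
    rw [← Real.mul_rpow hp.le (by positivity)]; congr 1; field_simp
  have e4 : h ^ (2 * α) = (h ^ α) ^ 2 := by
    rw [← Real.rpow_natCast, ← Real.rpow_mul hp.le]; congr 1; push_cast; ring
  rw [e2, e3, e4, ← mul_sub, mul_pow, mul_comm]
  exact mul_le_mul_of_nonneg_left h1.le (by positivity)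

lemma zeta_low {α : ℝ} (hα : 1 ≤ α) {δ : ℝ} (hδ : 0 < δ) :
    ∃ C ≥ 0, ∀ z s : ℝ, 0 ≤ s → 0 ≤ z → s ^ α - 2 ^ α ≤ z → (1 - δ) * s ^ (2 * α) ≤ z ^ 2 + C := by
  obtain ⟨M, hM1, hM⟩ := pow_large hα 0 hδ
  refine ⟨M ^ (2 * α), by positivity, fun z s hs hz h => ?_⟩
  rcases le_total M s with h1 | h1
  · obtain ⟨-, h3, h4⟩ := hM s h1
    rw [sub_zero] at h3 h4
    have : (s ^ α - 2 ^ α) ^ 2 ≤ z ^ 2 := by gcongr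
    have : 0 ≤ M ^ (2 * α) := by positivity
    linarith
  · have h5 : s ^ (2 * α) ≤ M ^ (2 * α) := Real.rpow_le_rpow hs h1 (by linarith)
    have h6 : 0 ≤ s ^ (2 * α) := by positivity
    nlinarith [sq_nonneg z]

lemma young1 {α : ℝ} (hα : 1 ≤ α) {b δ : ℝ} (hb : 0 ≤ b) (hδ : 0 < δ) :
    ∃ C ≥ 0, ∀ s : ℝ, 0 ≤ s → b * s ^ (2 * α - 1) ≤ δ * s ^ (2 * α) + C := by
  refine ⟨b * (b / δ) ^ (2 * α - 1), by positivity, fun s hs => ?_⟩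
  have e : s ^ (2 * α) = s * s ^ (2 * α - 1) := by
    rw [← Real.rpow_one_add' hs (by linarith)]; congr 1; ring
  have h0 : 0 ≤ s ^ (2 * α - 1) := by positivity
  rcases le_total (b / δ) s with h | h
  · rw [div_le_iff₀ hδ] at h
    have : 0 ≤ b * (b / δ) ^ (2 * α - 1) := by positivity
    rw [e]
    nlinarith
  · have : s ^ (2 * α - 1) ≤ (b / δ) ^ (2 * α - 1) := Real.rpow_le_rpow hs h (by linarith)
    have := mul_le_mul_of_nonneg_left this hb
    have : 0 ≤ δ * s ^ (2 * α) := by positivity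
    linarith

lemma core1 {α c1 c2 : ℝ} (hα : 1 ≤ α) (hc1 : 0 < c1) (hc2 : 0 < c2) :
    ∃ A > 0, ∃ κ ≥ 0, κ ^ 2 = c1 * c2 ∧ ∀ h w : ℝ, 0 ≤ h → 0 ≤ w →
      c1 * (w * h ^ (2 * α - 1)) + A * c2 * (h * w ^ (2 * α - 1)) ≤
        κ * (h ^ (2 * α) + A * w ^ (2 * α)) := by
  set κ := √(c1 * c2) with hκ
  have hκp : 0 < κ := Real.sqrt_pos.2 (by positivity)
  have hκ2 : κ ^ 2 = c1 * c2 := Real.sq_sqrt (by positivity)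
  set s := κ / c1 with hs
  have hsp : 0 < s := by positivity
  refine ⟨s ^ (-(2 * α)), by positivity, κ, hκp.le, hκ2, fun h w hh hw => ?_⟩
  set v := w / s with hv
  have hvp : 0 ≤ v := by positivity
  have hw' : w = s * v := by rw [hv]; field_simp
  have e1 : w ^ (2 * α) = s ^ (2 * α) * v ^ (2 * α) := by rw [hw', Real.mul_rpow hsp.le hvp]
  have e2 : w ^ (2 * α - 1) = s ^ (2 * α - 1) * v ^ (2 * α - 1) := by
    rw [hw', Real.mul_rpow hsp.le hvp]
  have e3 : s ^ (-(2 * α)) * s ^ (2 * α) = 1 := by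
    rw [← Real.rpow_add hsp]; simp
  have e4 : s ^ (-(2 * α)) * s ^ (2 * α - 1) = s⁻¹ := by
    rw [← Real.rpow_add hsp, ← Real.rpow_neg_one]; congr 1; ring
  have e5 : c1 * s = κ := by rw [hs]; field_simp
  have e6 : c2 * s⁻¹ = κ := by rw [hs]; field_simp; linarith
  have hr := rearr hvp hh (p := 2 * α) (by linarith)
  calc c1 * (w * h ^ (2 * α - 1)) + s ^ (-(2 * α)) * c2 * (h * w ^ (2 * α - 1))
      = (c1 * s) * (v * h ^ (2 * α - 1)) +
        c2 * (s ^ (-(2 * α)) * s ^ (2 * α - 1)) * (h * v ^ (2 * α - 1)) := by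
        rw [e2]; nth_rewrite 1 [hw']; ring
    _ = κ * (v * h ^ (2 * α - 1) + h * v ^ (2 * α - 1)) := by rw [e4, e5, e6]; ring
    _ ≤ κ * (v ^ (2 * α) + h ^ (2 * α)) := mul_le_mul_of_nonneg_left hr hκp.le
    _ = κ * (h ^ (2 * α) + (s ^ (-(2 * α)) * s ^ (2 * α)) * v ^ (2 * α)) := by rw [e3]; ring
    _ = _ := by rw [e1]; ring

set_option maxHeartbeats 800000 in
lemma pointwise {a : EReal} {f : ℝ → ℝ} (hf : HypH a f) {τ α c1 ε σ t0 : ℝ}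
    (P : Par τ α c1 ε σ) (N : Near a f τ ε t0) {η E ζ : ℝ → ℝ} (H : EtaE a f α c1 t0 η E)
    (hζ0 : ∀ s, 0 ≤ ζ s) (hζ : ∀ s, 0 ≤ s → s ^ α - 2 ^ α ≤ ζ s) {C3 : ℝ} (hC3 : 0 < C3) :
    ∃ A μ θ C : ℝ, 0 < A ∧ 0 < μ ∧ 0 ≤ θ ∧ θ < 1 ∧ 0 ≤ C ∧ ∀ t ∈ II a, ∀ w : ℝ, 0 ≤ w →
      w * E t + (A * (α ^ 2 / (2 * α - 1)) + μ * C3) * (f t * w ^ (2 * α - 1)) ≤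
        θ * (VV f t * η t ^ 2 + A * (VV f t * ζ w ^ 2)) + μ / 2 * ζ w ^ 2 + C := by
  have hα := P.hα
  have hc1 := P.hc1
  set c2 := α ^ 2 / (2 * α - 1) with hc2
  have hc2p : 0 < c2 := div_pos (by positivity) (by linarith)
  obtain ⟨c3, h23, h3⟩ : ∃ c3, c2 < c3 ∧ c3 < 1 / c1 := by
    apply exists_between
    rw [lt_div_iff₀ hc1]; linarith [P.hc12]
  have h31 : c1 * c3 < 1 := by rw [lt_div_iff₀ hc1] at h3; linarith
  obtain ⟨A, hA, κ, hκ0, hκ2, hcore⟩ := core1 hα hc1 (hc2p.trans h23)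
  have hκ1 : κ < 1 := by nlinarith
  set δ := (1 - κ) / 3 with hδ
  have hδp : 0 < δ := by rw [hδ]; linarith
  have hδ1 : δ < 1 := by rw [hδ]; linarith
  have hδκ : κ < (1 - δ) ^ 2 := by rw [hδ]; nlinarith
  have hδq : 0 < (1 - δ) ^ 2 := by nlinarith
  set μ := A * (c3 - c2) / C3 with hμ
  have hμp : 0 < μ := div_pos (mul_pos hA (by linarith)) hC3
  have hsum : A * c2 + μ * C3 = A * c3 := by rw [hμ]; field_simp; ring
  obtain ⟨C0, hC0, hlow⟩ := zeta_low hα hδp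
  obtain ⟨M, hM1, hM⟩ := pow_large hα (hh f t0) hδp
  obtain ⟨t2, ht2, h02, hlarge⟩ := hh_large hf P.hε2 N (max M (A * C0 / δ))
  have hEt2 : 0 ≤ E t2 := by
    rw [← H.E0 t0 N.mem le_rfl]; exact H.Emono _ _ N.mem ht2 h02
  have hft2 : 0 < f t2 := hf.pos t2 (II_sub ht2)
  have hc3p : 0 < c3 := hc2p.trans h23
  obtain ⟨C1, hC1, hy⟩ := young1 hα (b := E t2 + A * c3 * f t2) (by positivity)
    (δ := μ / 4) (by positivity)
  obtain ⟨C0', hC0', hlow'⟩ := zeta_low hα (δ := 1 / 2) (by norm_num)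
  refine ⟨A, μ, κ / (1 - δ) ^ 2, E t2 + C1 + μ / 2 * C0', hA, hμp, by positivity,
    (div_lt_one hδq).2 hδκ, by positivity, fun t ht w hw => ?_⟩
  rw [hsum]
  have hV := VV_pos hf ht
  have hH := hh_pos hf ht
  have hθ : 0 ≤ κ / (1 - δ) ^ 2 := by positivity
  have hwp : 0 ≤ w ^ (2 * α - 1) := by positivity
  rcases le_total t2 t with h | h
  · have hl := hlarge t ht h
    have hl1 : M ≤ hh f t := (le_max_left _ _).trans hl
    have hl2 : A * C0 / δ ≤ hh f t := (le_max_right _ _).trans hl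
    obtain ⟨b1, b2, b3⟩ := hM _ hl1
    have b4 : ((hh f t - hh f t0) ^ α - 2 ^ α) ^ 2 ≤ η t ^ 2 := by
      have := H.etage t ht (h02.trans h)
      have h6 : 0 ≤ (hh f t - hh f t0) ^ α - 2 ^ α := by linarith
      gcongr
    have b5 : A * C0 ≤ δ * hh f t ^ (2 * α) := by
      rw [div_le_iff₀ hδp] at hl2
      have : hh f t ^ (1:ℝ) ≤ hh f t ^ (2 * α) :=
        Real.rpow_le_rpow_of_exponent_le (hM1.trans hl1) (by linarith)
      rw [Real.rpow_one] at this
      have := mul_le_mul_of_nonneg_left this hδp.le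
      linarith
    have b6 := hlow _ w hw (hζ0 w) (hζ w hw)
    have b7 := mul_le_mul_of_nonneg_left b6 hA.le
    set X := hh f t ^ (2 * α) with hX
    set Y := w ^ (2 * α) with hY
    have b8 : (1 - δ) * (X + A * Y) ≤ X + A * ζ w ^ 2 := by linarith
    have b9 : (1 - δ) ^ 2 * (X + A * Y) ≤ η t ^ 2 + A * ζ w ^ 2 := by
      have := mul_le_mul_of_nonneg_left b8 (by linarith : 0 ≤ 1 - δ)
      have : 0 ≤ δ * (A * ζ w ^ 2) := by positivity
      linarith
    have b10 : κ * (X + A * Y) ≤ κ / (1 - δ) ^ 2 * (η t ^ 2 + A * ζ w ^ 2) := by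
      have := mul_le_mul_of_nonneg_left b9 hθ
      refine le_trans (le_of_eq ?_) this
      rw [← mul_assoc, div_mul_cancel₀ _ hδq.ne']
    have b11 := H.Ele t ht (h02.trans h)
    have b12 := mul_le_mul_of_nonneg_left b11 hw
    have b13 := mul_le_mul_of_nonneg_left ((hcore _ w hH.le hw).trans b10) hV.le
    have b14 : 0 ≤ E t2 + C1 + μ / 2 * C0' := by positivity
    have b15 : 0 ≤ μ / 2 * ζ w ^ 2 := by positivity
    rw [f_eq hf ht]
    calc _ ≤ w * (c1 * (VV f t * hh f t ^ (2 * α - 1))) +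
          A * c3 * (VV f t * hh f t * w ^ (2 * α - 1)) := by linarith
      _ = VV f t * (c1 * (w * hh f t ^ (2 * α - 1)) + A * c3 * (hh f t * w ^ (2 * α - 1))) := by
        ring
      _ ≤ _ := b13
      _ = κ / (1 - δ) ^ 2 * (VV f t * η t ^ 2 + A * (VV f t * ζ w ^ 2)) := by ring
      _ ≤ _ := by linarith
  · have b1 : E t ≤ E t2 := H.Emono _ _ ht ht2 h
    have b2 : f t ≤ f t2 := hf.mono.monotoneOn (II_sub ht) (II_sub ht2) h
    have b3 : w ≤ 1 + w ^ (2 * α - 1) := by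
      rcases le_total w 1 with h1 | h1
      · linarith
      · have : w ^ (1:ℝ) ≤ w ^ (2 * α - 1) :=
          Real.rpow_le_rpow_of_exponent_le h1 (by linarith)
        rw [Real.rpow_one] at this; linarith
    have b4 := hy w hw
    have b5 := hlow' _ w hw (hζ0 w) (hζ w hw)
    have b6 : 0 ≤ κ / (1 - δ) ^ 2 * (VV f t * η t ^ 2 + A * (VV f t * ζ w ^ 2)) := by positivity
    have b7 : w * E t ≤ (1 + w ^ (2 * α - 1)) * E t2 :=
      (mul_le_mul_of_nonneg_left b1 hw).trans (mul_le_mul_of_nonneg_right b3 hEt2)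
    have b8 : A * c3 * (f t * w ^ (2 * α - 1)) ≤ A * c3 * (f t2 * w ^ (2 * α - 1)) := by gcongr
    have b9 := mul_le_mul_of_nonneg_left b5 (by positivity : 0 ≤ μ / 2)
    linarith


lemma bddII {a : EReal} {g : ℝ → ℝ} (hg : ContinuousOn g (II a)) {t0 C0 : ℝ} (ht0 : t0 ∈ II a)
    (h0 : ∀ s, 0 < s → s ≤ t0 → |g s| ≤ C0) :
    ∀ t ∈ II a, ∃ C, ∀ s, 0 < s → s ≤ t → |g s| ≤ C := by
  intro t ht
  obtain ⟨C, hC⟩ := (isCompact_Icc (a := t0) (b := t)).exists_bound_of_continuousOn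
    (hg.mono fun s hs => II_down ht (ht0.1.trans_le hs.1) hs.2)
  refine ⟨max C0 C, fun s hs hst => ?_⟩
  rcases le_total s t0 with h | h
  · exact (h0 s hs h).trans (le_max_left _ _)
  · exact (hC s ⟨h, hst⟩).trans (le_max_right _ _)

lemma f_contII {a : EReal} {f : ℝ → ℝ} (hf : HypH a f) : ContinuousOn f (II a) :=
  fun t ht => (f_diff hf ht).continuousAt.continuousWithinAt

lemma f_bddII {a : EReal} {f : ℝ → ℝ} (hf : HypH a f) :
    ∀ t ∈ II a, ∃ C, ∀ s, 0 < s → s ≤ t → |f s| ≤ C := fun t ht =>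
  ⟨f t, fun s hs hst => by
    have h := II_down ht hs hst
    rw [abs_of_pos (hf.pos s (II_sub h))]
    exact hf.mono.monotoneOn (II_sub h) (II_sub ht) hst⟩

lemma EtaE.cont {a : EReal} {f : ℝ → ℝ} {α c1 t0 : ℝ} {η E : ℝ → ℝ} (H : EtaE a f α c1 t0 η E) :
    ContinuousOn η (II a) := fun t ht => (H.smooth t ht).continuousAt.continuousWithinAt

lemma EtaE.contE {a : EReal} {f : ℝ → ℝ} {α c1 t0 : ℝ} {η E : ℝ → ℝ} (H : EtaE a f α c1 t0 η E) :
    ContinuousOn E (II a) := fun t ht => (H.dE t ht).continuousAt.continuousWithinAt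

lemma k1 {Ω : Set (EuclideanSpace ℝ (Fin n))} (hΩ : GoodDomain Ω)
    {a : EReal} {f : ℝ → ℝ} {α c1 t0 L : ℝ} {η E : ℝ → ℝ} (H : EtaE a f α c1 t0 η E)
    (ht0 : t0 ∈ II a)
    {u w : EuclideanSpace ℝ (Fin n) → ℝ} (S : Sys Ω a f L u w) :
    ∫ x in Ω, VV f (u x) * η (u x) ^ 2 ≤ ∫ x in Ω, w x * E (u x) := by
  have hK := superlevel_compact hΩ.2.1 S.hu.continuous t0
  have hKΩ := superlevel_sub hΩ.1 ht0.1 S.u0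
  have hlt : ∀ x ∈ Ω, x ∉ closure Ω ∩ {x | t0 ≤ u x} → u x ≤ t0 := fun x hx hxK => by
    by_contra h
    exact hxK ⟨subset_closure hx, (not_le.1 h).le⟩
  have h0 : ∀ x ∈ Ω, x ∉ closure Ω ∩ {x | t0 ≤ u x} → η (u x) = 0 := fun x hx hxK =>
    H.eta0 _ (hlt x hx hxK)
  have hq : ∀ x ∈ Ω, ContDiffAt ℝ (⊤ : ℕ∞) (fun x => η (u x)) x := fun x hx =>
    (H.smooth _ (S.uI x hx)).comp x S.hu.contDiffAt
  have st := S.stab _ (loc_contDiff hΩ.1 hK hKΩ hq h0) (loc_hcs hK h0)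
    ((loc_supp hK h0).trans hKΩ)
  rw [energy hΩ.1 hK hKΩ S.hu (η := η) (F := E) (fun x hx => H.smooth _ (S.uI x hx)) ?_
    (fun x hx => (H.dE _ (S.uI x hx)).deriv)
    (fun x hx hxK => H.E0 _ (S.uI x hx) (hlt x hx hxK))] at st
  · have e1 : ∫ x in Ω, √(deriv f (u x)) * (Ω.indicator (fun x => η (u x)) x) ^ 2
        = ∫ x in Ω, VV f (u x) * η (u x) ^ 2 :=
      setIntegral_congr_fun hΩ.1.measurableSet fun x hx => by simp [hx, VV]
    have e2 : ∫ x in Ω, E (u x) * -lap u x = L * ∫ x in Ω, w x * E (u x) := by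
      rw [← integral_const_mul]
      exact setIntegral_congr_fun hΩ.1.measurableSet fun x hx => by simp only [S.lu x]; ring
    rw [e1, e2] at st
    exact le_of_mul_le_mul_left st S.Lpos
  · intro x hx
    have : ContDiffAt ℝ (⊤ : ℕ∞) E (u x) := by
      refine contDiffAt_of_deriv_top (k' := fun t => deriv η t ^ 2) ?_ ?_
      · filter_upwards [II_nhds (S.uI x hx)] with t ht using H.dE t ht
      · exact (contDiffAt_deriv (H.smooth _ (S.uI x hx)) (by simp)).pow 2
    exact this.of_le one_le_inf

lemma k23 (hn : 0 < n) {Ω : Set (EuclideanSpace ℝ (Fin n))} (hΩ : GoodDomain Ω)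
    {a : EReal} {f : ℝ → ℝ} {L R : ℝ} (hR : 0 < R) (hΩR : ∀ x ∈ Ω, ‖x‖ ≤ R)
    {ζ E2 : ℝ → ℝ} (hζ : ContDiff ℝ (⊤ : ℕ∞) ζ)
    (hE2 : ∀ s, HasDerivAt E2 (deriv ζ s ^ 2) s) (hζ0 : ∀ s ≤ 1, ζ s = 0) (hE0 : ∀ s ≤ 1, E2 s = 0)
    {u w : EuclideanSpace ℝ (Fin n) → ℝ} (S : Sys Ω a f L u w) :
    ∫ x in Ω, VV f (u x) * ζ (w x) ^ 2 ≤ ∫ x in Ω, f (u x) * E2 (w x) ∧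
    ∫ x in Ω, ζ (w x) ^ 2 ≤ 4 * R ^ 2 * (L * ∫ x in Ω, f (u x) * E2 (w x)) := by
  have hK := superlevel_compact hΩ.2.1 S.hw.continuous 1
  have hKΩ := superlevel_sub hΩ.1 one_pos S.w0
  have hlt : ∀ x ∈ Ω, x ∉ closure Ω ∩ {x | 1 ≤ w x} → w x ≤ 1 := fun x hx hxK => by
    by_contra h
    exact hxK ⟨subset_closure hx, (not_le.1 h).le⟩
  have h0 : ∀ x ∈ Ω, x ∉ closure Ω ∩ {x | 1 ≤ w x} → ζ (w x) = 0 := fun x hx hxK =>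
    hζ0 _ (hlt x hx hxK)
  have hq : ∀ x ∈ Ω, ContDiffAt ℝ (⊤ : ℕ∞) (fun x => ζ (w x)) x := fun x hx =>
    (hζ.comp S.hw).contDiffAt
  have hφ := loc_contDiff hΩ.1 hK hKΩ hq h0
  have hφc := loc_hcs hK h0
  have hφs := (loc_supp hK h0).trans hKΩ
  have st := S.stab _ hφ hφc hφs
  have hE2c : ∀ s, ContDiffAt ℝ (⊤ : ℕ∞) E2 s := fun s => by
    refine contDiffAt_of_deriv_top (k' := fun t => deriv ζ t ^ 2) ?_ ?_
    · exact Eventually.of_forall hE2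
    · exact (contDiffAt_deriv hζ.contDiffAt (by simp)).pow 2
  have en := energy hΩ.1 hK hKΩ S.hw (η := ζ) (F := E2) (fun x hx => hζ.contDiffAt)
    (fun x hx => (hE2c _).of_le one_le_inf)
    (fun x hx => (hE2 _).deriv) (fun x hx hxK => hE0 _ (hlt x hx hxK))
  have e1 : ∫ x in Ω, √(deriv f (u x)) * (Ω.indicator (fun x => ζ (w x)) x) ^ 2
      = ∫ x in Ω, VV f (u x) * ζ (w x) ^ 2 :=
    setIntegral_congr_fun hΩ.1.measurableSet fun x hx => by simp [hx, VV]
  have e2 : ∫ x in Ω, E2 (w x) * -lap w x = L * ∫ x in Ω, f (u x) * E2 (w x) := by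
    rw [← integral_const_mul]
    exact setIntegral_congr_fun hΩ.1.measurableSet fun x hx => by simp only [S.lw x hx]; ring
  rw [e2] at en
  rw [e1, en] at st
  refine ⟨le_of_mul_le_mul_left st S.Lpos, ?_⟩
  have po := poincare hn (hφ.of_le one_le_inf) hφc hR (fun x hx => by
    by_cases h : x ∈ Ω
    · exact hΩR x h
    · simp [h] at hx)
  have e3 : ∫ x, (Ω.indicator (fun x => ζ (w x)) x) ^ 2 = ∫ x in Ω, ζ (w x) ^ 2 := by
    rw [← integral_indicator hΩ.1.measurableSet]
    refine integral_congr_ae (Eventually.of_forall fun x => ?_)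
    by_cases h : x ∈ Ω <;> simp [h]
  have e4 : ∫ x, ‖gradient (Ω.indicator (fun x => ζ (w x))) x‖ ^ 2
      = ∫ x in Ω, ‖gradient (Ω.indicator (fun x => ζ (w x))) x‖ ^ 2 := by
    symm
    apply setIntegral_eq_integral_of_forall_compl_eq_zero
    intro x hx
    have h1 : x ∉ tsupport (Ω.indicator (fun x => ζ (w x))) := fun h => hx (hφs h)
    have h2 : fderiv ℝ (Ω.indicator (fun x => ζ (w x))) x = 0 :=
      image_eq_zero_of_notMem_tsupport fun h => h1 (tsupport_fderiv_subset ℝ h)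
    simp [gradient, h2]
  rw [e3, e4, en] at po
  exact po

lemma int_bound (hn : 0 < n) {Ω : Set (EuclideanSpace ℝ (Fin n))} (hΩ : GoodDomain Ω)
    {a : EReal} {f : ℝ → ℝ} (hf : HypH a f) {τ α c1 ε σ t0 : ℝ}
    (P : Par τ α c1 ε σ) (N : Near a f τ ε t0) {η E ζ E2 : ℝ → ℝ} (H : EtaE a f α c1 t0 η E)
    (hζ : ContDiff ℝ (⊤ : ℕ∞) ζ)
    (hE2 : ∀ s, HasDerivAt E2 (deriv ζ s ^ 2) s) (hζ0 : ∀ s ≤ 1, ζ s = 0) (hE0 : ∀ s ≤ 1, E2 s = 0)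
    (hζnn : ∀ s, 0 ≤ ζ s) (hζge : ∀ s, 0 ≤ s → s ^ α - 2 ^ α ≤ ζ s)
    (hE2le : ∀ s, 0 ≤ s → E2 s ≤ α ^ 2 / (2 * α - 1) * s ^ (2 * α - 1)) :
    ∃ C : ℝ, ∀ L u w, Sys Ω a f L u w →
      ∫ x in Ω, VV f (u x) * η (u x) ^ 2 ≤ C ∧ ∫ x in Ω, ζ (w x) ^ 2 ≤ C := by
  obtain ⟨L0, hL0, hL⟩ := L_bound hn hΩ hf
  obtain ⟨R', hR'⟩ := hΩ.2.1.exists_norm_le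
  set R := max R' 1 with hRdef
  have hR : 0 < R := lt_max_of_lt_right one_pos
  have hΩR : ∀ x ∈ Ω, ‖x‖ ≤ R := fun x hx => (hR' x hx).trans (le_max_left _ _)
  have hα := P.hα
  set c2 := α ^ 2 / (2 * α - 1) with hc2
  have hc2p : 0 < c2 := div_pos (by positivity) (by linarith)
  set C3 := 4 * R ^ 2 * (L0 * c2) with hC3
  have hC3p : 0 < C3 := by positivity
  obtain ⟨A, μ, θ, C, hA, hμ, hθ0, hθ1, hC, hpt⟩ := pointwise hf P N H hζnn hζge hC3p
  set B := C * (volume Ω).toReal with hB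
  refine ⟨max (B / (1 - θ)) (B / (μ / 2)), fun L u w S => ?_⟩
  have m := hΩ.1.measurableSet
  have hVb := V_bdd hf
  have hVc := V_cont hf
  have i1 : IntegrableOn (fun x => VV f (u x) * η (u x) ^ 2) Ω := by
    have := S.int hΩ (g := fun t => VV f t * η t ^ 2) (p := fun _ => 1)
      (hVc.mul (H.cont.pow 2)) (bddII (hVc.mul (H.cont.pow 2)) N.mem (C0 := 0)
        (fun s _ h => by simp [H.eta0 s h])) continuous_const
    simpa using this
  have i2 : IntegrableOn (fun x => VV f (u x) * ζ (w x) ^ 2) Ω :=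
    S.int hΩ (g := VV f) (p := fun t => ζ t ^ 2) hVc hVb (hζ.continuous.pow 2)
  have i3 : IntegrableOn (fun x => ζ (w x) ^ 2) Ω := by
    have := S.int hΩ (g := fun _ => 1) (p := fun t => ζ t ^ 2) continuousOn_const
      (fun t ht => ⟨1, by simp⟩) (hζ.continuous.pow 2)
    simpa using this
  have i4 : IntegrableOn (fun x => w x * E (u x)) Ω := by
    have := S.int hΩ (g := E) (p := id) H.contE (bddII H.contE N.mem (C0 := 0)
        (fun s h0 h => by simp [H.E0 s (II_down N.mem h0 h) h])) continuous_id
    simpa [mul_comm] using this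
  have i5 : IntegrableOn (fun x => f (u x) * w x ^ (2 * α - 1)) Ω :=
    S.int hΩ (g := f) (p := fun t => t ^ (2 * α - 1)) (f_contII hf) (f_bddII hf)
      (Real.continuous_rpow_const (by linarith))
  have i6 : IntegrableOn (fun x => f (u x) * E2 (w x)) Ω :=
    S.int hΩ (g := f) (p := E2) (f_contII hf) (f_bddII hf)
      (continuous_iff_continuousAt.2 fun s => (hE2 s).continuousAt)
  have q1 := k1 hΩ H N.mem S
  obtain ⟨q2, q3⟩ := k23 hn hΩ hR hΩR hζ hE2 hζ0 hE0 S
  have q4 : ∫ x in Ω, f (u x) * E2 (w x) ≤ c2 * ∫ x in Ω, f (u x) * w x ^ (2 * α - 1) := by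
    rw [← integral_const_mul]
    refine setIntegral_mono_on i6 (i5.const_mul _) m fun x hx => ?_
    have := mul_le_mul_of_nonneg_left (hE2le (w x) (S.wpos x hx).le)
      (hf.pos _ (II_sub (S.uI x hx))).le
    linarith
  have q5 : (∫ x in Ω, w x * E (u x)) + (A * c2 + μ * C3) * (∫ x in Ω, f (u x) * w x ^ (2 * α - 1))
      ≤ θ * ((∫ x in Ω, VV f (u x) * η (u x) ^ 2) + A * ∫ x in Ω, VV f (u x) * ζ (w x) ^ 2)
        + μ / 2 * (∫ x in Ω, ζ (w x) ^ 2) + B := by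
    have l : ∫ x in Ω, (w x * E (u x) + (A * c2 + μ * C3) * (f (u x) * w x ^ (2 * α - 1))) ≤
        ∫ x in Ω, (θ * (VV f (u x) * η (u x) ^ 2 + A * (VV f (u x) * ζ (w x) ^ 2))
          + μ / 2 * ζ (w x) ^ 2 + C) := by
      refine setIntegral_mono_on (i4.add (i5.const_mul _))
        ((((i1.add (i2.const_mul _)).const_mul _).add (i3.const_mul _)).add
          (integrableOn_const hΩ.2.1.measure_lt_top.ne)) m fun x hx => ?_
      exact hpt _ (S.uI x hx) _ (S.wpos x hx).le
    have j1 : IntegrableOn (fun x => θ * (VV f (u x) * η (u x) ^ 2 +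
        A * (VV f (u x) * ζ (w x) ^ 2))) Ω := (i1.add (i2.const_mul _)).const_mul _
    have j2 : IntegrableOn (fun x => θ * (VV f (u x) * η (u x) ^ 2 +
        A * (VV f (u x) * ζ (w x) ^ 2)) + μ / 2 * ζ (w x) ^ 2) Ω := j1.add (i3.const_mul _)
    rw [integral_add i4 (i5.const_mul _), integral_const_mul,
      integral_add j2 (integrableOn_const hΩ.2.1.measure_lt_top.ne),
      integral_add j1 (i3.const_mul _),
      integral_const_mul, integral_const_mul, integral_add i1 (i2.const_mul _),
      integral_const_mul, setIntegral_const] at l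
    rw [hB]
    simpa [Measure.real, mul_comm C] using l
  set X := ∫ x in Ω, VV f (u x) * η (u x) ^ 2
  set Y := ∫ x in Ω, VV f (u x) * ζ (w x) ^ 2
  set Z := ∫ x in Ω, ζ (w x) ^ 2
  set W := ∫ x in Ω, w x * E (u x)
  set Q := ∫ x in Ω, f (u x) * w x ^ (2 * α - 1)
  set Q' := ∫ x in Ω, f (u x) * E2 (w x)
  have hX : 0 ≤ X := setIntegral_nonneg m fun x hx =>
    mul_nonneg (VV_pos hf (S.uI x hx)).le (sq_nonneg _)
  have hY : 0 ≤ Y := setIntegral_nonneg m fun x hx =>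
    mul_nonneg (VV_pos hf (S.uI x hx)).le (sq_nonneg _)
  have hZ : 0 ≤ Z := setIntegral_nonneg m fun x hx => sq_nonneg _
  have hQ : 0 ≤ Q := setIntegral_nonneg m fun x hx =>
    mul_nonneg (hf.pos _ (II_sub (S.uI x hx))).le (Real.rpow_nonneg (S.wpos x hx).le _)
  have hZ3 : Z ≤ C3 * Q := by
    have h1 : L * Q' ≤ L0 * (c2 * Q) :=
      (mul_le_mul_of_nonneg_left q4 S.Lpos.le).trans
        (mul_le_mul_of_nonneg_right (hL L u w S) (by positivity))
    have := mul_le_mul_of_nonneg_left h1 (by positivity : 0 ≤ 4 * R ^ 2)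
    rw [hC3]; linarith
  have r1 : A * Y ≤ A * (c2 * Q) := mul_le_mul_of_nonneg_left (q2.trans q4) hA.le
  have r2 : μ * Z ≤ μ * (C3 * Q) := mul_le_mul_of_nonneg_left hZ3 hμ.le
  have r3 : (1 - θ) * (X + A * Y) + μ / 2 * Z ≤ B := by linarith
  have r4 : 0 ≤ (1 - θ) * (A * Y) := mul_nonneg (by linarith) (by positivity)
  have r5 : 0 ≤ (1 - θ) * X := mul_nonneg (by linarith) hX
  have r6 : 0 ≤ μ / 2 * Z := by positivity
  constructor
  · refine le_trans ?_ (le_max_left _ _)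
    rw [le_div_iff₀ (by linarith)]; linarith
  · refine le_trans ?_ (le_max_right _ _)
    rw [le_div_iff₀ (by positivity)]; linarith

/-- primitive of `V` vanishing at `t0` -/
def GG (f : ℝ → ℝ) (t0 t : ℝ) : ℝ := ∫ s in t0..t, VV f s

lemma GG_deriv {a : EReal} {f : ℝ → ℝ} (hf : HypH a f) {t0 t : ℝ} (ht0 : t0 ∈ II a)
    (ht : t ∈ II a) : HasDerivAt (GG f t0) (VV f t) t :=
  prim_II (V_cont hf) ht0 ht

lemma GG_smooth {a : EReal} {f : ℝ → ℝ} (hf : HypH a f) {t0 t : ℝ} (ht0 : t0 ∈ II a)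
    (ht : t ∈ II a) : ContDiffAt ℝ (⊤ : ℕ∞) (GG f t0) t := by
  refine contDiffAt_of_deriv_top (k' := VV f) ?_ (VV_smooth hf ht)
  filter_upwards [II_nhds ht] with s hs using GG_deriv hf ht0 hs

lemma GG_cont {a : EReal} {f : ℝ → ℝ} (hf : HypH a f) {t0 : ℝ} (ht0 : t0 ∈ II a) :
    ContinuousOn (GG f t0) (II a) := fun _ ht =>
  (GG_deriv hf ht0 ht).continuousAt.continuousWithinAt

lemma GG_deriv2 {a : EReal} {f : ℝ → ℝ} (hf : HypH a f) {t0 t : ℝ} (ht0 : t0 ∈ II a)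
    (ht : t ∈ II a) : 0 ≤ deriv (deriv (GG f t0)) t := by
  have : deriv (GG f t0) =ᶠ[𝓝 t] VV f := by
    filter_upwards [II_nhds ht] with s hs using (GG_deriv hf ht0 hs).deriv
  rw [this.deriv_eq, (VV_deriv hf ht).deriv]
  have := TT_nonneg hf ht
  have := hh_pos hf ht
  positivity

lemma GG_nonpos {a : EReal} {f : ℝ → ℝ} {t0 t : ℝ} (h : t ≤ t0) : GG f t0 t ≤ 0 := by
  unfold GG
  rw [intervalIntegral.integral_symm, neg_nonpos]
  exact intervalIntegral.integral_nonneg h fun s _ => Real.sqrt_nonneg _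

lemma GG_nonneg {f : ℝ → ℝ} {t0 t : ℝ} (h : t0 ≤ t) : 0 ≤ GG f t0 t :=
  intervalIntegral.integral_nonneg h fun s _ => Real.sqrt_nonneg _

lemma GG_lower {a : EReal} {f : ℝ → ℝ} (hf : HypH a f) {t0 t : ℝ} (ht0 : t0 ∈ II a)
    (ht : t ∈ II a) : -(VV f t0 * t0) ≤ GG f t0 t := by
  have hV := VV_pos hf ht0
  have h0 := ht0.1
  rcases le_total t0 t with h | h
  · have := GG_nonneg (f := f) h
    have : 0 ≤ VV f t0 * t0 := by positivity
    linarith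
  · have h1 : ‖GG f t0 t‖ ≤ VV f t0 * |t - t0| := by
      refine intervalIntegral.norm_integral_le_of_norm_le_const fun s hs => ?_
      rw [uIoc_of_ge h] at hs
      rw [Real.norm_of_nonneg (show 0 ≤ VV f s from Real.sqrt_nonneg _)]
      exact V_mono hf (II_down ht0 (ht.1.trans hs.1) hs.2) ht0 hs.2
    have h2 : |t - t0| ≤ t0 := by
      rw [abs_le]; have := ht.1; constructor <;> linarith
    have h3 := (abs_le.1 (h1.trans (mul_le_mul_of_nonneg_left h2 hV.le))).1
    exact h3

lemma GG_mono {a : EReal} {f : ℝ → ℝ} (hf : HypH a f) {t0 s t : ℝ} (ht0 : t0 ∈ II a)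
    (ht : t ∈ II a) (hs : t0 ≤ s) (hst : s ≤ t) : GG f t0 s ≤ GG f t0 t :=
  mono_tool (g := GG f t0) ht0 (fun r hr _ => ⟨GG_deriv hf ht0 hr, (VV_pos hf hr).le⟩) ht hs hst

lemma hh_le_GG {a : EReal} {f : ℝ → ℝ} (hf : HypH a f) {t0 t : ℝ} (ht0 : t0 ∈ II a)
    (ht : t ∈ II a) (h : t0 ≤ t) : hh f t ≤ hh f t0 + GG f t0 t := by
  have := mono_tool (g := fun t => GG f t0 t - hh f t) ht0 (fun r hr _ =>
    ⟨(GG_deriv hf ht0 hr).sub (hh_deriv hf hr), by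
      have := mul_nonneg (VV_pos hf hr).le (TT_nonneg hf hr)
      linarith⟩) ht le_rfl h
  have h0 : GG f t0 t0 = 0 := intervalIntegral.integral_same
  simp only [h0] at this
  linarith

lemma GG_le_hh {a : EReal} {f : ℝ → ℝ} (hf : HypH a f) {τ ε t0 t : ℝ} (N : Near a f τ ε t0)
    (ht : t ∈ II a) (h : t0 ≤ t) : (1 - (τ + ε) / 2) * GG f t0 t ≤ hh f t - hh f t0 := by
  have := mono_tool (g := fun t => hh f t - (1 - (τ + ε) / 2) * GG f t0 t) N.mem (fun r hr h1 =>
    ⟨(hh_deriv hf hr).sub ((GG_deriv hf N.mem hr).const_mul _), by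
      have h2 := (N.hT r hr h1).2
      have := mul_nonneg (VV_pos hf hr).le (by linarith : 0 ≤ τ + ε - TT f r)
      linarith⟩) ht le_rfl h
  have h0 : GG f t0 t0 = 0 := intervalIntegral.integral_same
  simp only [h0] at this
  linarith

lemma pt_bounds {a : EReal} {f : ℝ → ℝ} (hf : HypH a f) {τ α c1 ε σ t0 : ℝ}
    (P : Par τ α c1 ε σ) (N : Near a f τ ε t0) {η E : ℝ → ℝ} (H : EtaE a f α c1 t0 η E) :
    ∃ C ≥ 0, ∀ t ∈ II a, (1 + VV f t) ^ (1 + 2 * α / σ) ≤ C * (1 + VV f t * η t ^ 2) ∧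
      max (GG f t0 t) 0 ≤ C * (1 + VV f t * η t ^ 2) := by
  have hα := P.hα
  have hσ := P.hσ
  set k0 := 1 - (τ + ε) / 2 with hk0
  have hk : 0 < k0 := by rw [hk0]; linarith [P.hε2]
  obtain ⟨CV, hCV, hV⟩ := VV_le hf P N
  obtain ⟨M, hM1, hM⟩ := pow_large hα (hh f t0) (δ := 1 / 2) (by norm_num)
  obtain ⟨t2, ht2, h02, hlarge⟩ := hh_large hf P.hε2 N M
  set p := 1 + 2 * α / σ with hp
  have hp0 : 0 < p := by positivity
  set V0 := VV f t0 with hV0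
  have hV0p : 0 < V0 := VV_pos hf N.mem
  set C1 := (1 + VV f t2) ^ p with hC1
  have hVt2 := VV_pos hf ht2
  set C2 := (2:ℝ) ^ p * (1 + 2 * CV ^ (2 * α / σ)) with hC2
  set C3 := GG f t0 t2 with hC3
  have hC3p : 0 ≤ C3 := GG_nonneg h02
  set C4 := 2 / (k0 * V0) with hC4
  have a1 : 0 ≤ C1 := by positivity
  have a2 : 0 ≤ C2 := by positivity
  have a4 : 0 ≤ C4 := by positivity
  refine ⟨C1 + C2 + C3 + C4, by positivity, fun t ht => ?_⟩
  have hVt := VV_pos hf ht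
  have hJ : 0 ≤ VV f t * η t ^ 2 := by positivity
  rcases le_total t2 t with h | h
  · have hHM := hlarge t ht h
    obtain ⟨b1, b2, b3⟩ := hM _ hHM
    have hH1 : 1 ≤ hh f t := hM1.trans hHM
    have hH := hh_pos hf ht
    have b4 : ((hh f t - hh f t0) ^ α - 2 ^ α) ^ 2 ≤ η t ^ 2 := by
      have := H.etage t ht (h02.trans h)
      have h6 : 0 ≤ (hh f t - hh f t0) ^ α - 2 ^ α := by linarith
      gcongr
    have b5 : hh f t ^ (2 * α) ≤ 2 * η t ^ 2 := by linarith
    have b6 : hh f t ≤ hh f t ^ (2 * α) := by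
      have : hh f t ^ (1:ℝ) ≤ hh f t ^ (2 * α) :=
        Real.rpow_le_rpow_of_exponent_le hH1 (by linarith)
      rwa [Real.rpow_one] at this
    constructor
    · have c1 : VV f t ^ (2 * α / σ) ≤ CV ^ (2 * α / σ) * hh f t ^ (2 * α) := by
        have := Real.rpow_le_rpow hVt.le (hV t ht (h02.trans h)) (by positivity : 0 ≤ 2 * α / σ)
        rw [Real.mul_rpow hCV.le (by positivity), ← Real.rpow_mul hH.le] at this
        rwa [mul_div_cancel₀ _ hσ.ne'] at this
      have c2 : VV f t ^ p = VV f t * VV f t ^ (2 * α / σ) := by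
        rw [hp, Real.rpow_add hVt, Real.rpow_one]
      have c3 : VV f t ^ p ≤ 2 * CV ^ (2 * α / σ) * (VV f t * η t ^ 2) := by
        rw [c2]
        calc _ ≤ VV f t * (CV ^ (2 * α / σ) * (2 * η t ^ 2)) := by
              refine mul_le_mul_of_nonneg_left (c1.trans ?_) hVt.le
              exact mul_le_mul_of_nonneg_left b5 (by positivity)
          _ = _ := by ring
      have c4 : (1 + VV f t) ^ p ≤ 2 ^ p * (1 + VV f t ^ p) := by
        have hV' : 0 ≤ VV f t ^ p := by positivity
        rcases le_total (VV f t) 1 with h1 | h1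
        · have : (1 + VV f t) ^ p ≤ 2 ^ p :=
            Real.rpow_le_rpow (by positivity) (by linarith) hp0.le
          have : 0 ≤ (2:ℝ) ^ p * VV f t ^ p := by positivity
          linarith
        · have : (1 + VV f t) ^ p ≤ (2 * VV f t) ^ p :=
            Real.rpow_le_rpow (by positivity) (by linarith) hp0.le
          rw [Real.mul_rpow (by norm_num) hVt.le] at this
          have : 0 ≤ (2:ℝ) ^ p := by positivity
          linarith
      have c5 : 1 + VV f t ^ p ≤ (1 + 2 * CV ^ (2 * α / σ)) * (1 + VV f t * η t ^ 2) := by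
        have : 0 ≤ 2 * CV ^ (2 * α / σ) := by positivity
        linarith
      calc _ ≤ _ := c4
        _ ≤ 2 ^ p * ((1 + 2 * CV ^ (2 * α / σ)) * (1 + VV f t * η t ^ 2)) :=
          mul_le_mul_of_nonneg_left c5 (by positivity)
        _ = C2 * (1 + VV f t * η t ^ 2) := by rw [hC2]; ring
        _ ≤ _ := mul_le_mul_of_nonneg_right (by linarith) (by linarith)
    · rw [max_eq_left (GG_nonneg (h02.trans h))]
      have c1 := GG_le_hh hf N ht (h02.trans h)
      rw [← hk0] at c1
      have c2 := hh_pos hf N.mem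
      have c3 : k0 * GG f t0 t ≤ 2 * η t ^ 2 := by linarith
      have c4 : V0 ≤ VV f t := V_mono hf N.mem ht (h02.trans h)
      have c5 : GG f t0 t ≤ C4 * (VV f t * η t ^ 2) := by
        have : C4 * (VV f t * η t ^ 2) = (2 * η t ^ 2) * VV f t / (k0 * V0) := by
          rw [hC4]; ring
        rw [this, le_div_iff₀ (by positivity)]
        have e1 := mul_le_mul_of_nonneg_right c3 hV0p.le
        have e2 := mul_le_mul_of_nonneg_left c4 (by positivity : 0 ≤ 2 * η t ^ 2)
        linarith
      calc _ ≤ _ := c5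
        _ ≤ C4 * (1 + VV f t * η t ^ 2) := mul_le_mul_of_nonneg_left (by linarith) a4
        _ ≤ _ := mul_le_mul_of_nonneg_right (by linarith) (by linarith)
  · constructor
    · have : (1 + VV f t) ^ p ≤ C1 :=
        Real.rpow_le_rpow (by positivity)
          (by have : VV f t ≤ VV f t2 := V_mono hf ht ht2 h
              linarith) hp0.le
      have : 0 ≤ (C1 + C2 + C3 + C4) * (VV f t * η t ^ 2) := by positivity
      linarith
    · have : max (GG f t0 t) 0 ≤ C3 := by
        refine max_le ?_ hC3p
        rcases le_total t0 t with h1 | h1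
        · exact GG_mono hf N.mem ht2 h1 h
        · exact (GG_nonpos (a := a) h1).trans hC3p
      have : 0 ≤ (C1 + C2 + C3 + C4) * (VV f t * η t ^ 2) := by positivity
      linarith


def SS (f : ℝ → ℝ) (t0 t w : ℝ) : ℝ := 1 + w + max (GG f t0 t) 0

lemma GP_cont {a : EReal} {f : ℝ → ℝ} (hf : HypH a f) {t0 : ℝ} (ht0 : t0 ∈ II a) :
    ContinuousOn (fun t => max (GG f t0 t) 0) (II a) := (GG_cont hf ht0).sup continuousOn_const

lemma SS_int {Ω : Set (EuclideanSpace ℝ (Fin n))} (hΩ : GoodDomain Ω)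
    {a : EReal} {f : ℝ → ℝ} (hf : HypH a f) {t0 L : ℝ} (ht0 : t0 ∈ II a)
    {u w : EuclideanSpace ℝ (Fin n) → ℝ} (S : Sys Ω a f L u w) :
    IntegrableOn (fun x => w x) Ω ∧ IntegrableOn (fun x => max (GG f t0 (u x)) 0) Ω ∧
      IntegrableOn (fun x => SS f t0 (u x) (w x)) Ω := by
  have i1 : IntegrableOn (fun x => w x) Ω := by
    have := S.int hΩ (g := fun _ => 1) (p := id) continuousOn_const
      (fun t ht => ⟨1, by simp⟩) continuous_id
    simpa using this
  have i2 : IntegrableOn (fun x => max (GG f t0 (u x)) 0) Ω := by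
    have := S.int hΩ (g := fun t => max (GG f t0 t) 0) (p := fun _ => 1) (GP_cont hf ht0)
      (bddII (GP_cont hf ht0) ht0 (C0 := 0)
        (fun s _ h => by simp [max_eq_right (GG_nonpos (a := a) (f := f) h)])) continuous_const
    simpa using this
  exact ⟨i1, i2, ((integrableOn_const hΩ.2.1.measure_lt_top.ne).add i1).add i2⟩

lemma Vp_int {Ω : Set (EuclideanSpace ℝ (Fin n))} (hΩ : GoodDomain Ω)
    {a : EReal} {f : ℝ → ℝ} (hf : HypH a f) {L p : ℝ} (hp : 0 ≤ p)
    {u w : EuclideanSpace ℝ (Fin n) → ℝ} (S : Sys Ω a f L u w) :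
    IntegrableOn (fun x => (1 + VV f (u x)) ^ p) Ω := by
  have hc : ContinuousOn (fun t => (1 + VV f t) ^ p) (II a) :=
    (continuousOn_const.add (V_cont hf)).rpow_const fun t _ => Or.inr hp
  have := S.int hΩ (g := fun t => (1 + VV f t) ^ p) (p := fun _ => 1) hc
    (fun t ht => ⟨(1 + VV f t) ^ p, fun s hs hst => by
      have h1 := VV_pos hf (II_down ht hs hst)
      rw [abs_of_nonneg (by positivity)]
      refine Real.rpow_le_rpow (by positivity) ?_ hp
      have : VV f s ≤ VV f t := V_mono hf (II_down ht hs hst) ht hst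
      linarith⟩) continuous_const
  simpa using this

lemma int_bound2 (hn : 0 < n) {Ω : Set (EuclideanSpace ℝ (Fin n))} (hΩ : GoodDomain Ω)
    {a : EReal} {f : ℝ → ℝ} (hf : HypH a f) {τ α c1 ε σ t0 : ℝ}
    (P : Par τ α c1 ε σ) (N : Near a f τ ε t0) :
    ∃ C ≥ 0, ∀ L u w, Sys Ω a f L u w →
      ∫ x in Ω, (1 + VV f (u x)) ^ (1 + 2 * α / σ) ≤ C ∧
      ∫ x in Ω, SS f t0 (u x) (w x) ≤ C := by
  obtain ⟨η, E, H⟩ := eta_exists hf P N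
  obtain ⟨ζ, E2, h1, h2, h3, h4, h5, h6, -, h8⟩ := zeta_exists P.hα
  obtain ⟨C0, hC0⟩ := int_bound hn hΩ hf P N H h1 h2 h3 h4 h5 h6 h8
  obtain ⟨C1, hC1, hpt⟩ := pt_bounds hf P N H
  have hα := P.hα
  have hσ := P.hσ
  obtain ⟨C2, hC2, hz⟩ := zeta_low hα (δ := 1 / 2) (by norm_num)
  set B := (volume Ω).toReal with hB
  set D1 := C1 * (B + C0) with hD1
  set D2 := B + ((1 + 2 * C2) * B + 2 * C0) + D1 with hD2
  refine ⟨max 0 (max D1 D2), le_max_left _ _, fun L u w S => ?_⟩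
  obtain ⟨q1, q2⟩ := hC0 L u w S
  have m := hΩ.1.measurableSet
  have ic : ∀ c : ℝ, IntegrableOn (fun _ : EuclideanSpace ℝ (Fin n) => c) Ω := fun c =>
    integrableOn_const hΩ.2.1.measure_lt_top.ne
  have hcint : ∀ c : ℝ, ∫ _ in Ω, c = c * B := fun c => by
    rw [setIntegral_const]; simp [Measure.real, hB, mul_comm]
  have i1 : IntegrableOn (fun x => VV f (u x) * η (u x) ^ 2) Ω := by
    have := S.int hΩ (g := fun t => VV f t * η t ^ 2) (p := fun _ => 1)
      ((V_cont hf).mul (H.cont.pow 2)) (bddII ((V_cont hf).mul (H.cont.pow 2)) N.mem (C0 := 0)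
        (fun s _ h => by simp [H.eta0 s h])) continuous_const
    simpa using this
  have i3 : IntegrableOn (fun x => ζ (w x) ^ 2) Ω := by
    have := S.int hΩ (g := fun _ => 1) (p := fun t => ζ t ^ 2) continuousOn_const
      (fun t ht => ⟨1, by simp⟩) (h1.continuous.pow 2)
    simpa using this
  have i4 : IntegrableOn (fun x => C1 * (1 + VV f (u x) * η (u x) ^ 2)) Ω :=
    ((ic 1).add i1).const_mul _
  have e4 : ∫ x in Ω, C1 * (1 + VV f (u x) * η (u x) ^ 2) ≤ D1 := by
    rw [integral_const_mul, integral_add (ic 1) i1, hcint, hD1]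
    refine mul_le_mul_of_nonneg_left ?_ hC1
    linarith
  obtain ⟨j1, j2, j3⟩ := SS_int hΩ hf N.mem S
  have b1 : ∫ x in Ω, (1 + VV f (u x)) ^ (1 + 2 * α / σ) ≤ D1 := by
    refine le_trans (setIntegral_mono_on (Vp_int hΩ hf (by positivity) S) i4 m fun x hx => ?_) e4
    exact (hpt _ (S.uI x hx)).1
  have b2 : ∫ x in Ω, max (GG f t0 (u x)) 0 ≤ D1 := by
    refine le_trans (setIntegral_mono_on j2 i4 m fun x hx => ?_) e4
    exact (hpt _ (S.uI x hx)).2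
  have b3 : ∫ x in Ω, w x ≤ (1 + 2 * C2) * B + 2 * C0 := by
    have : ∫ x in Ω, w x ≤ ∫ x in Ω, ((1 + 2 * C2) + 2 * ζ (w x) ^ 2) := by
      refine setIntegral_mono_on j1 ((ic _).add (i3.const_mul _)) m fun x hx => ?_
      have hw := (S.wpos x hx).le
      have a1 := hz _ _ hw (h5 _) (h6 _ hw)
      have a2 : w x ≤ 1 + w x ^ (2 * α) := by
        have : 0 ≤ w x ^ (2 * α) := by positivity
        rcases le_total (w x) 1 with h | h
        · linarith
        · have : w x ^ (1:ℝ) ≤ w x ^ (2 * α) :=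
            Real.rpow_le_rpow_of_exponent_le h (by linarith)
          rw [Real.rpow_one] at this; linarith
      linarith
    rw [integral_add (ic _) (i3.const_mul _), hcint, integral_const_mul] at this
    linarith
  refine ⟨b1.trans ((le_max_left _ _).trans (le_max_right _ _)), ?_⟩
  refine le_trans ?_ ((le_max_right _ _).trans (le_max_right _ _))
  have : ∫ x in Ω, SS f t0 (u x) (w x) = B + (∫ x in Ω, w x) + ∫ x in Ω, max (GG f t0 (u x)) 0 := by
    unfold SS
    have k1 : IntegrableOn (fun x => 1 + w x) Ω := (ic 1).add j1
    rw [integral_add k1 j2, integral_add (ic 1) j1, hcint, one_mul]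
  rw [this, hD2]
  linarith

lemma holder_pt {K v S M r p : ℝ} (hK : 0 ≤ K) (hv : 0 ≤ v) (hS : 1 ≤ S) (hSM : S ≤ M)
    (hr : 0 < r) (hp : 0 < p) (h : r + 1 / p < 1) :
    K * (v * S) ≤ M ^ (r + 1 / p) * (K ^ (1 / r) + v ^ p + S) := by
  have hS0 : 0 < S := by linarith
  have hp' : 0 < 1 / p := by positivity
  have g := Real.geom_mean_le_arith_mean3_weighted (w₁ := r) (w₂ := 1 / p) (w₃ := 1 - (r + 1 / p))
    (p₁ := K ^ (1 / r)) (p₂ := v ^ p) (p₃ := S) hr.le hp'.le (by linarith) (by positivity)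
    (by positivity) hS0.le (by ring)
  rw [← Real.rpow_mul hK, ← Real.rpow_mul hv, one_div_mul_cancel hr.ne', mul_one_div_cancel hp.ne',
    Real.rpow_one, Real.rpow_one] at g
  have a1 : 0 ≤ K ^ (1 / r) := by positivity
  have a2 : 0 ≤ v ^ p := by positivity
  have g2 : K * v * S ^ (1 - (r + 1 / p)) ≤ K ^ (1 / r) + v ^ p + S := by
    have e1 : r * K ^ (1 / r) ≤ 1 * K ^ (1 / r) := mul_le_mul_of_nonneg_right (by linarith) a1
    have e2 : 1 / p * v ^ p ≤ 1 * v ^ p := mul_le_mul_of_nonneg_right (by linarith) a2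
    have e3 : (1 - (r + 1 / p)) * S ≤ 1 * S := mul_le_mul_of_nonneg_right (by linarith) hS0.le
    linarith
  have e4 : S = S ^ (r + 1 / p) * S ^ (1 - (r + 1 / p)) := by
    rw [← Real.rpow_add hS0]; simp
  have e5 : S ^ (r + 1 / p) ≤ M ^ (r + 1 / p) := Real.rpow_le_rpow hS0.le hSM (by linarith)
  calc K * (v * S) = S ^ (r + 1 / p) * (K * v * S ^ (1 - (r + 1 / p))) := by
        nth_rewrite 1 [e4]; ring
    _ ≤ M ^ (r + 1 / p) * (K * v * S ^ (1 - (r + 1 / p))) :=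
      mul_le_mul_of_nonneg_right e5 (by positivity)
    _ ≤ _ := mul_le_mul_of_nonneg_left g2 (Real.rpow_nonneg (by linarith) _)

lemma Hf_exists {Ω : Set (EuclideanSpace ℝ (Fin n))} (hΩ : GoodDomain Ω)
    {a : EReal} {f : ℝ → ℝ} (hf : HypH a f) {t0 L L0 : ℝ} (ht0 : t0 ∈ II a)
    {u w : EuclideanSpace ℝ (Fin n) → ℝ} (S : Sys Ω a f L u w) (hL : L ≤ L0) :
    ∃ Hf : EuclideanSpace ℝ (Fin n) → ℝ, ContDiff ℝ 2 Hf ∧ HasCompactSupport Hf ∧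
      tsupport Hf ⊆ Ω ∧ (∀ y, 0 ≤ Hf y) ∧
      (∀ y ∈ Ω, -lap Hf y ≤ L0 * (f t0 + hh f t0 + 1) *
        ((1 + VV f (u y)) * SS f t0 (u y) (w y))) ∧
      ∀ y ∈ Ω, SS f t0 (u y) (w y) ≤ 3 + VV f t0 * t0 + Hf y := by
  obtain ⟨ψ, p1, p2, p3, p4, p5, p6, p7⟩ := psi_exists
  set Z : EuclideanSpace ℝ (Fin n) → ℝ := fun x => w x + GG f t0 (u x) with hZ
  have hGu : ∀ x ∈ Ω, ContDiffAt ℝ (⊤ : ℕ∞) (fun x => GG f t0 (u x)) x := fun x hx =>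
    (GG_smooth hf ht0 (S.uI x hx)).comp x S.hu.contDiffAt
  have hZs : ∀ x ∈ Ω, ContDiffAt ℝ (⊤ : ℕ∞) Z x := fun x hx => S.hw.contDiffAt.add (hGu x hx)
  set K := (closure Ω ∩ {x | t0 ≤ u x}) ∪ (closure Ω ∩ {x | 1 ≤ w x}) with hKdef
  have hK : IsCompact K := (superlevel_compact hΩ.2.1 S.hu.continuous t0).union
    (superlevel_compact hΩ.2.1 S.hw.continuous 1)
  have hKΩ : K ⊆ Ω := union_subset (superlevel_sub hΩ.1 ht0.1 S.u0)
    (superlevel_sub hΩ.1 one_pos S.w0)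
  have h0 : ∀ x ∈ Ω, x ∉ K → ψ (Z x) = 0 := fun x hx hxK => by
    have h1 : u x ≤ t0 := by
      by_contra h
      exact hxK (Or.inl ⟨subset_closure hx, (not_le.1 h).le⟩)
    have h2 : w x ≤ 1 := by
      by_contra h
      exact hxK (Or.inr ⟨subset_closure hx, (not_le.1 h).le⟩)
    have h3 := GG_nonpos (a := a) (f := f) h1
    exact p2 _ (by simp only [hZ]; linarith)
  have hq : ∀ x ∈ Ω, ContDiffAt ℝ (⊤ : ℕ∞) (fun x => ψ (Z x)) x := fun x hx =>
    p1.contDiffAt.comp x (hZs x hx)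
  refine ⟨Ω.indicator (fun x => ψ (Z x)), (loc_contDiff hΩ.1 hK hKΩ hq h0).of_le two_le_inf,
    loc_hcs hK h0, (loc_supp hK h0).trans hKΩ, fun y => indicator_nonneg (fun _ _ => p3 _) y,
    fun y hy => ?_, fun y hy => ?_⟩
  · have hV := VV_pos hf (S.uI y hy)
    have hfy := hf.pos _ (II_sub (S.uI y hy))
    have hwy := S.wpos y hy
    have hft0 := hf.pos _ (II_sub ht0)
    have hh0 := hh_pos hf ht0
    rw [lap_congr (loc_eventually hΩ.1 _ hy),
      lap_comp ((hZs y hy).of_le two_le_inf) (p1.contDiffAt.of_le two_le_inf)]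
    have l1 : lap Z y = lap w y + lap (fun x => GG f t0 (u x)) y :=
      lap_add (S.hw.contDiffAt.of_le two_le_inf) ((hGu y hy).of_le two_le_inf)
    rw [lap_comp (S.hu.contDiffAt.of_le two_le_inf)
      ((GG_smooth hf ht0 (S.uI y hy)).of_le two_le_inf), S.lw y hy, S.lu y,
      (GG_deriv hf ht0 (S.uI y hy)).deriv] at l1
    have n1 : 0 ≤ deriv (deriv (GG f t0)) (u y) * ∑ i, (fderiv ℝ u y (ee i)) ^ 2 :=
      mul_nonneg (GG_deriv2 hf ht0 (S.uI y hy)) (Finset.sum_nonneg fun i _ => sq_nonneg _)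
    have n2 : 0 ≤ deriv (deriv ψ) (Z y) * ∑ i, (fderiv ℝ Z y (ee i)) ^ 2 :=
      mul_nonneg (p6 _) (Finset.sum_nonneg fun i _ => sq_nonneg _)
    have n3 : -lap Z y ≤ L * (f (u y) + VV f (u y) * w y) := by rw [l1]; linarith
    have n4 : 0 ≤ L * (f (u y) + VV f (u y) * w y) := by
      have := S.Lpos; positivity
    have n5 : -(deriv ψ (Z y) * lap Z y) ≤ L * (f (u y) + VV f (u y) * w y) := by
      have e1 := mul_le_mul_of_nonneg_left n3 (p4 (Z y)).1
      have e2 := mul_le_mul_of_nonneg_right (p4 (Z y)).2 n4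
      linarith
    set g := max (GG f t0 (u y)) 0 with hg
    have hg0 : 0 ≤ g := le_max_right _ _
    have n6 : f (u y) ≤ f t0 + VV f (u y) * (hh f t0 + g) := by
      rcases le_total t0 (u y) with h | h
      · rw [f_eq hf (S.uI y hy)]
        have e1 := hh_le_GG hf ht0 (S.uI y hy) h
        have e2 : GG f t0 (u y) ≤ g := le_max_left _ _
        have e3 := mul_le_mul_of_nonneg_left (e1.trans (by linarith : _ ≤ hh f t0 + g)) hV.le
        linarith
      · have e1 : f (u y) ≤ f t0 := hf.mono.monotoneOn (II_sub (S.uI y hy)) (II_sub ht0) h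
        have : 0 ≤ VV f (u y) * (hh f t0 + g) := by positivity
        linarith
    have n7 : f (u y) + VV f (u y) * w y ≤ (f t0 + hh f t0 + 1) *
        ((1 + VV f (u y)) * SS f t0 (u y) (w y)) := by
      have : (f t0 + hh f t0 + 1) * ((1 + VV f (u y)) * SS f t0 (u y) (w y)) -
        (f t0 + VV f (u y) * (hh f t0 + g) + VV f (u y) * w y) =
        (f t0 + hh f t0 + 1) * (w y + g) + (hh f t0 + 1) + VV f (u y) * (f t0 + 1)
        + (f t0 + hh f t0) * (VV f (u y) * (w y + g)) := by
        unfold SS; rw [← hg]; ring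
      have : 0 ≤ (f t0 + hh f t0 + 1) * (w y + g) + (hh f t0 + 1) + VV f (u y) * (f t0 + 1)
        + (f t0 + hh f t0) * (VV f (u y) * (w y + g)) := by positivity
      linarith
    have n8 := mul_le_mul_of_nonneg_left n7 S.Lpos.le
    have n9 : 0 ≤ (f t0 + hh f t0 + 1) * ((1 + VV f (u y)) * SS f t0 (u y) (w y)) := by
      have : 0 ≤ f (u y) + VV f (u y) * w y := by positivity
      linarith
    have n10 := mul_le_mul_of_nonneg_right hL n9
    linarith
  · have e1 : Ω.indicator (fun x => ψ (Z x)) y = ψ (Z y) := indicator_of_mem hy _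
    rw [e1]
    have e2 := p7 (Z y)
    have e3 := GG_lower hf ht0 (S.uI y hy)
    have e4 : 0 ≤ VV f t0 * t0 := mul_nonneg (VV_pos hf ht0).le ht0.1.le
    have e5 : max (GG f t0 (u y)) 0 ≤ GG f t0 (u y) + VV f t0 * t0 :=
      max_le (by linarith) (by linarith)
    have e6 : Z y = w y + GG f t0 (u y) := rfl
    unfold SS
    linarith


set_option maxHeartbeats 800000 in
lemma linf (hn : 0 < n) (hn7 : n ≤ 7) {Ω : Set (EuclideanSpace ℝ (Fin n))} (hΩ : GoodDomain Ω)
    {a : EReal} {f : ℝ → ℝ} (hf : HypH a f) {τ α c1 ε σ t0 : ℝ}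
    (P : Par τ α c1 ε σ) (N : Near a f τ ε t0) :
    ∃ M0 : ℝ, ∀ L u w, Sys Ω a f L u w → ∀ x ∈ Ω, SS f t0 (u x) (w x) ≤ M0 := by
  have hα := P.hα
  have hσ := P.hσ
  have hn0 : (0:ℝ) < n := by exact_mod_cast hn
  obtain ⟨L0, hL0, hL⟩ := L_bound hn hΩ hf
  obtain ⟨C, hC, hintg⟩ := int_bound2 hn hΩ hf P N
  set p := 1 + 2 * α / σ with hp
  have hp72 : 7 / 2 < p := by
    have : 5 / 2 < 2 * α / σ := by rw [lt_div_iff₀ hσ]; linarith [P.hσα]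
    rw [hp]; linarith
  have hp0 : 0 < p := by linarith
  have hpi : 1 / p < 2 / 7 := by rw [div_lt_div_iff₀ hp0 (by norm_num)]; linarith
  obtain ⟨r, hr1, hr2⟩ : ∃ r, 5 / 7 < r ∧ r < 1 - 1 / p := exists_between (by linarith)
  have hr0 : 0 < r := by linarith
  set θ := r + 1 / p with hθ
  have hθ1 : θ < 1 := by rw [hθ]; linarith
  have hθ0 : 0 < θ := by positivity
  -- diameter bound
  obtain ⟨R', hR'⟩ := hΩ.2.1.exists_norm_le
  set D := 2 * |R'| + 1 with hD
  have hDp : 0 < D := by positivity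
  have hdist : ∀ x ∈ Ω, ∀ y ∈ Ω, ‖y - x‖ < D := fun x hx y hy => by
    have h1 := norm_sub_le y x
    have h2 := hR' x hx
    have h3 := hR' y hy
    have h4 := le_abs_self R'
    rw [hD]; linarith
  obtain ⟨Ck, hCk, hker⟩ := kernel_bound hn hn7 hDp
  obtain ⟨Ci, hki⟩ := kernel_int (D := D) hn (r := 5 * n / 7 * (1 / r)) (by positivity) (by
    rw [mul_one_div, div_lt_iff₀ hr0]; nlinarith)
  obtain ⟨Ci', hki'⟩ := kernel_int (D := D) hn (r := 5 * n / 7) (by positivity) (by linarith)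
  set C5 := L0 * (f t0 + hh f t0 + 1) with hC5
  have hft0 := hf.pos _ (II_sub N.mem)
  have hh0 := hh_pos hf N.mem
  have hC5p : 0 < C5 := by positivity
  set C6 := Ck * (C5 * (|Ci| + C + C)) with hC6
  have hC6p : 0 ≤ C6 := by positivity
  set C7 := 3 + VV f t0 * t0 with hC7
  have hC7p : 0 < C7 := by
    have := VV_pos hf N.mem
    have := N.mem.1
    positivity
  refine ⟨(C7 + C6) ^ (1 / (1 - θ)), fun L u w S => ?_⟩
  have m := hΩ.1.measurableSet
  obtain ⟨q1, q2⟩ := hintg L u w S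
  obtain ⟨Hf, H1, H2, H3, H4, H5, H6⟩ := Hf_exists hΩ hf N.mem S (hL L u w S)
  obtain ⟨tm, htm, hum⟩ := S.max hΩ
  obtain ⟨wm, hwm0, hwm⟩ := S.wmax hΩ
  have hS1 : ∀ x ∈ Ω, 1 ≤ SS f t0 (u x) (w x) := fun x hx => by
    have := S.wpos x hx
    have : 0 ≤ max (GG f t0 (u x)) 0 := le_max_right _ _
    unfold SS; linarith
  obtain ⟨gm, hgm⟩ := bddII (GP_cont hf N.mem) N.mem (C0 := 0)
    (fun s _ h => by simp [max_eq_right (GG_nonpos (a := a) (f := f) h)]) tm htm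
  have hSb : ∀ x ∈ Ω, SS f t0 (u x) (w x) ≤ 1 + wm + gm := fun x hx => by
    have h1 := hwm x hx
    have h2 := (le_abs_self _).trans (hgm (u x) (S.uI x hx).1 (hum x hx))
    unfold SS; linarith
  have hVb : ∀ x ∈ Ω, VV f (u x) ≤ VV f tm := fun x hx =>
    V_mono hf (S.uI x hx) htm (hum x hx)
  obtain ⟨-, -, iS⟩ := SS_int hΩ hf N.mem S
  have iV := Vp_int hΩ hf hp0.le S
  have iV1 : IntegrableOn (fun x => 1 + VV f (u x)) Ω := by
    have := Vp_int hΩ hf zero_le_one S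
    simpa using this
  set T := (fun x => SS f t0 (u x) (w x)) '' Ω with hT
  have hTb : BddAbove T := ⟨1 + wm + gm, by rintro _ ⟨x, hx, rfl⟩; exact hSb x hx⟩
  have hTn : T.Nonempty := hΩ.2.2.image _
  set M := sSup T with hM
  have hSM : ∀ x ∈ Ω, SS f t0 (u x) (w x) ≤ M := fun x hx => le_csSup hTb ⟨x, hx, rfl⟩
  have hM1 : 1 ≤ M := by
    obtain ⟨x, hx⟩ := hΩ.2.2
    exact (hS1 x hx).trans (hSM x hx)
  have key : ∀ x ∈ Ω, SS f t0 (u x) (w x) ≤ C7 + C6 * M ^ θ := by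
    intro x hx
    set K : EuclideanSpace ℝ (Fin n) → ℝ := fun y => ‖y - x‖ ^ (-(5 * n / 7 : ℝ)) with hK
    have hK0 : ∀ y, 0 ≤ K y := fun y => by positivity
    have hKr : ∀ y, K y ^ (1 / r) = ‖y - x‖ ^ (-(5 * n / 7 * (1 / r) : ℝ)) := fun y => by
      simp only [hK]; rw [← Real.rpow_mul (norm_nonneg _)]; congr 1; ring
    obtain ⟨ik, ek⟩ := hki Ω x m (hdist x hx)
    obtain ⟨ik', -⟩ := hki' Ω x m (hdist x hx)
    set ρ : EuclideanSpace ℝ (Fin n) → ℝ := fun y =>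
      C5 * ((1 + VV f (u y)) * SS f t0 (u y) (w y)) with hρ
    have iρ0 : IntegrableOn (fun y => K y * ((1 + VV f (u y)) * SS f t0 (u y) (w y))) Ω := by
      refine Integrable.mul_bdd (c := (1 + VV f tm) * M) ik'
        (iV1.aestronglyMeasurable.mul iS.aestronglyMeasurable) ?_
      refine (ae_restrict_iff' m).2 (Eventually.of_forall fun y hy => ?_)
      have h1 := hVb y hy
      have h2 := hSM y hy
      have h3 := hS1 y hy
      have h4 := VV_pos hf (S.uI y hy)
      rw [Real.norm_of_nonneg (by positivity)]
      exact mul_le_mul (by linarith) h2 (by linarith) (by linarith)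
    have iρ : IntegrableOn (fun y => K y * ρ y) Ω := by
      have i := iρ0.const_mul C5
      refine i.congr (Eventually.of_forall fun y => ?_)
      simp only [hρ]; ring
    have hb := hker Ω x hΩ.1 (fun y hy => (hdist x hx y hy).le) Hf ρ H1 H2 H3 H4 (fun y hy => by
      have h3 := hS1 y hy
      have h4 := VV_pos hf (S.uI y hy)
      simp only [hρ]; positivity) H5 iρ
    have iJ : IntegrableOn (fun y => K y ^ (1 / r) + (1 + VV f (u y)) ^ p
        + SS f t0 (u y) (w y)) Ω := by
      refine (Integrable.add ?_ iV).add iS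
      simp only [hKr]; exact ik
    have est : ∫ y in Ω, K y * ρ y ≤ C5 * (M ^ θ * (|Ci| + C + C)) := by
      have e1 : ∫ y in Ω, K y * ρ y =
          C5 * ∫ y in Ω, K y * ((1 + VV f (u y)) * SS f t0 (u y) (w y)) := by
        rw [← integral_const_mul]
        refine setIntegral_congr_fun m fun y _ => ?_
        simp only [hρ]; ring
      have e2 : ∫ y in Ω, K y * ((1 + VV f (u y)) * SS f t0 (u y) (w y)) ≤
          ∫ y in Ω, M ^ θ * (K y ^ (1 / r) + (1 + VV f (u y)) ^ p + SS f t0 (u y) (w y)) := by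
        refine setIntegral_mono_on iρ0 (iJ.const_mul _) m fun y hy => ?_
        exact holder_pt (hK0 y) (by have := VV_pos hf (S.uI y hy); positivity) (hS1 y hy)
          (hSM y hy) hr0 hp0 hθ1
      have e3 : ∫ y in Ω, (K y ^ (1 / r) + (1 + VV f (u y)) ^ p + SS f t0 (u y) (w y))
          ≤ |Ci| + C + C := by
        have ikr : IntegrableOn (fun y => K y ^ (1 / r)) Ω := by simp only [hKr]; exact ik
        have j1 : IntegrableOn (fun y => K y ^ (1 / r) + (1 + VV f (u y)) ^ p) Ω := ikr.add iV
        rw [integral_add j1 iS, integral_add ikr iV]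
        have : ∫ y in Ω, K y ^ (1 / r) ≤ |Ci| := by
          simp only [hKr]; exact ek.trans (le_abs_self _)
        linarith
      rw [e1]
      refine mul_le_mul_of_nonneg_left (e2.trans ?_) hC5p.le
      rw [integral_const_mul]
      exact mul_le_mul_of_nonneg_left e3 (Real.rpow_nonneg (by linarith) _)
    have h8 := mul_le_mul_of_nonneg_left est hCk.le
    have h9 := H6 x hx
    calc _ ≤ _ := h9
      _ ≤ C7 + Ck * (C5 * (M ^ θ * (|Ci| + C + C))) := by
        have := hb.trans h8
        linarith
      _ = _ := by rw [hC6]; ring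
  have hMle : M ≤ C7 + C6 * M ^ θ := csSup_le hTn (by rintro _ ⟨x, hx, rfl⟩; exact key x hx)
  have hMp : 0 < M := by linarith
  have hMθ : 1 ≤ M ^ θ := Real.one_le_rpow hM1 hθ0.le
  have h1 : M ≤ (C7 + C6) * M ^ θ := by
    have := mul_le_mul_of_nonneg_left hMθ hC7p.le
    linarith
  have h2 : M ^ (1 - θ) ≤ C7 + C6 := by
    have e : M = M ^ (1 - θ) * M ^ θ := by rw [← Real.rpow_add hMp]; simp
    have h3 : M ^ (1 - θ) * M ^ θ ≤ (C7 + C6) * M ^ θ := by rw [← e]; exact h1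
    exact le_of_mul_le_mul_right h3 (by linarith)
  have h3 : M ≤ (C7 + C6) ^ (1 / (1 - θ)) := by
    have := Real.rpow_le_rpow (by positivity) h2 (by
      have : 0 < 1 - θ := by linarith
      positivity : 0 ≤ 1 / (1 - θ))
    rwa [← Real.rpow_mul hMp.le, mul_one_div_cancel (by linarith : (1 - θ) ≠ 0), Real.rpow_one]
      at this
  exact fun x hx => (hSM x hx).trans h3

lemma final_bound (hn : 0 < n) (hn7 : n ≤ 7) {Ω : Set (EuclideanSpace ℝ (Fin n))}
    (hΩ : GoodDomain Ω)
    {a : EReal} {f : ℝ → ℝ} (hf : HypH a f) {τ α c1 ε σ t0 : ℝ}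
    (P : Par τ α c1 ε σ) (N : Near a f τ ε t0) :
    ∃ t1 ∈ II a, ∀ L u w, Sys Ω a f L u w → ∀ x ∈ Ω, u x ≤ t1 := by
  obtain ⟨M0, hM0⟩ := linf hn hn7 hΩ hf P N
  obtain ⟨t1, ht1, h01, h⟩ := hh_large hf P.hε2 N (hh f t0 + M0)
  refine ⟨t1, ht1, fun L u w S x hx => ?_⟩
  by_contra hlt
  push Not at hlt
  have h1 := h (u x) (S.uI x hx) hlt.le
  have h2 := hh_le_GG hf N.mem (S.uI x hx) (h01.trans hlt.le)
  have h3 := hM0 L u w S x hx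
  have h4 : GG f t0 (u x) ≤ max (GG f t0 (u x)) 0 := le_max_left _ _
  have h5 := S.wpos x hx
  unfold SS at h3
  linarith

/-- If `f` satisfies (H) with `τ₋ = τ₊ =: τ` and `0 < τ ≤ 1.57863`, and `n ≤ 7`, then any
sequence of semistable solutions of `(N_{λ_m})` satisfying the stability inequality is
uniformly bounded away from `a_f` in `L^∞(Ω)`. -/
theorem statement2 {n : ℕ} (hn : n ≤ 7) (Ω : Set (EuclideanSpace ℝ (Fin n)))
    (hΩ : GoodDomain Ω) (a : EReal) (f : ℝ → ℝ) (hf : HypH a f)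
    (heq : tauMinus a f = tauPlus a f) (hτ0 : 0 < tauPlus a f)
    (hτ1 : tauPlus a f ≤ 1.57863)
    (lam : ℕ → ℝ) (hlam : ∀ m, 0 < lam m)
    (u : ℕ → EuclideanSpace ℝ (Fin n) → ℝ)
    (hsol : ∀ m, Solves Ω a (lam m) f (u m))
    (hsemi : ∀ m, Semistable Ω (lam m) f (u m))
    (hstab : ∀ m, StabIneq Ω (lam m) f (u m)) :
    ∃ C : ℝ, (C : EReal) < a ∧ ∀ m, ∀ x ∈ Ω, u m x ≤ C := by
  rcases Nat.eq_zero_or_pos n with h0 | hn0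
  · subst h0
    obtain ⟨x, hx⟩ := hΩ.2.2
    obtain ⟨-, h1, h2, -⟩ := hsol 0
    have h3 := h2 x hx
    have h4 : lap (lap (u 0)) x = 0 := by unfold lap; simp
    have h5 := mul_pos (hlam 0) (hf.pos (u 0 x) (h1 x hx))
    rw [h4] at h3
    linarith
  · obtain ⟨α, c1, ε, σ, P⟩ := par_exists hτ0 hτ1
    obtain ⟨t0, N⟩ := near_exists hf heq hτ0 P.hε
    obtain ⟨t1, ht1, hb⟩ := final_bound hn0 hn hΩ hf P N
    exact ⟨t1, ht1.2, fun m x hx =>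
      hb _ _ _ (sys_of_solves hn0 hΩ hf (hlam m) (hsol m) (hstab m)) x hx⟩

end
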